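/- arXiv:2308.12268 — 2 statements merged into one kernel-verified Lean document; each statement's English description precedes it below -/
import Mathlib

section
/- Fix an integer r ≥ 2 and an r-partite r-pattern P. Then there exists a constant C = C(r) > 0 such that for all positive integers n: e^{−Cn}·n^{(r−1−1/(r−1))n} ≤ N_P(n) ≤ e^{Cn}·n^{(r−1−1/(r−1))n}. -/
/-- An ordered `r`-matching of size `n`: a partition of `{1,…,r*n}` into `n`
edges, each of size `r`. -/
def IsOrderedMatching (r n : ℕ) (M : Finset (Finset ℕ)) : Prop :=
  M.card = n ∧ (∀ e ∈ M, e.card = r) ∧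
    (∀ e ∈ M, ∀ f ∈ M, e ≠ f → Disjoint e f) ∧
    M.biUnion id = Finset.Icc 1 (r * n)

/-- Two edges `e, f` form the pattern `P`: there is a strictly increasing map
on `e ∪ f` sending the pair `{e, f}` to the pair of edges of `P`. -/
def FormsPattern (e f : Finset ℕ) (P : Finset (Finset ℕ)) : Prop :=
  ∃ φ : ℕ → ℕ, StrictMonoOn φ (↑(e ∪ f) : Set ℕ) ∧
    ({e.image φ, f.image φ} : Finset (Finset ℕ)) = P

/-- An `r`-pattern: an ordered `r`-matching of size `2` (on `{1,…,2r}`). -/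
def IsPattern (r : ℕ) (P : Finset (Finset ℕ)) : Prop :=
  IsOrderedMatching r 2 P

/-- A collection of edges in which every pair of distinct edges forms `P`. -/
def IsPatternClique (P S : Finset (Finset ℕ)) : Prop :=
  ∀ e ∈ S, ∀ f ∈ S, e ≠ f → FormsPattern e f P

/-- `L_P(M)`: the maximum size of a sub-matching of `M` which is a `P`-clique. -/
noncomputable def cliqueSize (P M : Finset (Finset ℕ)) : ℕ :=
  sSup {k | ∃ S ⊆ M, IsPatternClique P S ∧ S.card = k}

/-- `L(M) = max_P L_P(M)`, the maximum over all `r`-patterns `P`. -/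
noncomputable def Lmax (r : ℕ) (M : Finset (Finset ℕ)) : ℕ :=
  sSup {k | ∃ P, IsPattern r P ∧ cliqueSize P M = k}

/-- An ordered `r`-matching on `{1,…,r*n}` is `r`-partite if, dividing the
vertex set into `r` contiguous intervals of length `n`, every edge has exactly
one vertex in each interval. -/
def IsPartite (r n : ℕ) (M : Finset (Finset ℕ)) : Prop :=
  ∀ e ∈ M, ∀ i : ℕ, 1 ≤ i → i ≤ r →
    (e ∩ Finset.Icc ((i - 1) * n + 1) (i * n)).card = 1

/-- `N_P(n)`: the number of ordered `r`-matchings on `{1,…,r*n}` in which no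
two edges form the pattern `P`. -/
noncomputable def patternFreeCount (r n : ℕ) (P : Finset (Finset ℕ)) : ℕ :=
  Nat.card {M : Finset (Finset ℕ) // IsOrderedMatching r n M ∧
    ∀ e ∈ M, ∀ f ∈ M, e ≠ f → ¬ FormsPattern e f P}

/-- The edge whose vertices are the values of `x`. -/
def edgeOf {r : ℕ} (x : Fin r → ℕ) : Finset ℕ := Finset.univ.image x

theorem mem_edgeOf {r : ℕ} {x : Fin r → ℕ} {v : ℕ} : v ∈ edgeOf x ↔ ∃ i, x i = v := by
  simp [edgeOf]

theorem eq_of_edgeOf_eq {r : ℕ} {x y : Fin r → ℕ} (hx : StrictMono x) (hy : StrictMono y)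
    (h : edgeOf x = edgeOf y) : x = y := by
  refine (StrictMono.range_inj hx hy).1 ?_
  have := congrArg (fun s : Finset ℕ => (s : Set ℕ)) h
  simpa [edgeOf] using this

theorem card_edgeOf {r : ℕ} {x : Fin r → ℕ} (hx : Function.Injective x) :
    (edgeOf x).card = r := by
  simp [edgeOf, Finset.card_image_of_injective _ hx]

theorem exists_strictMono_edgeOf_eq {r : ℕ} {e : Finset ℕ} (he : e.card = r) :
    ∃ x : Fin r → ℕ, StrictMono x ∧ edgeOf x = e := by
  refine ⟨e.orderEmbOfFin he, (e.orderEmbOfFin he).strictMono, ?_⟩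
  ext v
  rw [mem_edgeOf, ← Set.mem_range, Finset.range_orderEmbOfFin, Finset.mem_coe]

/-- `α` and `β` list the two edges of an `r`-partite `r`-pattern: the `i`-th vertices of the two
edges are `2i+1` and `2i+2`, in one of the two orders. -/
def IsInterleaved {r : ℕ} (α β : Fin r → ℕ) : Prop :=
  ∀ i : Fin r, (α i = 2 * i + 1 ∧ β i = 2 * i + 2) ∨ (α i = 2 * i + 2 ∧ β i = 2 * i + 1)

theorem IsInterleaved.strictMono {r : ℕ} {α β : Fin r → ℕ} (h : IsInterleaved α β) :
    StrictMono α ∧ StrictMono β := by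
  constructor <;> intro i j hij <;>
  · have : (i : ℕ) < j := hij
    have h1 := h i
    have h2 := h j
    omega

theorem exists_isInterleaved {r : ℕ} {P : Finset (Finset ℕ)} (hP : IsPattern r P)
    (hpart : IsPartite r 2 P) :
    ∃ α β : Fin r → ℕ, IsInterleaved α β ∧ P = {edgeOf α, edgeOf β} := by
  obtain ⟨hc, hcard, hdisj, -⟩ := hP
  obtain ⟨A, B, hAB, rfl⟩ := Finset.card_eq_two.1 hc
  have key : ∀ e ∈ ({A, B} : Finset (Finset ℕ)), ∀ i : Fin r,
      ∃ v, v ∈ e ∧ (v = 2 * (i : ℕ) + 1 ∨ v = 2 * (i : ℕ) + 2) := by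
    intro e he i
    have h1 := hpart e he (i + 1) (by omega) (by omega)
    obtain ⟨v, hv⟩ := Finset.card_eq_one.1 h1
    have hv' : v ∈ e ∩ Finset.Icc ((i + 1 - 1) * 2 + 1) ((i + 1) * 2) := by
      rw [hv]
      exact Finset.mem_singleton_self v
    rw [Finset.mem_inter, Finset.mem_Icc] at hv'
    exact ⟨v, hv'.1, by omega⟩
  choose α hα hα' using key A (by simp)
  choose β hβ hβ' using key B (by simp)
  have hd := hdisj A (by simp) B (by simp) hAB
  have hne : ∀ i, α i ≠ β i := fun i h =>
    Finset.disjoint_left.1 hd (hα i) (h ▸ hβ i)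
  have hI : IsInterleaved α β := by
    intro i
    have h1 := hα' i
    have h2 := hβ' i
    have h3 := hne i
    omega
  have hA : edgeOf α = A := by
    refine Finset.eq_of_subset_of_card_le ?_ ?_
    · intro v hv
      obtain ⟨i, rfl⟩ := mem_edgeOf.1 hv
      exact hα i
    · rw [hcard A (by simp), card_edgeOf hI.strictMono.1.injective]
  have hB : edgeOf β = B := by
    refine Finset.eq_of_subset_of_card_le ?_ ?_
    · intro v hv
      obtain ⟨i, rfl⟩ := mem_edgeOf.1 hv
      exact hβ i
    · rw [hcard B (by simp), card_edgeOf hI.strictMono.2.injective]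
  exact ⟨α, β, hI, by rw [hA, hB]⟩

theorem formsPattern_of_interleaved {r : ℕ} {α β x y : Fin r → ℕ} (hI : IsInterleaved α β)
    (hx : StrictMono x) (hy : StrictMono y) (hxy : ∀ i j, i < j → x i < y j)
    (hyx : ∀ i j, i < j → y i < x j)
    (hlt : ∀ i, α i < β i → x i < y i) (hgt : ∀ i, β i < α i → y i < x i) :
    FormsPattern (edgeOf x) (edgeOf y) {edgeOf α, edgeOf β} := by
  classical
  obtain ⟨hα, hβ⟩ := hI.strictMono
  have hne : ∀ i j, x i ≠ y j := by
    intro i j h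
    rcases lt_trichotomy i j with hij | rfl | hij
    · exact (hxy i j hij).ne h
    · have h1 := hI i
      have h2 := hlt i
      have h3 := hgt i
      omega
    · exact (hyx j i hij).ne' h
  let φ : ℕ → ℕ := fun v =>
    if h : ∃ i, x i = v then α h.choose else if h : ∃ i, y i = v then β h.choose else 0
  have hφx : ∀ i, φ (x i) = α i := by
    intro i
    have h : ∃ j, x j = x i := ⟨i, rfl⟩
    have : φ (x i) = α h.choose := dif_pos h
    rw [this, hx.injective h.choose_spec]
  have hφy : ∀ i, φ (y i) = β i := by
    intro i
    have h : ∃ j, y j = y i := ⟨i, rfl⟩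
    have h' : ¬ ∃ j, x j = y i := fun ⟨j, hj⟩ => hne j i hj
    have : φ (y i) = β h.choose := (dif_neg h').trans (dif_pos h)
    rw [this, hy.injective h.choose_spec]
  refine ⟨φ, ?_, ?_⟩
  · intro u hu v hv huv
    rw [Finset.mem_coe, Finset.mem_union, mem_edgeOf, mem_edgeOf] at hu hv
    rcases hu with ⟨i, rfl⟩ | ⟨i, rfl⟩ <;> rcases hv with ⟨j, rfl⟩ | ⟨j, rfl⟩
    · rw [hφx, hφx]
      exact hα (hx.lt_iff_lt.1 huv)
    · rw [hφx, hφy]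
      rcases lt_trichotomy i j with hij | rfl | hij
      · have h1 := hI i
        have h2 := hI j
        have : (i : ℕ) < j := hij
        omega
      · have h1 := hI i
        have h3 := hgt i
        omega
      · exact absurd huv (hyx j i hij).not_gt
    · rw [hφx, hφy]
      rcases lt_trichotomy i j with hij | rfl | hij
      · have h1 := hI i
        have h2 := hI j
        have : (i : ℕ) < j := hij
        omega
      · have h1 := hI i
        have h3 := hlt i
        omega
      · exact absurd huv (hxy j i hij).not_gt
    · rw [hφy, hφy]
      exact hβ (hy.lt_iff_lt.1 huv)
  · have h1 : (edgeOf x).image φ = edgeOf α := by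
      rw [edgeOf, Finset.image_image]
      exact Finset.image_congr fun i _ => hφx i
    have h2 : (edgeOf y).image φ = edgeOf β := by
      rw [edgeOf, Finset.image_image]
      exact Finset.image_congr fun i _ => hφy i
    rw [h1, h2]

theorem FormsPattern.lt_iff_lt {r : ℕ} {α β x y : Fin r → ℕ} (hα : StrictMono α)
    (hβ : StrictMono β) (hx : StrictMono x) (hy : StrictMono y)
    (h : FormsPattern (edgeOf x) (edgeOf y) {edgeOf α, edgeOf β}) :
    (∀ i, x i < y i ↔ α i < β i) ∨ (∀ i, y i < x i ↔ α i < β i) := by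
  obtain ⟨φ, hφ, heq⟩ := h
  have hxm : ∀ i, x i ∈ (↑(edgeOf x ∪ edgeOf y) : Set ℕ) := fun i => by
    simp [mem_edgeOf]
  have hym : ∀ i, y i ∈ (↑(edgeOf x ∪ edgeOf y) : Set ℕ) := fun i => by
    simp [mem_edgeOf]
  have hsx : StrictMono (φ ∘ x) := fun i j hij => hφ (hxm i) (hxm j) (hx hij)
  have hsy : StrictMono (φ ∘ y) := fun i j hij => hφ (hym i) (hym j) (hy hij)
  have himg : ∀ z : Fin r → ℕ, (edgeOf z).image φ = edgeOf (φ ∘ z) := fun z => by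
    rw [edgeOf, edgeOf, Finset.image_image]
  rw [himg, himg] at heq
  have hmem1 : edgeOf (φ ∘ x) ∈ ({edgeOf α, edgeOf β} : Finset (Finset ℕ)) := by simp [← heq]
  have hmem2 : edgeOf (φ ∘ y) ∈ ({edgeOf α, edgeOf β} : Finset (Finset ℕ)) := by simp [← heq]
  have hmemα : edgeOf α ∈ ({edgeOf (φ ∘ x), edgeOf (φ ∘ y)} : Finset (Finset ℕ)) := by simp [heq]
  have hmemβ : edgeOf β ∈ ({edgeOf (φ ∘ x), edgeOf (φ ∘ y)} : Finset (Finset ℕ)) := by simp [heq]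
  rw [Finset.mem_insert, Finset.mem_singleton] at hmem1 hmem2 hmemα hmemβ
  have main : (edgeOf (φ ∘ x) = edgeOf α ∧ edgeOf (φ ∘ y) = edgeOf β) ∨
      (edgeOf (φ ∘ x) = edgeOf β ∧ edgeOf (φ ∘ y) = edgeOf α) := by grind
  rcases main with ⟨h1, h2⟩ | ⟨h1, h2⟩
  · left
    intro i
    rw [← eq_of_edgeOf_eq hsx hα h1, ← eq_of_edgeOf_eq hsy hβ h2]
    exact (hφ.lt_iff_lt (hxm i) (hym i)).symm
  · right
    intro i
    rw [← eq_of_edgeOf_eq hsx hβ h1, ← eq_of_edgeOf_eq hsy hα h2]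
    exact (hφ.lt_iff_lt (hym i) (hxm i)).symm

theorem finite_patternFree (r n : ℕ) (P : Finset (Finset ℕ)) :
    {M : Finset (Finset ℕ) | IsOrderedMatching r n M ∧
      ∀ e ∈ M, ∀ f ∈ M, e ≠ f → ¬ FormsPattern e f P}.Finite := by
  refine (Finset.finite_toSet (Finset.Icc 1 (r * n)).powerset.powerset).subset ?_
  rintro M ⟨⟨-, -, -, hM⟩, -⟩
  rw [Finset.mem_coe, Finset.mem_powerset]
  intro e he
  rw [Finset.mem_powerset, ← hM]
  exact Finset.subset_biUnion_of_mem id he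

/-- `a` lies strictly below `b` in the coordinates satisfying `ε`, strictly above in the others. -/
def SignLT {r : ℕ} (ε : Fin r → Prop) (a b : Fin r → ℕ) : Prop :=
  ∀ i, (ε i → a i < b i) ∧ (¬ ε i → b i < a i)

theorem card_le_of_signLT_free {r : ℕ} (hr : 0 < r) (ε : Fin r → Prop) (M : ℕ)
    (S : Finset (Fin r → ℕ)) (hS : ∀ a ∈ S, ∀ i, a i < M)
    (hfree : ∀ a ∈ S, ∀ b ∈ S, ¬ SignLT ε a b) : S.card ≤ r * M ^ (r - 1) := by
  classical
  have : Nonempty (Fin r) := ⟨⟨0, hr⟩⟩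
  let g : (Fin r → ℕ) → Fin r → ℕ := fun a i => if ε i then a i else M - 1 - a i
  have hmin : ∀ a : Fin r → ℕ, ∃ i, ∀ j, g a i ≤ g a j := fun a => Finite.exists_min (g a)
  choose μ hμ using hmin
  let T : Finset (Fin r → ℕ) := Finset.univ.biUnion fun i : Fin r =>
    Fintype.piFinset fun j => if j = i then {0} else Finset.range M
  have hT : T.card ≤ r * M ^ (r - 1) := by
    have h := Finset.card_biUnion_le_card_mul (Finset.univ : Finset (Fin r))
      (fun i : Fin r => Fintype.piFinset fun j => if j = i then {0} else Finset.range M)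
      (M ^ (r - 1)) (fun i _ => by
        rw [Fintype.card_piFinset, ← Finset.mul_prod_erase _ _ (Finset.mem_univ i)]
        rw [Finset.prod_congr rfl (g := fun _ => M)]
        · simp
        · intro j hj
          simp [Finset.ne_of_mem_erase hj])
    simpa using h
  refine le_trans ?_ hT
  refine Finset.card_le_card_of_injOn (fun a j => g a j - g a (μ a)) ?_ ?_
  · intro a ha
    simp only [T, Finset.coe_biUnion, Set.mem_iUnion, Finset.mem_coe, Finset.mem_univ,
      Fintype.mem_piFinset]
    refine ⟨μ a, trivial, fun j => ?_⟩
    split_ifs with hj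
    · simp [hj]
    · have h1 := hS a ha j
      have h2 : g a j < M := by
        simp only [g]
        split_ifs <;> omega
      rw [Finset.mem_range]
      omega
  · have key : ∀ a ∈ S, ∀ b ∈ S, (fun j => g a j - g a (μ a)) = (fun j => g b j - g b (μ b)) →
        g b (μ b) ≤ g a (μ a) := by
      intro a ha b hb hab
      by_contra! hlt
      refine hfree a ha b hb fun i => ?_
      have h1 : g a i - g a (μ a) = g b i - g b (μ b) := congrFun hab i
      have h2 := hμ a i
      have h3 := hμ b i
      have h4 : g a i < g b i := by omega
      have h5 := hS a ha i
      have h6 := hS b hb i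
      constructor <;> intro hε <;> simp only [g, hε, if_true, if_false] at h4 <;> omega
    intro a ha b hb hab
    have h0 := le_antisymm (key a ha b hb hab) (key b hb a ha hab.symm)
    ext i
    have h1 : g a i - g a (μ a) = g b i - g b (μ b) := congrFun hab i
    have h2 := hμ a i
    have h3 := hμ b i
    have h4 : g a i = g b i := by omega
    have h5 := hS a ha i
    have h6 := hS b hb i
    by_cases hε : ε i <;> simp only [g, hε, if_true, if_false] at h4 <;> omega

/-- Containers for `SignLT`-free sets of cells of the dyadic grid of side `2 ^ s`. -/
theorem exists_cell_containers {r : ℕ} (hr : 0 < r) (ε : Fin r → Prop) (s : ℕ) :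
    ∃ F : Finset (Finset (Fin r → ℕ)),
      F.card ≤ 2 ^ (r * 2 ^ r * ∑ i ∈ Finset.range s, (2 ^ i) ^ (r - 1)) ∧
      (∀ S ∈ F, S.card ≤ r * (2 ^ s) ^ (r - 1)) ∧
      ∀ T : Finset (Fin r → ℕ), (∀ a ∈ T, ∀ i, a i < 2 ^ s) →
        (∀ a ∈ T, ∀ b ∈ T, ¬ SignLT ε a b) → ∃ S ∈ F, T ⊆ S := by
  classical
  induction s with
  | zero =>
    refine ⟨{{fun _ => 0}}, by simp, by simpa using Nat.succ_le_of_lt hr,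
      fun T hT _ => ⟨{fun _ => 0}, by simp, ?_⟩⟩
    intro a ha
    rw [Finset.mem_singleton]
    ext i
    simpa using hT a ha i
  | succ s ih =>
    obtain ⟨F, hF, hFS, hFT⟩ := ih
    let ch : Finset (Fin r → ℕ) → Finset (Fin r → ℕ) := fun S =>
      S.biUnion fun c => Fintype.piFinset fun i => {2 * c i, 2 * c i + 1}
    have hch : ∀ S, (ch S).card ≤ S.card * 2 ^ r := by
      intro S
      refine Finset.card_biUnion_le_card_mul _ _ _ fun c _ => ?_
      rw [Fintype.card_piFinset]
      simp
    refine ⟨(F.biUnion fun S => (ch S).powerset).filter fun S => (∀ a ∈ S, ∀ i, a i < 2 ^ (s + 1)) ∧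
        ∀ a ∈ S, ∀ b ∈ S, ¬ SignLT ε a b, ?_, ?_, ?_⟩
    · refine (Finset.card_filter_le _ _).trans ?_
      rw [Finset.sum_range_succ, mul_add, pow_add]
      refine (Finset.card_biUnion_le_card_mul F _ (2 ^ (r * 2 ^ r * (2 ^ s) ^ (r - 1)))
        fun S hS => ?_).trans (Nat.mul_le_mul_right _ hF)
      rw [Finset.card_powerset]
      refine Nat.pow_le_pow_right (by norm_num) ((hch S).trans ?_)
      calc S.card * 2 ^ r ≤ (r * (2 ^ s) ^ (r - 1)) * 2 ^ r := Nat.mul_le_mul_right _ (hFS S hS)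
        _ = _ := by ring
    · intro S hS
      obtain ⟨-, h1, h2⟩ := Finset.mem_filter.1 hS
      exact card_le_of_signLT_free hr ε _ S h1 h2
    · intro T hT hfree
      obtain ⟨S, hS, hTS⟩ := hFT (T.image fun a i => a i / 2) (by
          intro a ha i
          obtain ⟨b, hb, rfl⟩ := Finset.mem_image.1 ha
          have := hT b hb i
          rw [pow_succ] at this
          simp only
          omega) (by
          intro a ha b hb hab
          obtain ⟨a', ha', rfl⟩ := Finset.mem_image.1 ha
          obtain ⟨b', hb', rfl⟩ := Finset.mem_image.1 hb
          refine hfree a' ha' b' hb' fun i => ?_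
          have := hab i
          simp only at this
          exact ⟨fun h => by have := this.1 h; omega, fun h => by have := this.2 h; omega⟩)
      refine ⟨T, ?_, Finset.Subset.refl _⟩
      rw [Finset.mem_filter]
      refine ⟨Finset.mem_biUnion.2 ⟨S, hS, Finset.mem_powerset.2 fun a ha => ?_⟩, hT, hfree⟩
      refine Finset.mem_biUnion.2 ⟨_, hTS (Finset.mem_image_of_mem _ ha), ?_⟩
      rw [Fintype.mem_piFinset]
      intro i
      rw [Finset.mem_insert, Finset.mem_singleton]
      omega

/-- Containers for `SignLT`-free sets of points in a product of dyadic intervals. -/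
theorem exists_box_containers {r : ℕ} (hr : 0 < r) (ε : Fin r → Prop) (k a : Fin r → ℕ) (s : ℕ)
    (hs : ∀ i, s ≤ k i) :
    ∃ F : Finset (Finset (Fin r → ℕ)),
      F.card ≤ 2 ^ (r * 2 ^ r * ∑ i ∈ Finset.range s, (2 ^ i) ^ (r - 1)) ∧
      (∀ R ∈ F, R.card * 2 ^ s ≤ r * 2 ^ (∑ i, k i)) ∧
      ∀ T : Finset (Fin r → ℕ), (∀ x ∈ T, ∀ i, x i / 2 ^ k i = a i) →
        (∀ x ∈ T, ∀ y ∈ T, ¬ SignLT ε x y) → ∃ R ∈ F, T ⊆ R := by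
  classical
  obtain ⟨F, hF, hFS, hFT⟩ := exists_cell_containers hr ε s
  let reg : Finset (Fin r → ℕ) → Finset (Fin r → ℕ) := fun S =>
    S.biUnion fun c => Fintype.piFinset fun i =>
      Finset.Ico ((2 ^ s * a i + c i) * 2 ^ (k i - s))
        ((2 ^ s * a i + c i) * 2 ^ (k i - s) + 2 ^ (k i - s))
  refine ⟨F.image reg, Finset.card_image_le.trans hF, ?_, ?_⟩
  · intro R hR
    obtain ⟨S, hS, rfl⟩ := Finset.mem_image.1 hR
    have h1 : (reg S).card ≤ S.card * ∏ i, 2 ^ (k i - s) := by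
      refine Finset.card_biUnion_le_card_mul _ _ _ fun c _ => ?_
      rw [Fintype.card_piFinset]
      simp
    have h2 : (∏ i, 2 ^ (k i - s)) * (2 ^ s) ^ r = 2 ^ ∑ i, k i := by
      rw [← Finset.prod_pow_eq_pow_sum]
      have : (2 ^ s) ^ r = ∏ _i : Fin r, 2 ^ s := by simp
      rw [this, ← Finset.prod_mul_distrib]
      refine Finset.prod_congr rfl fun i _ => ?_
      rw [← pow_add, Nat.sub_add_cancel (hs i)]
    have h3 : (2 ^ s) ^ (r - 1) * 2 ^ s = (2 ^ s) ^ r := by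
      rw [← pow_succ, Nat.sub_add_cancel hr]
    calc (reg S).card * 2 ^ s ≤ ((r * (2 ^ s) ^ (r - 1)) * ∏ i, 2 ^ (k i - s)) * 2 ^ s :=
          Nat.mul_le_mul_right _ (h1.trans (Nat.mul_le_mul_right _ (hFS S hS)))
      _ = r * ((∏ i, 2 ^ (k i - s)) * ((2 ^ s) ^ (r - 1) * 2 ^ s)) := by ring
      _ = _ := by rw [h3, h2]
  · intro T hT hfree
    have hdec : ∀ x ∈ T, ∀ i, x i / 2 ^ (k i - s) =
        2 ^ s * a i + x i / 2 ^ (k i - s) % 2 ^ s := by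
      intro x hx i
      have h1 : x i / 2 ^ (k i - s) / 2 ^ s = a i := by
        rw [Nat.div_div_eq_div_mul, ← pow_add, Nat.sub_add_cancel (hs i), hT x hx i]
      rw [← h1, Nat.div_add_mod]
    obtain ⟨S, hS, hTS⟩ := hFT (T.image fun x i => x i / 2 ^ (k i - s) % 2 ^ s) (by
        intro c hc i
        obtain ⟨x, hx, rfl⟩ := Finset.mem_image.1 hc
        exact Nat.mod_lt _ (by positivity)) (by
        intro c hc d hd hcd
        obtain ⟨x, hx, rfl⟩ := Finset.mem_image.1 hc
        obtain ⟨y, hy, rfl⟩ := Finset.mem_image.1 hd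
        refine hfree x hx y hy fun i => ?_
        have h := hcd i
        simp only at h
        have h1 := hdec x hx i
        have h2 := hdec y hy i
        refine ⟨fun hε => ?_, fun hε => ?_⟩
        · have := h.1 hε
          by_contra! hle
          have := Nat.div_le_div_right (c := 2 ^ (k i - s)) hle
          omega
        · have := h.2 hε
          by_contra! hle
          have := Nat.div_le_div_right (c := 2 ^ (k i - s)) hle
          omega)
    refine ⟨reg S, Finset.mem_image_of_mem _ hS, fun x hx => ?_⟩
    refine Finset.mem_biUnion.2 ⟨_, hTS (Finset.mem_image_of_mem _ hx), ?_⟩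
    rw [Fintype.mem_piFinset]
    intro i
    rw [← hdec x hx i, Finset.mem_Ico]
    have h1 := Nat.div_mul_le_self (x i) (2 ^ (k i - s))
    have h2 := Nat.lt_div_mul_add (a := x i) (b := 2 ^ (k i - s)) (by positivity)
    exact ⟨h1, h2⟩

/-- The boxes of a dyadic decomposition: an element of `dyadicBoxes K j a` is a list of `j` disjoint
dyadic intervals inside `[a * 2 ^ K, (a + 1) * 2 ^ K)`, in increasing order. The pair `(k, c)`
stands for the interval `[c * 2 ^ k, (c + 1) * 2 ^ k)`. -/
def dyadicBoxes : ℕ → ℕ → ℕ → Finset (List (ℕ × ℕ))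
  | _, 0, _ => {[]}
  | K, 1, a => {[(K, a)]}
  | 0, _ + 2, _ => ∅
  | K + 1, j + 2, a => (Finset.HasAntidiagonal.antidiagonal (j + 2)).biUnion fun p =>
      (dyadicBoxes K p.1 (2 * a) ×ˢ dyadicBoxes K p.2 (2 * a + 1)).image fun q => q.1 ++ q.2

theorem mem_dyadicBoxes_zero_right {K a : ℕ} {b : List (ℕ × ℕ)} :
    b ∈ dyadicBoxes K 0 a ↔ b = [] := by
  cases K <;> simp [dyadicBoxes]

theorem mem_dyadicBoxes_one_right {K a : ℕ} {b : List (ℕ × ℕ)} :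
    b ∈ dyadicBoxes K 1 a ↔ b = [(K, a)] := by
  cases K <;> simp [dyadicBoxes]

theorem mem_dyadicBoxes_succ {K j a : ℕ} {b : List (ℕ × ℕ)} :
    b ∈ dyadicBoxes (K + 1) (j + 2) a ↔ ∃ p q b₁ b₂, p + q = j + 2 ∧
      b₁ ∈ dyadicBoxes K p (2 * a) ∧ b₂ ∈ dyadicBoxes K q (2 * a + 1) ∧ b = b₁ ++ b₂ := by
  simp only [dyadicBoxes, Finset.mem_biUnion, Finset.HasAntidiagonal.mem_antidiagonal,
    Finset.mem_image,
    Finset.mem_product, Prod.exists]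
  constructor
  · rintro ⟨p, q, h, b₁, b₂, ⟨h1, h2⟩, rfl⟩
    exact ⟨p, q, b₁, b₂, h, h1, h2, rfl⟩
  · rintro ⟨p, q, b₁, b₂, h, h1, h2, rfl⟩
    exact ⟨p, q, h, b₁, b₂, ⟨h1, h2⟩, rfl⟩

theorem length_of_mem_dyadicBoxes {K j a : ℕ} {b : List (ℕ × ℕ)} (hb : b ∈ dyadicBoxes K j a) :
    b.length = j := by
  induction K generalizing j a b with
  | zero =>
    match j with
    | 0 => simp_all [dyadicBoxes]
    | 1 => simp_all [dyadicBoxes]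
    | j + 2 => simp [dyadicBoxes] at hb
  | succ K ih =>
    match j with
    | 0 => simp_all [dyadicBoxes]
    | 1 => simp_all [dyadicBoxes]
    | j + 2 =>
      obtain ⟨p, q, b₁, b₂, h, h1, h2, rfl⟩ := mem_dyadicBoxes_succ.1 hb
      rw [List.length_append, ih h1, ih h2, h]

theorem div_eq_of_mem_dyadicBoxes {K j a : ℕ} {b : List (ℕ × ℕ)} (hb : b ∈ dyadicBoxes K j a) :
    ∀ I ∈ b, I.1 ≤ K ∧ ∀ x, x / 2 ^ I.1 = I.2 → x / 2 ^ K = a := by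
  induction K generalizing j a b with
  | zero =>
    match j with
    | 0 => simp_all [dyadicBoxes]
    | 1 => simp_all [dyadicBoxes]
    | j + 2 => simp [dyadicBoxes] at hb
  | succ K ih =>
    match j with
    | 0 => simp_all [dyadicBoxes]
    | 1 => simp_all [dyadicBoxes]
    | j + 2 =>
      obtain ⟨p, q, b₁, b₂, h, h1, h2, rfl⟩ := mem_dyadicBoxes_succ.1 hb
      intro I hI
      have hdiv : ∀ x, x / 2 ^ (K + 1) = x / 2 ^ K / 2 := fun x => by
        rw [pow_succ, Nat.div_div_eq_div_mul]
      rcases List.mem_append.1 hI with hI | hI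
      · obtain ⟨h3, h4⟩ := ih h1 I hI
        refine ⟨by omega, fun x hx => ?_⟩
        rw [hdiv, h4 x hx]
        omega
      · obtain ⟨h3, h4⟩ := ih h2 I hI
        refine ⟨by omega, fun x hx => ?_⟩
        rw [hdiv, h4 x hx]
        omega

theorem pairwise_of_mem_dyadicBoxes {K j a : ℕ} {b : List (ℕ × ℕ)} (hb : b ∈ dyadicBoxes K j a) :
    b.Pairwise fun I J => ∀ x y, x / 2 ^ I.1 = I.2 → y / 2 ^ J.1 = J.2 → x < y := by
  induction K generalizing j a b with
  | zero =>
    match j with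
    | 0 => simp_all [dyadicBoxes]
    | 1 => simp_all [dyadicBoxes]
    | j + 2 => simp [dyadicBoxes] at hb
  | succ K ih =>
    match j with
    | 0 => simp_all [dyadicBoxes]
    | 1 => simp_all [dyadicBoxes]
    | j + 2 =>
      obtain ⟨p, q, b₁, b₂, h, h1, h2, rfl⟩ := mem_dyadicBoxes_succ.1 hb
      refine List.pairwise_append.2 ⟨ih h1, ih h2, fun I hI J hJ x y hx hy => ?_⟩
      have h3 := (div_eq_of_mem_dyadicBoxes h1 I hI).2 x hx
      have h4 := (div_eq_of_mem_dyadicBoxes h2 J hJ).2 y hy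
      by_contra! hle
      have := Nat.div_le_div_right (c := 2 ^ K) hle
      omega

/-- The total depth of a box below level `K`. -/
def boxDepth (K : ℕ) (b : List (ℕ × ℕ)) : ℕ := (b.map fun I => K - I.1).sum

theorem boxDepth_append (K : ℕ) (b c : List (ℕ × ℕ)) :
    boxDepth K (b ++ c) = boxDepth K b + boxDepth K c := by
  simp [boxDepth]

theorem boxDepth_succ {K : ℕ} {b : List (ℕ × ℕ)} (hb : ∀ I ∈ b, I.1 ≤ K) :
    boxDepth (K + 1) b = boxDepth K b + b.length := by
  induction b with
  | nil => simp [boxDepth]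
  | cons I b ih =>
    have h1 := ih fun J hJ => hb J (List.mem_cons_of_mem _ hJ)
    have h2 := hb I List.mem_cons_self
    simp only [boxDepth, List.map_cons, List.sum_cons, List.length_cons] at h1 ⊢
    omega

theorem boxDepth_of_mem_succ {K p q a : ℕ} {b₁ b₂ : List (ℕ × ℕ)}
    (h1 : b₁ ∈ dyadicBoxes K p (2 * a)) (h2 : b₂ ∈ dyadicBoxes K q (2 * a + 1)) :
    boxDepth (K + 1) (b₁ ++ b₂) = boxDepth K b₁ + boxDepth K b₂ + (p + q) := by
  rw [boxDepth_append, boxDepth_succ fun I hI => (div_eq_of_mem_dyadicBoxes h1 I hI).1,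
    boxDepth_succ fun I hI => (div_eq_of_mem_dyadicBoxes h2 I hI).1,
    length_of_mem_dyadicBoxes h1, length_of_mem_dyadicBoxes h2]
  ring

theorem two_mul_le_boxDepth {K j a : ℕ} (hj : 2 ≤ j) {b : List (ℕ × ℕ)}
    (hb : b ∈ dyadicBoxes K j a) : ∀ I ∈ b, 2 * (K - I.1) ≤ boxDepth K b := by
  have hmem : ∀ {K j a : ℕ} {b : List (ℕ × ℕ)}, b ∈ dyadicBoxes K j a →
      (2 ≤ j → ∀ I ∈ b, 2 * (K - I.1) ≤ boxDepth K b) →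
      ∀ I ∈ b, 2 * (K - I.1) ≤ boxDepth K b := by
    intro K j a b hb ih I hI
    match j with
    | 0 => simp_all [mem_dyadicBoxes_zero_right]
    | 1 => simp_all [mem_dyadicBoxes_one_right]
    | j + 2 => exact ih (by omega) I hI
  induction K generalizing j a b with
  | zero =>
    match j with
    | j + 2 => simp [dyadicBoxes] at hb
  | succ K ih =>
    match j with
    | j + 2 =>
      obtain ⟨p, q, b₁, b₂, h, h1, h2, rfl⟩ := mem_dyadicBoxes_succ.1 hb
      intro I hI
      rw [boxDepth_of_mem_succ h1 h2]
      rcases List.mem_append.1 hI with hI | hI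
      · have := hmem h1 (fun hp => ih hp h1) I hI
        omega
      · have := hmem h2 (fun hp => ih hp h2) I hI
        omega

theorem sum_add_boxDepth {K : ℕ} {b : List (ℕ × ℕ)} (hb : ∀ I ∈ b, I.1 ≤ K) :
    (b.map Prod.fst).sum + boxDepth K b = b.length * K := by
  induction b with
  | nil => simp [boxDepth]
  | cons I b ih =>
    have h1 := ih fun J hJ => hb J (List.mem_cons_of_mem _ hJ)
    have h2 := hb I List.mem_cons_self
    simp only [boxDepth, List.map_cons, List.sum_cons, List.length_cons] at h1 ⊢
    rw [add_mul, ← h1]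
    omega

theorem exists_split_of_pairwise_lt {K a : ℕ} {l : List ℕ} (hl : l.Pairwise (· < ·))
    (ha : ∀ x ∈ l, x / 2 ^ (K + 1) = a) :
    ∃ l₁ l₂, l = l₁ ++ l₂ ∧ (∀ x ∈ l₁, x / 2 ^ K = 2 * a) ∧
      ∀ x ∈ l₂, x / 2 ^ K = 2 * a + 1 := by
  have hdiv : ∀ x, x / 2 ^ (K + 1) = x / 2 ^ K / 2 := fun x => by
    rw [pow_succ, Nat.div_div_eq_div_mul]
  induction l with
  | nil => exact ⟨[], [], by simp⟩
  | cons x l ih =>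
    rw [List.pairwise_cons] at hl
    obtain ⟨l₁, l₂, h, h1, h2⟩ := ih hl.2 fun y hy => ha y (List.mem_cons_of_mem _ hy)
    have hx := ha x List.mem_cons_self
    rw [hdiv] at hx
    by_cases hc : x / 2 ^ K = 2 * a
    · refine ⟨x :: l₁, l₂, by rw [h, List.cons_append], ?_, h2⟩
      intro y hy
      rcases List.mem_cons.1 hy with rfl | hy
      exacts [hc, h1 y hy]
    · refine ⟨[], x :: l, rfl, by simp, ?_⟩
      intro y hy
      rcases List.mem_cons.1 hy with rfl | hy'
      · omega
      · have h3 := Nat.div_le_div_right (c := 2 ^ K) (hl.1 y hy').le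
        have h4 := ha y hy
        rw [hdiv] at h4
        omega

theorem exists_mem_dyadicBoxes {K a : ℕ} {l : List ℕ} (hl : l.Pairwise (· < ·))
    (ha : ∀ x ∈ l, x / 2 ^ K = a) :
    ∃ b ∈ dyadicBoxes K l.length a, List.Forall₂ (fun x I => x / 2 ^ I.1 = I.2) l b := by
  induction K generalizing a l with
  | zero =>
    match l with
    | [] => exact ⟨[], by simp [dyadicBoxes]⟩
    | [x] => exact ⟨[(0, a)], by simpa [dyadicBoxes] using ha⟩
    | x :: y :: l =>
      have h1 := ha x (by simp)
      have h2 := ha y (by simp)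
      have h3 : x < y := by
        rw [List.pairwise_cons] at hl
        exact hl.1 y (by simp)
      simp at h1 h2
      omega
  | succ K ih =>
    match l with
    | [] => exact ⟨[], by simp [dyadicBoxes]⟩
    | [x] => exact ⟨[(K + 1, a)], by simpa [dyadicBoxes] using ha⟩
    | x :: y :: l =>
      obtain ⟨l₁, l₂, h, h1, h2⟩ := exists_split_of_pairwise_lt hl ha
      rw [h] at hl
      rw [List.pairwise_append] at hl
      obtain ⟨b₁, hb₁, hf₁⟩ := ih hl.1 h1
      obtain ⟨b₂, hb₂, hf₂⟩ := ih hl.2.1 h2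
      have hlen : l₁.length + l₂.length = l.length + 2 := by
        rw [← List.length_append, ← h]
        rfl
      refine ⟨b₁ ++ b₂, mem_dyadicBoxes_succ.2 ⟨_, _, b₁, b₂, hlen, hb₁, hb₂, rfl⟩, ?_⟩
      rw [h]
      exact List.rel_append hf₁ hf₂

theorem sum_biUnion_le_sum_sum {ι κ : Type*} [DecidableEq κ] (s : Finset ι) (t : ι → Finset κ)
    {f : κ → ℝ} (hf : ∀ x, 0 ≤ f x) : ∑ x ∈ s.biUnion t, f x ≤ ∑ i ∈ s, ∑ x ∈ t i, f x := by
  classical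
  have h : s.biUnion t = (s.sigma t).image Sigma.snd := by
    ext x
    simp
  rw [h, ← Finset.sum_sigma (f := fun p : (_ : ι) × κ => f p.2)]
  exact Finset.sum_image_le_of_nonneg fun p _ => hf _

theorem exists_sum_dyadicBoxes_le (j : ℕ) :
    ∃ c : ℝ, 0 ≤ c ∧ ∀ K a, ∑ b ∈ dyadicBoxes K j a, (2 / 3 : ℝ) ^ boxDepth K b ≤ c := by
  induction j using Nat.strong_induction_on with
  | _ j ih =>
    match j with
    | 0 =>
      refine ⟨1, zero_le_one, fun K a => ?_⟩
      cases K <;> simp [dyadicBoxes, boxDepth]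
    | 1 =>
      refine ⟨1, zero_le_one, fun K a => ?_⟩
      cases K <;> simp [dyadicBoxes, boxDepth]
    | j + 2 =>
      choose! c hc0 hc using ih
      have hA : 0 ≤ ∑ p ∈ (Finset.HasAntidiagonal.antidiagonal (j + 2)).filter
          (fun p => p.1 ≠ 0 ∧ p.2 ≠ 0), c p.1 * c p.2 := by
        refine Finset.sum_nonneg fun p hp => ?_
        obtain ⟨h1, h2, h3⟩ := Finset.mem_filter.1 hp
        rw [Finset.HasAntidiagonal.mem_antidiagonal] at h1
        exact mul_nonneg (hc0 _ (by omega)) (hc0 _ (by omega))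
      set A := ∑ p ∈ (Finset.HasAntidiagonal.antidiagonal (j + 2)).filter
          (fun p => p.1 ≠ 0 ∧ p.2 ≠ 0), c p.1 * c p.2
      refine ⟨9 * A, by positivity, fun K => ?_⟩
      induction K with
      | zero =>
        intro a
        simp only [dyadicBoxes, Finset.sum_empty]
        positivity
      | succ K ihK =>
        intro a
        let f : ℕ × ℕ → ℝ := fun p =>
          (∑ b ∈ dyadicBoxes K p.1 (2 * a), (2 / 3 : ℝ) ^ boxDepth K b) *
            ∑ b ∈ dyadicBoxes K p.2 (2 * a + 1), (2 / 3 : ℝ) ^ boxDepth K b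
        have h1 : ∑ b ∈ dyadicBoxes (K + 1) (j + 2) a, (2 / 3 : ℝ) ^ boxDepth (K + 1) b ≤
            ∑ p ∈ Finset.HasAntidiagonal.antidiagonal (j + 2), (2 / 3 : ℝ) ^ (j + 2) * f p := by
          rw [dyadicBoxes]
          refine (sum_biUnion_le_sum_sum _ _ fun b => by positivity).trans ?_
          refine Finset.sum_le_sum fun p hp => ?_
          rw [Finset.HasAntidiagonal.mem_antidiagonal] at hp
          refine (Finset.sum_image_le_of_nonneg fun q _ => by positivity).trans ?_
          refine le_of_eq ?_
          simp only [f]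
          rw [Finset.sum_mul_sum, ← Finset.sum_product', Finset.mul_sum]
          refine Finset.sum_congr rfl fun q hq => ?_
          rw [Finset.mem_product] at hq
          rw [boxDepth_of_mem_succ hq.1 hq.2, hp]
          ring
        have h2 : ∑ p ∈ Finset.HasAntidiagonal.antidiagonal (j + 2), f p ≤ 9 * A + 9 * A + A := by
          have h0 : ∀ a, ∑ b ∈ dyadicBoxes K 0 a, (2 / 3 : ℝ) ^ boxDepth K b = 1 := fun a => by
            cases K <;> simp [dyadicBoxes, boxDepth]
          rw [← Finset.sum_filter_add_sum_filter_not _ (fun p : ℕ × ℕ => p.1 ≠ 0 ∧ p.2 ≠ 0),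
            add_comm]
          refine add_le_add ?_ ?_
          · have hsub : (Finset.HasAntidiagonal.antidiagonal (j + 2)).filter
                (fun p : ℕ × ℕ => ¬ (p.1 ≠ 0 ∧ p.2 ≠ 0)) = {(0, j + 2), (j + 2, 0)} := by
              ext ⟨p, q⟩
              simp only [Finset.mem_filter, Finset.HasAntidiagonal.mem_antidiagonal,
                Finset.mem_insert, Finset.mem_singleton, Prod.mk.injEq]
              omega
            rw [hsub, Finset.sum_pair (by simp)]
            simp only [h0, one_mul, mul_one, f]
            exact add_le_add (ihK _) (ihK _)
          · refine Finset.sum_le_sum fun p hp => ?_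
            obtain ⟨h1, h2, h3⟩ := Finset.mem_filter.1 hp
            rw [Finset.HasAntidiagonal.mem_antidiagonal] at h1
            exact mul_le_mul (hc _ (by omega) _ _) (hc _ (by omega) _ _)
              (Finset.sum_nonneg fun b _ => by positivity) (hc0 _ (by omega))
        rw [← Finset.mul_sum] at h1
        have h3 : (2 / 3 : ℝ) ^ (j + 2) ≤ 4 / 9 := by
          have : (2 / 3 : ℝ) ^ (j + 2) ≤ (2 / 3) ^ 2 :=
            pow_le_pow_of_le_one (by norm_num) (by norm_num) (by omega)
          norm_num at this ⊢
          exact this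
        have h4 : 0 ≤ ∑ p ∈ Finset.HasAntidiagonal.antidiagonal (j + 2), f p :=
          Finset.sum_nonneg fun p _ => by positivity
        nlinarith

theorem one_le_pow_mul_four_pow (D : ℕ) : (1 : ℝ) ≤ 9 / 4 * (2 / 3) ^ D * 4 ^ (D / 3) := by
  have h1 : (2 / 3 : ℝ) ^ D = (2 / 3) ^ (D % 3) * ((2 / 3) ^ 3) ^ (D / 3) := by
    rw [← pow_mul, ← pow_add, Nat.mod_add_div]
  have h2 : (4 / 9 : ℝ) ≤ (2 / 3) ^ (D % 3) := by
    have : (2 / 3 : ℝ) ^ 2 ≤ (2 / 3) ^ (D % 3) :=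
      pow_le_pow_of_le_one (by norm_num) (by norm_num) (by omega)
    norm_num at this ⊢
    exact this
  have h3 : (1 : ℝ) ≤ ((2 / 3) ^ 3 * 4) ^ (D / 3) := one_le_pow₀ (by norm_num)
  rw [mul_pow] at h3
  rw [h1]
  have h4 : (0 : ℝ) ≤ ((2 / 3) ^ 3) ^ (D / 3) * 4 ^ (D / 3) := by positivity
  nlinarith

theorem sum_range_two_pow_pow_le {d : ℕ} (hd : 1 ≤ d) (s : ℕ) :
    ∑ i ∈ Finset.range s, (2 ^ i) ^ d ≤ (2 ^ s) ^ d := by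
  induction s with
  | zero => simp
  | succ s ih =>
    rw [Finset.sum_range_succ, pow_succ, mul_pow]
    have h : 2 ^ 1 ≤ 2 ^ d := Nat.pow_le_pow_right (by norm_num) hd
    have h2 : (2 ^ s) ^ d * 2 ≤ (2 ^ s) ^ d * 2 ^ d := Nat.mul_le_mul_left _ (by simpa using h)
    omega

theorem sum_range_sub_div_three_le {d : ℕ} (hd : 2 ≤ d) (t D : ℕ) :
    ((∑ i ∈ Finset.range (t - D / 3), (2 ^ i) ^ d : ℕ) : ℝ) ≤
      9 / 4 * 2 ^ (t * d) * (2 / 3) ^ D := by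
  rcases le_total t (D / 3) with h | h
  · rw [Nat.sub_eq_zero_of_le h]
    simp only [Finset.range_zero, Finset.sum_empty, Nat.cast_zero]
    positivity
  · have h1 : ((∑ i ∈ Finset.range (t - D / 3), (2 ^ i) ^ d : ℕ) : ℝ) ≤
        (2 ^ (t - D / 3)) ^ d := by
      exact_mod_cast sum_range_two_pow_pow_le (by omega) _
    have h2 : ((2 : ℝ) ^ (t - D / 3)) ^ d * 4 ^ (D / 3) ≤ 2 ^ (t * d) := by
      have h4 : (4 : ℝ) ^ (D / 3) ≤ (2 ^ (D / 3)) ^ d := by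
        have h5 : (4 : ℝ) ^ (D / 3) = (2 ^ (D / 3)) ^ 2 := by
          rw [← pow_mul, mul_comm, pow_mul]
          norm_num
        rw [h5]
        exact pow_le_pow_right₀ (one_le_pow₀ (by norm_num)) hd
      calc ((2 : ℝ) ^ (t - D / 3)) ^ d * 4 ^ (D / 3)
          ≤ (2 ^ (t - D / 3)) ^ d * (2 ^ (D / 3)) ^ d := by gcongr
        _ = 2 ^ (t * d) := by rw [← mul_pow, ← pow_add, Nat.sub_add_cancel h, ← pow_mul]
    calc ((∑ i ∈ Finset.range (t - D / 3), (2 ^ i) ^ d : ℕ) : ℝ)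
        ≤ (2 ^ (t - D / 3)) ^ d * 1 := by rwa [mul_one]
      _ ≤ (2 ^ (t - D / 3)) ^ d * (9 / 4 * (2 / 3) ^ D * 4 ^ (D / 3)) := by
          gcongr
          exact one_le_pow_mul_four_pow D
      _ = 9 / 4 * (2 / 3) ^ D * ((2 ^ (t - D / 3)) ^ d * 4 ^ (D / 3)) := by ring
      _ ≤ 9 / 4 * (2 / 3) ^ D * 2 ^ (t * d) := by gcongr
      _ = _ := by ring

theorem exists_eq_ofFn {ι : Type*} {r : ℕ} {b : List ι} (hb : b.length = r) :
    ∃ v : Fin r → ι, b = List.ofFn v := by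
  subst hb
  exact ⟨b.get, (List.ofFn_get b).symm⟩

/-- Containers for pattern-free sets of edges inside a fixed dyadic box. -/
theorem exists_dyadicBox_containers {r : ℕ} (hr : 3 ≤ r) {α β : Fin r → ℕ}
    (hI : IsInterleaved α β) {K t : ℕ} (hK : 2 * t ≤ K) {b : List (ℕ × ℕ)}
    (hb : b ∈ dyadicBoxes K r 0) :
    ∃ F : Finset (Finset (Fin r → ℕ)),
      F.card ≤ 2 ^ (r * 2 ^ r *
        ∑ i ∈ Finset.range (t - boxDepth K b / 3), (2 ^ i) ^ (r - 1)) ∧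
      (∀ R ∈ F, (R.card : ℝ) * 2 ^ t ≤ 9 / 4 * r * 2 ^ (r * K) * (2 / 3) ^ boxDepth K b) ∧
      ∀ T : Finset (Fin r → ℕ), (∀ x ∈ T, StrictMono x) →
        (∀ x ∈ T, ∀ y ∈ T, x ≠ y →
          ¬ FormsPattern (edgeOf x) (edgeOf y) {edgeOf α, edgeOf β}) →
        ∃ R ∈ F, ∀ x ∈ T, List.Forall₂ (fun u I => u / 2 ^ I.1 = I.2) (List.ofFn x) b → x ∈ R := by
  classical
  obtain ⟨v, hv⟩ := exists_eq_ofFn (length_of_mem_dyadicBoxes hb)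
  set D := boxDepth K b with hD
  have hsk : ∀ i, t - D / 3 ≤ (v i).1 := by
    intro i
    have hmem : v i ∈ b := by rw [hv]; exact List.mem_ofFn.2 ⟨i, rfl⟩
    have h1 := two_mul_le_boxDepth (by omega) hb _ hmem
    have h2 := (div_eq_of_mem_dyadicBoxes hb _ hmem).1
    omega
  have hsum : (∑ i, (v i).1) + D = r * K := by
    have := sum_add_boxDepth fun I hI => (div_eq_of_mem_dyadicBoxes hb I hI).1
    rw [length_of_mem_dyadicBoxes hb] at this
    rw [← this, hv, List.map_ofFn, List.sum_ofFn, hD, hv]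
    rfl
  have hpair := pairwise_of_mem_dyadicBoxes hb
  rw [hv, List.pairwise_ofFn] at hpair
  obtain ⟨F, hF, hFR, hFT⟩ := exists_box_containers (by omega) (fun i => α i < β i)
    (fun i => (v i).1) (fun i => (v i).2) _ hsk
  refine ⟨F, hF, fun R hR => ?_, fun T hT hfree => ?_⟩
  · have h1 : (R.card : ℝ) * 2 ^ (t - D / 3) ≤ r * 2 ^ ∑ i, (v i).1 := by
      exact_mod_cast hFR R hR
    have h2 : (2 : ℝ) ^ t ≤ 2 ^ (t - D / 3) * 2 ^ (D / 3) := by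
      rw [← pow_add]
      exact pow_le_pow_right₀ (by norm_num) (by omega)
    have h3 : (2 : ℝ) ^ (∑ i, (v i).1) * 2 ^ (D / 3) * 4 ^ (D / 3) ≤ 2 ^ (r * K) := by
      have : (4 : ℝ) ^ (D / 3) = 2 ^ (2 * (D / 3)) := by rw [pow_mul]; norm_num
      rw [this, ← pow_add, ← pow_add]
      exact pow_le_pow_right₀ (by norm_num) (by omega)
    calc (R.card : ℝ) * 2 ^ t ≤ R.card * (2 ^ (t - D / 3) * 2 ^ (D / 3)) := by gcongr
      _ = (R.card * 2 ^ (t - D / 3)) * 2 ^ (D / 3) := by ring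
      _ ≤ (r * 2 ^ ∑ i, (v i).1) * 2 ^ (D / 3) * 1 := by rw [mul_one]; gcongr
      _ ≤ (r * 2 ^ ∑ i, (v i).1) * 2 ^ (D / 3) * (9 / 4 * (2 / 3) ^ D * 4 ^ (D / 3)) := by
          gcongr
          exact one_le_pow_mul_four_pow D
      _ = r * (9 / 4 * (2 / 3) ^ D) * (2 ^ (∑ i, (v i).1) * 2 ^ (D / 3) * 4 ^ (D / 3)) := by ring
      _ ≤ r * (9 / 4 * (2 / 3) ^ D) * 2 ^ (r * K) := by gcongr
      _ = _ := by ring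
  · have hforall : ∀ x : Fin r → ℕ,
        List.Forall₂ (fun u I => u / 2 ^ I.1 = I.2) (List.ofFn x) b →
          ∀ i, x i / 2 ^ (v i).1 = (v i).2 := by
      intro x hx i
      rw [hv, List.forall₂_iff_get] at hx
      simpa using hx.2 i (by simp) (by simp)
    obtain ⟨R, hR, hTR⟩ := hFT
      (T.filter fun x => ∀ i, x i / 2 ^ (v i).1 = (v i).2)
      (fun x hx => (Finset.mem_filter.1 hx).2) (by
        intro x hx y hy hxy
        obtain ⟨hxT, hx⟩ := Finset.mem_filter.1 hx
        obtain ⟨hyT, hy⟩ := Finset.mem_filter.1 hy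
        have hαβ : ∀ i, ¬ α i < β i → β i < α i := fun i h => by
          have := hI i
          omega
        refine hfree x hxT y hyT ?_ (formsPattern_of_interleaved hI (hT x hxT) (hT y hyT)
          (fun i j hij => hpair hij _ _ (hx i) (hy j)) (fun i j hij => hpair hij _ _ (hy i) (hx j))
          (fun i h => (hxy i).1 h) (fun i h => (hxy i).2 h.not_gt))
        rintro rfl
        have h := hxy ⟨0, by omega⟩
        rcases em (α ⟨0, by omega⟩ < β ⟨0, by omega⟩) with h0 | h0
        · exact lt_irrefl _ (h.1 h0)
        · exact lt_irrefl _ (h.2 h0))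
    exact ⟨R, hR, fun x hx hxb => hTR (Finset.mem_filter.2 ⟨hx, hforall x hxb⟩)⟩

theorem exists_containers {r : ℕ} (hr : 3 ≤ r) :
    ∃ c : ℝ, 0 ≤ c ∧ ∀ α β : Fin r → ℕ, IsInterleaved α β → ∀ K t : ℕ, 2 * t ≤ K →
      ∃ G : Finset (Finset (Fin r → ℕ)),
        (G.card : ℝ) ≤ Real.exp (c * 2 ^ (t * (r - 1))) ∧
        (∀ R ∈ G, (R.card : ℝ) * 2 ^ t ≤ c * 2 ^ (r * K)) ∧
        ∀ T : Finset (Fin r → ℕ), (∀ x ∈ T, StrictMono x) → (∀ x ∈ T, ∀ i, x i < 2 ^ K) →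
          (∀ x ∈ T, ∀ y ∈ T, x ≠ y →
            ¬ FormsPattern (edgeOf x) (edgeOf y) {edgeOf α, edgeOf β}) →
          ∃ R ∈ G, T ⊆ R := by
  classical
  obtain ⟨w, hw0, hw⟩ := exists_sum_dyadicBoxes_le r
  refine ⟨9 / 4 * r * 2 ^ r * w, by positivity, fun α β hI K t hK => ?_⟩
  have hbox : ∀ b : List (ℕ × ℕ), b ∈ dyadicBoxes K r 0 → _ := fun b hb =>
    exists_dyadicBox_containers hr hI hK hb
  choose! F hF hFR hFT using hbox
  let un : ((b : List (ℕ × ℕ)) → b ∈ dyadicBoxes K r 0 → Finset (Fin r → ℕ)) →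
      Finset (Fin r → ℕ) := fun f => (dyadicBoxes K r 0).attach.biUnion fun b => f b b.2
  refine ⟨((dyadicBoxes K r 0).pi F).image un, ?_, ?_, ?_⟩
  · have h1 : (((dyadicBoxes K r 0).pi F).image un).card ≤
        2 ^ (r * 2 ^ r * ∑ b ∈ dyadicBoxes K r 0,
          ∑ i ∈ Finset.range (t - boxDepth K b / 3), (2 ^ i) ^ (r - 1)) := by
      refine Finset.card_image_le.trans ?_
      rw [Finset.card_pi, Finset.mul_sum, ← Finset.prod_pow_eq_pow_sum]
      exact Finset.prod_le_prod' fun b hb => hF b hb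
    have h2 : ((∑ b ∈ dyadicBoxes K r 0,
        ∑ i ∈ Finset.range (t - boxDepth K b / 3), (2 ^ i) ^ (r - 1) : ℕ) : ℝ) ≤
        9 / 4 * 2 ^ (t * (r - 1)) * w := by
      rw [Nat.cast_sum]
      refine (Finset.sum_le_sum fun b _ =>
        sum_range_sub_div_three_le (d := r - 1) (by omega) t (boxDepth K b)).trans ?_
      rw [← Finset.mul_sum]
      gcongr
      exact hw K 0
    have h3 : ((((dyadicBoxes K r 0).pi F).image un).card : ℝ) ≤
        2 ^ (r * 2 ^ r * ∑ b ∈ dyadicBoxes K r 0,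
          ∑ i ∈ Finset.range (t - boxDepth K b / 3), (2 ^ i) ^ (r - 1)) := by
      exact_mod_cast h1
    refine h3.trans ?_
    have h4 : (2 : ℝ) ≤ Real.exp 1 := by
      have := Real.add_one_le_exp (1 : ℝ)
      linarith
    refine (pow_le_pow_left₀ (by norm_num) h4 _).trans ?_
    rw [← Real.exp_nat_mul, mul_one, Real.exp_le_exp, Nat.cast_mul]
    push_cast at h2 ⊢
    calc _ ≤ (r * 2 ^ r : ℝ) * (9 / 4 * 2 ^ (t * (r - 1)) * w) := by gcongr
      _ = _ := by ring
  · intro R hR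
    obtain ⟨f, hf, rfl⟩ := Finset.mem_image.1 hR
    rw [Finset.mem_pi] at hf
    have h1 : ((un f).card : ℝ) ≤ ∑ b ∈ (dyadicBoxes K r 0).attach, ((f b b.2).card : ℝ) := by
      exact_mod_cast Finset.card_biUnion_le
    calc ((un f).card : ℝ) * 2 ^ t
        ≤ (∑ b ∈ (dyadicBoxes K r 0).attach, ((f b b.2).card : ℝ)) * 2 ^ t := by gcongr
      _ = ∑ b ∈ (dyadicBoxes K r 0).attach, ((f b b.2).card : ℝ) * 2 ^ t := Finset.sum_mul _ _ _
      _ ≤ ∑ b ∈ (dyadicBoxes K r 0).attach,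
          9 / 4 * r * 2 ^ (r * K) * (2 / 3 : ℝ) ^ boxDepth K (b : List (ℕ × ℕ)) :=
        Finset.sum_le_sum fun b _ => hFR b b.2 _ (hf b b.2)
      _ = ∑ b ∈ dyadicBoxes K r 0, 9 / 4 * r * 2 ^ (r * K) * (2 / 3 : ℝ) ^ boxDepth K b :=
        Finset.sum_attach (dyadicBoxes K r 0) fun b =>
          9 / 4 * r * 2 ^ (r * K) * (2 / 3 : ℝ) ^ boxDepth K b
      _ ≤ 9 / 4 * r * 2 ^ (r * K) * w := by
        rw [← Finset.mul_sum]
        gcongr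
        exact hw K 0
      _ = 9 / 4 * r * 1 * w * 2 ^ (r * K) := by ring
      _ ≤ 9 / 4 * r * 2 ^ r * w * 2 ^ (r * K) := by
        gcongr
        exact one_le_pow₀ (by norm_num)
  · intro T hT hTK hfree
    have hR := fun b (hb : b ∈ dyadicBoxes K r 0) => hFT b hb T hT hfree
    choose R hRF hR using hR
    refine ⟨un R, Finset.mem_image_of_mem _ (Finset.mem_pi.2 hRF), fun x hx => ?_⟩
    obtain ⟨b, hb, hxb⟩ := exists_mem_dyadicBoxes (K := K) (a := 0) (l := List.ofFn x)
      (List.pairwise_ofFn.2 fun i j hij => hT x hx hij) (by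
        intro u hu
        obtain ⟨i, rfl⟩ := List.mem_ofFn.1 hu
        exact Nat.div_eq_of_lt (hTK x hx i))
    rw [List.length_ofFn] at hb
    exact Finset.mem_biUnion.2 ⟨⟨b, hb⟩, Finset.mem_attach _ _, hR b hb x hx hxb⟩

theorem patternFreeCount_le_of_containers {r n K V : ℕ} {P : Finset (Finset ℕ)}
    (hK : r * n < 2 ^ K) {G : Finset (Finset (Fin r → ℕ))} (hV : ∀ R ∈ G, R.card ≤ V)
    (hG : ∀ T : Finset (Fin r → ℕ), (∀ x ∈ T, StrictMono x) → (∀ x ∈ T, ∀ i, x i < 2 ^ K) →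
      (∀ x ∈ T, ∀ y ∈ T, x ≠ y → ¬ FormsPattern (edgeOf x) (edgeOf y) P) → ∃ R ∈ G, T ⊆ R) :
    patternFreeCount r n P ≤ G.card * V.choose n := by
  classical
  let F : Finset (Finset (Finset ℕ)) :=
    G.biUnion fun R => (R.powersetCard n).image fun T => T.image edgeOf
  have hF : F.card ≤ G.card * V.choose n := by
    refine Finset.card_biUnion_le_card_mul _ _ _ fun R hR => Finset.card_image_le.trans ?_
    rw [Finset.card_powersetCard]
    exact Nat.choose_le_choose n (hV R hR)
  refine le_trans ?_ hF
  have hsub : {M : Finset (Finset ℕ) | IsOrderedMatching r n M ∧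
      ∀ e ∈ M, ∀ f ∈ M, e ≠ f → ¬ FormsPattern e f P} ⊆ (F : Set (Finset (Finset ℕ))) := by
    rintro M ⟨⟨hMn, hMr, -, hMU⟩, hMP⟩
    have hex : ∀ e : Finset ℕ, ∃ x : Fin r → ℕ, e ∈ M → StrictMono x ∧ edgeOf x = e := by
      intro e
      by_cases he : e ∈ M
      · obtain ⟨x, hx⟩ := exists_strictMono_edgeOf_eq (hMr e he)
        exact ⟨x, fun _ => hx⟩
      · exact ⟨0, fun h => absurd h he⟩
    choose x hx using hex
    have himg : (M.image x).image edgeOf = M := by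
      rw [Finset.image_image]
      conv_rhs => rw [← Finset.image_id (s := M)]
      exact Finset.image_congr fun e he => (hx e he).2
    have hcard : (M.image x).card = n := by
      rw [Finset.card_image_of_injOn, hMn]
      intro e he f hf hef
      rw [← (hx e he).2, ← (hx f hf).2]
      exact congrArg edgeOf hef
    obtain ⟨R, hR, hTR⟩ := hG (M.image x) (by
        intro y hy
        obtain ⟨e, he, rfl⟩ := Finset.mem_image.1 hy
        exact (hx e he).1) (by
        intro y hy i
        obtain ⟨e, he, rfl⟩ := Finset.mem_image.1 hy
        have h1 : x e i ∈ e := by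
          have : x e i ∈ edgeOf (x e) := mem_edgeOf.2 ⟨i, rfl⟩
          rwa [(hx e he).2] at this
        have h2 : x e i ∈ Finset.Icc 1 (r * n) := by
          rw [← hMU]
          exact Finset.mem_biUnion.2 ⟨e, he, h1⟩
        exact (Finset.mem_Icc.1 h2).2.trans_lt hK) (by
        intro y hy z hz hyz
        obtain ⟨e, he, rfl⟩ := Finset.mem_image.1 hy
        obtain ⟨f, hf, rfl⟩ := Finset.mem_image.1 hz
        rw [(hx e he).2, (hx f hf).2]
        exact hMP e he f hf fun h => hyz (congrArg x h))
    exact Finset.mem_coe.2 (Finset.mem_biUnion.2 ⟨R, hR, Finset.mem_image.2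
      ⟨M.image x, Finset.mem_powersetCard.2 ⟨hTR, hcard⟩, himg⟩⟩)
  have := Set.ncard_le_ncard hsub F.finite_toSet
  rwa [Set.ncard_coe_finset, ← Nat.card_coe_set_eq] at this

theorem choose_le_pow_of_le {V n : ℕ} {v : ℝ} (hn : 1 ≤ n) (hV : (V : ℝ) ≤ v) :
    (V.choose n : ℝ) ≤ (Real.exp 1 * (v / n)) ^ n := by
  have hn' : (0 : ℝ) < n := by exact_mod_cast hn
  have h1 : (V.choose n : ℝ) ≤ (V : ℝ) ^ n / n.factorial := Nat.choose_le_pow_div n V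
  have h2 : (n : ℝ) ^ n / n.factorial ≤ Real.exp n :=
    Real.pow_div_factorial_le_exp _ hn'.le n
  have h3 : (V : ℝ) ^ n ≤ v ^ n := pow_le_pow_left₀ (Nat.cast_nonneg V) hV n
  have h4 : (v / n) ^ n * ((n : ℝ) ^ n / n.factorial) = v ^ n / n.factorial := by
    rw [div_pow]
    field_simp
  have hv : (0 : ℝ) ≤ v := (Nat.cast_nonneg V).trans hV
  calc (V.choose n : ℝ) ≤ v ^ n / n.factorial := h1.trans (by gcongr)
    _ = (v / n) ^ n * ((n : ℝ) ^ n / n.factorial) := h4.symm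
    _ ≤ (v / n) ^ n * Real.exp n := by gcongr
    _ = (Real.exp 1 * (v / n)) ^ n := by
      rw [mul_pow, ← Real.exp_nat_mul, mul_one, mul_comm]

theorem exists_patternFreeCount_le {d : ℕ} (hd : 2 ≤ d) :
    ∃ c : ℝ, 0 < c ∧ ∀ α β : Fin (d + 1) → ℕ, IsInterleaved α β → ∀ (n t : ℕ) (u : ℝ), 1 ≤ n →
      0 < u → u ^ d = n → (2 : ℝ) ^ t ≤ u → u ≤ 2 ^ (t + 1) →
      (patternFreeCount (d + 1) n {edgeOf α, edgeOf β} : ℝ) ≤ (c * ((n : ℝ) ^ d / u)) ^ n := by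
  obtain ⟨c, hc0, hc⟩ := exists_containers (r := d + 1) (by omega)
  refine ⟨Real.exp c * (Real.exp 1 * (2 * c * (2 * (d + 1)) ^ (d + 1))) + 1, by positivity, ?_⟩
  intro α β hI n t u hn hu hun htu hut
  have hn' : (0 : ℝ) < n := by exact_mod_cast hn
  have htn : 2 ^ (t * d) ≤ n := by
    have : ((2 : ℝ) ^ t) ^ d ≤ n := hun ▸ pow_le_pow_left₀ (by positivity) htu d
    rw [← pow_mul] at this
    exact_mod_cast this
  let K := Nat.log 2 ((d + 1) * n) + 1
  have hK1 : (d + 1) * n < 2 ^ K := Nat.lt_pow_succ_log_self (by norm_num) _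
  have hK2 : 2 ^ K ≤ 2 * ((d + 1) * n) := by
    rw [pow_succ, mul_comm]
    exact Nat.mul_le_mul_left 2 (Nat.pow_log_le_self 2 (by positivity))
  have htK : 2 * t ≤ K := by
    have h1 : 2 ^ (t * d) < 2 ^ K := by
      refine lt_of_le_of_lt htn (lt_of_le_of_lt ?_ hK1)
      exact Nat.le_mul_of_pos_left n (by omega)
    have h2 := (Nat.pow_lt_pow_iff_right (by norm_num)).1 h1
    nlinarith
  obtain ⟨G, hG1, hG2, hG3⟩ := hc α β hI K t htK
  have hcount := patternFreeCount_le_of_containers (V := G.sup Finset.card) hK1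
    (fun R hR => Finset.le_sup (f := Finset.card) hR) hG3
  have hV : ((G.sup Finset.card : ℕ) : ℝ) ≤ c * 2 ^ ((d + 1) * K) / 2 ^ t := by
    rcases G.eq_empty_or_nonempty with rfl | hne
    · simp only [Finset.sup_empty, bot_eq_zero', Nat.cast_zero]
      positivity
    · obtain ⟨R, hR, hRe⟩ := Finset.exists_mem_eq_sup G hne Finset.card
      rw [hRe, le_div_iff₀ (by positivity)]
      exact hG2 R hR
  have hV2 : c * 2 ^ ((d + 1) * K) / 2 ^ t / n ≤
      2 * c * (2 * (d + 1)) ^ (d + 1) * ((n : ℝ) ^ d / u) := by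
    have h1 : ((2 : ℝ) ^ K) ^ (d + 1) ≤ (2 * ((d + 1) * n)) ^ (d + 1) := by
      have : (2 : ℝ) ^ K ≤ 2 * ((d + 1) * n) := by exact_mod_cast hK2
      exact pow_le_pow_left₀ (by positivity) this _
    have h2 : u / 2 ≤ 2 ^ t := by
      rw [pow_succ] at hut
      linarith
    rw [mul_comm (d + 1) K, pow_mul]
    calc c * ((2 : ℝ) ^ K) ^ (d + 1) / 2 ^ t / n
        ≤ c * (2 * ((d + 1) * n)) ^ (d + 1) / (u / 2) / n := by gcongr
      _ = 2 * c * (2 * (d + 1)) ^ (d + 1) * ((n : ℝ) ^ d / u) := by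
        rw [← mul_assoc, mul_pow _ (n : ℝ), pow_succ (n : ℝ)]
        field_simp
  have hexp : (G.card : ℝ) ≤ Real.exp c ^ n := by
    refine hG1.trans ?_
    rw [← Real.exp_nat_mul, Real.exp_le_exp, Nat.add_sub_cancel, mul_comm]
    have : ((2 : ℝ) ^ (t * d)) ≤ n := by exact_mod_cast htn
    gcongr
  calc (patternFreeCount (d + 1) n {edgeOf α, edgeOf β} : ℝ)
      ≤ G.card * ((G.sup Finset.card).choose n : ℕ) := by exact_mod_cast hcount
    _ ≤ Real.exp c ^ n * (Real.exp 1 * (c * 2 ^ ((d + 1) * K) / 2 ^ t / n)) ^ n := by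
      gcongr
      exact choose_le_pow_of_le hn hV
    _ ≤ Real.exp c ^ n *
        (Real.exp 1 * (2 * c * (2 * (d + 1)) ^ (d + 1) * ((n : ℝ) ^ d / u))) ^ n := by
      gcongr
    _ = (Real.exp c * (Real.exp 1 * (2 * c * (2 * (d + 1)) ^ (d + 1))) *
        ((n : ℝ) ^ d / u)) ^ n := by
      rw [← mul_pow]
      ring_nf
    _ ≤ _ := by
      gcongr
      linarith

/-- `x < y` are the two vertices of an edge of `M`. -/
def IsArc (M : Finset (Finset ℕ)) (x y : ℕ) : Prop := x < y ∧ {x, y} ∈ M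

theorem IsOrderedMatching.eq_of_mem {r n : ℕ} {M : Finset (Finset ℕ)}
    (hM : IsOrderedMatching r n M) {e f : Finset ℕ} (he : e ∈ M) (hf : f ∈ M) {v : ℕ}
    (hve : v ∈ e) (hvf : v ∈ f) : e = f := by
  by_contra h
  exact Finset.disjoint_left.1 (hM.2.2.1 e he f hf h) hve hvf

theorem IsOrderedMatching.isArc_eq {n : ℕ} {M : Finset (Finset ℕ)}
    (hM : IsOrderedMatching 2 n M) {x y x' y' v : ℕ} (h : IsArc M x y) (h' : IsArc M x' y')
    (hv : v = x ∨ v = y) (hv' : v = x' ∨ v = y') : x = x' ∧ y = y' := by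
  obtain ⟨h1, h2⟩ := h
  obtain ⟨h3, h4⟩ := h'
  have heq : ({x, y} : Finset ℕ) = {x', y'} :=
    hM.eq_of_mem h2 h4 (v := v) (by simpa using hv) (by simpa using hv')
  have h5 : x = x' ∨ x = y' := by
    have : x ∈ ({x', y'} : Finset ℕ) := by simp [← heq]
    simpa using this
  have h6 : y = x' ∨ y = y' := by
    have : y ∈ ({x', y'} : Finset ℕ) := by simp [← heq]
    simpa using this
  omega

theorem IsOrderedMatching.exists_isArc {n : ℕ} {M : Finset (Finset ℕ)}
    (hM : IsOrderedMatching 2 n M) {e : Finset ℕ} (he : e ∈ M) :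
    ∃ x y, IsArc M x y ∧ e = {x, y} := by
  obtain ⟨x, y, hxy, rfl⟩ := Finset.card_eq_two.1 (hM.2.1 e he)
  rcases hxy.lt_or_gt with h | h
  · exact ⟨x, y, ⟨h, he⟩, rfl⟩
  · exact ⟨y, x, ⟨h, by rwa [Finset.pair_comm]⟩, Finset.pair_comm x y⟩

theorem IsOrderedMatching.mem_Icc {r n : ℕ} {M : Finset (Finset ℕ)}
    (hM : IsOrderedMatching r n M) {e : Finset ℕ} (he : e ∈ M) {v : ℕ} (hv : v ∈ e) :
    v ∈ Finset.Icc 1 (r * n) := by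
  rw [← hM.2.2.2]
  exact Finset.mem_biUnion.2 ⟨e, he, hv⟩

theorem IsOrderedMatching.exists_isArc_left {n : ℕ} {M M' : Finset (Finset ℕ)}
    (hM : IsOrderedMatching 2 n M) (hM' : IsOrderedMatching 2 n M')
    (hopen : ∀ x, (∃ y, IsArc M x y) ↔ ∃ y, IsArc M' x y) {x y : ℕ} (h : IsArc M x y) :
    ∃ z, IsArc M' z y := by
  have hy : y ∈ M'.biUnion id := by
    rw [hM'.2.2.2]
    exact hM.mem_Icc h.2 (by simp)
  obtain ⟨e, he, hye⟩ := Finset.mem_biUnion.1 hy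
  obtain ⟨a, b, hab, rfl⟩ := hM'.exists_isArc he
  have hye' : y = a ∨ y = b := by simpa using hye
  rcases hye' with rfl | rfl
  · obtain ⟨z, hz⟩ := (hopen y).2 ⟨b, hab⟩
    have := hM.isArc_eq h hz (Or.inr rfl) (Or.inl rfl)
    exact absurd h.1 (by omega)
  · exact ⟨a, hab⟩

theorem IsOrderedMatching.isArc_eq_of_forall_lt {n : ℕ} {M M' : Finset (Finset ℕ)}
    (hM : IsOrderedMatching 2 n M) (hM' : IsOrderedMatching 2 n M')
    (hopen : ∀ x, (∃ y, IsArc M x y) ↔ ∃ y, IsArc M' x y)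
    (hn : ∀ x y x' y', IsArc M x y → IsArc M x' y' → x < x' → y < y')
    (hn' : ∀ x y x' y', IsArc M' x y → IsArc M' x' y' → x < x' → y < y') :
    ∀ x y y', IsArc M x y → IsArc M' x y' → y = y' := by
  intro x
  induction x using Nat.strong_induction_on with
  | _ x ih =>
    intro y y' h h'
    rcases lt_trichotomy y y' with hlt | heq | hlt
    · obtain ⟨z, hz⟩ := hM.exists_isArc_left hM' hopen h
      have hzx : z < x := by
        by_contra hzx
        rcases (not_lt.1 hzx).eq_or_lt with rfl | hxz
        · have := hM'.isArc_eq h' hz (Or.inl rfl) (Or.inl rfl)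
          omega
        · have := hn' _ _ _ _ h' hz hxz
          omega
      obtain ⟨w, hw⟩ := (hopen z).2 ⟨y, hz⟩
      have hwy := ih z hzx w y hw hz
      subst hwy
      have := hM.isArc_eq h hw (Or.inr rfl) (Or.inr rfl)
      omega
    · exact heq
    · obtain ⟨z, hz⟩ := hM'.exists_isArc_left hM (fun x => (hopen x).symm) h'
      have hzx : z < x := by
        by_contra hzx
        rcases (not_lt.1 hzx).eq_or_lt with rfl | hxz
        · have := hM.isArc_eq h hz (Or.inl rfl) (Or.inl rfl)
          omega
        · have := hn _ _ _ _ h hz hxz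
          omega
      obtain ⟨w, hw⟩ := (hopen z).1 ⟨y', hz⟩
      have hwy := ih z hzx y' w hz hw
      subst hwy
      have := hM'.isArc_eq h' hw (Or.inr rfl) (Or.inr rfl)
      omega

theorem IsOrderedMatching.isArc_eq_of_forall_gt {n : ℕ} {M M' : Finset (Finset ℕ)}
    (hM : IsOrderedMatching 2 n M) (hM' : IsOrderedMatching 2 n M')
    (hopen : ∀ x, (∃ y, IsArc M x y) ↔ ∃ y, IsArc M' x y)
    (hn : ∀ x y x' y', IsArc M x y → IsArc M x' y' → x < x' → x' < y → y' < y)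
    (hn' : ∀ x y x' y', IsArc M' x y → IsArc M' x' y' → x < x' → x' < y → y' < y) :
    ∀ y x x', IsArc M x y → IsArc M' x' y → x = x' := by
  intro y
  induction y using Nat.strong_induction_on with
  | _ y ih =>
    intro x x' h h'
    rcases lt_trichotomy x x' with hlt | heq | hlt
    · obtain ⟨z, hz⟩ := (hopen x').2 ⟨y, h'⟩
      have hzy := hn _ _ _ _ h hz hlt h'.1
      obtain ⟨w, hw⟩ := hM.exists_isArc_left hM' hopen hz
      have hwx := ih z hzy x' w hz hw
      subst hwx
      have := hM'.isArc_eq h' hw (Or.inl rfl) (Or.inl rfl)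
      omega
    · exact heq
    · obtain ⟨z, hz⟩ := (hopen x).1 ⟨y, h⟩
      have hzy := hn' _ _ _ _ h' hz hlt h.1
      obtain ⟨w, hw⟩ := hM'.exists_isArc_left hM (fun x => (hopen x).symm) hz
      have hwx := ih z hzy w x hw hz
      subst hwx
      have := hM.isArc_eq h hw (Or.inl rfl) (Or.inl rfl)
      omega

theorem IsArc.formsPattern {α β : Fin 2 → ℕ} (hI : IsInterleaved α β) {M : Finset (Finset ℕ)}
    {x y x' y' : ℕ} (h : IsArc M x y) (h' : IsArc M x' y') (h1 : x < y') (h2 : x' < y)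
    (h3 : α 0 < β 0 → x < x') (h4 : β 0 < α 0 → x' < x) (h5 : α 1 < β 1 → y < y')
    (h6 : β 1 < α 1 → y' < y) :
    FormsPattern {x, y} {x', y'} {edgeOf α, edgeOf β} := by
  have hedge : ∀ a b : ℕ, ({a, b} : Finset ℕ) = edgeOf ![a, b] := by
    intro a b
    ext v
    simp [mem_edgeOf, eq_comm]
  rw [hedge, hedge]
  have hmono : ∀ {a b : ℕ}, a < b → StrictMono ![a, b] := by
    intro a b hab i j hij
    fin_cases i <;> fin_cases j <;> simp_all
  refine formsPattern_of_interleaved hI (hmono h.1) (hmono h'.1) ?_ ?_ ?_ ?_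
  · intro i j hij
    fin_cases i <;> fin_cases j <;> simp_all
  · intro i j hij
    fin_cases i <;> fin_cases j <;> simp_all
  · intro i
    fin_cases i <;> simpa
  · intro i
    fin_cases i <;> simpa

theorem IsOrderedMatching.eq_of_patternFree {n : ℕ} {M M' : Finset (Finset ℕ)}
    (hM : IsOrderedMatching 2 n M) (hM' : IsOrderedMatching 2 n M')
    (hopen : ∀ x, (∃ y, IsArc M x y) ↔ ∃ y, IsArc M' x y) {α β : Fin 2 → ℕ}
    (hI : IsInterleaved α β)
    (hP : ∀ e ∈ M, ∀ f ∈ M, e ≠ f → ¬ FormsPattern e f {edgeOf α, edgeOf β})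
    (hP' : ∀ e ∈ M', ∀ f ∈ M', e ≠ f → ¬ FormsPattern e f {edgeOf α, edgeOf β}) :
    M = M' := by
  have hfree : ∀ {N : Finset (Finset ℕ)}, IsOrderedMatching 2 n N →
      (∀ e ∈ N, ∀ f ∈ N, e ≠ f → ¬ FormsPattern e f {edgeOf α, edgeOf β}) →
      ∀ {x y x' y'}, IsArc N x y → IsArc N x' y' → x < x' → x' < y →
        ((α 0 < β 0 ↔ α 1 < β 1) → y' < y) ∧ (¬ (α 0 < β 0 ↔ α 1 < β 1) → y < y') := by
    intro N hN hNP x y x' y' h h' hlt hlt'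
    have hne : ({x, y} : Finset ℕ) ≠ {x', y'} := by
      intro heq
      have : x ∈ ({x', y'} : Finset ℕ) := by simp [← heq]
      have h1 : x = x' ∨ x = y' := by simpa using this
      have := h'.1
      omega
    have hyy : y ≠ y' := fun heq => by
      have := hN.isArc_eq h h' (Or.inr heq.symm) (Or.inr rfl)
      omega
    have h0 := hI 0
    have h1 := hI 1
    have hxy := h.1
    have hxy' := h'.1
    by_contra hcon
    by_cases hs : α 0 < β 0
    · refine hNP _ h.2 _ h'.2 hne (IsArc.formsPattern hI h h' ?_ ?_ ?_ ?_ ?_ ?_) <;> grind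
    · refine hNP _ h'.2 _ h.2 hne.symm (IsArc.formsPattern hI h' h ?_ ?_ ?_ ?_ ?_ ?_) <;> grind
  have hsub : M ⊆ M' := by
    intro e he
    obtain ⟨x, y, hxy, rfl⟩ := hM.exists_isArc he
    by_cases hs : α 0 < β 0 ↔ α 1 < β 1
    · obtain ⟨x', hx'⟩ := hM.exists_isArc_left hM' hopen hxy
      have := hM.isArc_eq_of_forall_gt hM' hopen
        (fun _ _ _ _ h h' h1 h2 => (hfree hM hP h h' h1 h2).1 hs)
        (fun _ _ _ _ h h' h1 h2 => (hfree hM' hP' h h' h1 h2).1 hs) y x x' hxy hx'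
      rw [this]
      exact hx'.2
    · have hlt : ∀ {N : Finset (Finset ℕ)}, IsOrderedMatching 2 n N →
          (∀ e ∈ N, ∀ f ∈ N, e ≠ f → ¬ FormsPattern e f {edgeOf α, edgeOf β}) →
          ∀ x y x' y', IsArc N x y → IsArc N x' y' → x < x' → y < y' := by
        intro N hN hNP x y x' y' h h' h1
        rcases lt_or_ge x' y with h2 | h2
        · exact (hfree hN hNP h h' h1 h2).2 hs
        · exact h2.trans_lt h'.1
      obtain ⟨y', hy'⟩ := (hopen x).1 ⟨y, hxy⟩
      have := hM.isArc_eq_of_forall_lt hM' hopen (hlt hM hP) (hlt hM' hP') x y y' hxy hy'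
      rw [this]
      exact hy'.2
  exact Finset.eq_of_subset_of_card_le hsub (by rw [hM.1, hM'.1])

theorem patternFreeCount_two_le {α β : Fin 2 → ℕ} (hI : IsInterleaved α β) (n : ℕ) :
    patternFreeCount 2 n {edgeOf α, edgeOf β} ≤ 4 ^ n := by
  classical
  let F : {M : Finset (Finset ℕ) // IsOrderedMatching 2 n M ∧
      ∀ e ∈ M, ∀ f ∈ M, e ≠ f → ¬ FormsPattern e f {edgeOf α, edgeOf β}} →
      (Finset.Icc 1 (2 * n)).powerset :=
    fun M => ⟨(Finset.Icc 1 (2 * n)).filter fun x => ∃ y, IsArc M.1 x y,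
      Finset.mem_powerset.2 (Finset.filter_subset _ _)⟩
  have hF : Function.Injective F := by
    intro M M' h
    refine Subtype.ext (M.2.1.eq_of_patternFree M'.2.1 (fun x => ?_) hI M.2.2 M'.2.2)
    have h' := Finset.ext_iff.1 (congrArg Subtype.val h) x
    simp only [F, Finset.mem_filter] at h'
    constructor
    · rintro ⟨y, hy⟩
      exact (h'.1 ⟨M.2.1.mem_Icc hy.2 (by simp), y, hy⟩).2
    · rintro ⟨y, hy⟩
      exact (h'.2 ⟨M'.2.1.mem_Icc hy.2 (by simp), y, hy⟩).2
  have := Nat.card_le_card_of_injective F hF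
  rw [Nat.card_eq_fintype_card (α := (Finset.Icc 1 (2 * n)).powerset), Fintype.card_coe,
    Finset.card_powerset, Nat.card_Icc, Nat.add_sub_cancel, pow_mul] at this
  exact this

theorem exists_coordinates {d m n : ℕ} (h : n ≤ m ^ d) :
    ∃ A : Fin (d + 1) → Fin n → ℕ, (∀ i j, A i j ≤ d * m) ∧ (∀ j, ∑ i, A i j = d * m) ∧
      ∀ j k, (∀ i, A i j = A i k) → j = k := by
  obtain ⟨f⟩ : Nonempty (Fin n ↪ (Fin d → Fin m)) :=
    Function.Embedding.nonempty_of_card_le (by simpa using h)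
  have hle : ∀ j, ∑ i, (f j i : ℕ) ≤ d * m := fun j =>
    (Finset.sum_le_card_nsmul _ _ m fun i _ => (f j i).2.le).trans (by simp)
  have hsum : ∀ j, ∑ i, Fin.snoc (α := fun _ => ℕ) (fun i => (f j i : ℕ))
      (d * m - ∑ i, (f j i : ℕ)) i = d * m := by
    intro j
    rw [Fin.sum_univ_castSucc]
    simp only [Fin.snoc_castSucc, Fin.snoc_last]
    exact Nat.add_sub_of_le (hle j)
  refine ⟨fun i j => Fin.snoc (α := fun _ => ℕ) (fun i => (f j i : ℕ))
      (d * m - ∑ i, (f j i : ℕ)) i, fun i j => ?_, hsum, fun j k hjk => ?_⟩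
  · exact (Finset.single_le_sum (f := fun i => Fin.snoc (α := fun _ => ℕ)
      (fun i => (f j i : ℕ)) (d * m - ∑ i, (f j i : ℕ)) i) (fun _ _ => Nat.zero_le _)
      (Finset.mem_univ i)).trans_eq (hsum j)
  · refine f.injective (funext fun i => Fin.ext ?_)
    simpa using hjk i.castSucc

theorem exists_signed_coordinates {d m n : ℕ} (hm : 1 ≤ m) (h : n ≤ m ^ d)
    (ε : Fin (d + 1) → Prop) :
    ∃ g : Fin (d + 1) → Fin n → Fin ((d + 1) * m), ∀ j k, (∀ i, ε i → g i j ≤ g i k) →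
      (∀ i, ¬ ε i → g i k ≤ g i j) → j = k := by
  classical
  obtain ⟨A, hA, hsum, hinj⟩ := exists_coordinates h
  have hdm : d * m < (d + 1) * m := by nlinarith
  refine ⟨fun i j => ⟨if ε i then A i j else d * m - A i j, ?_⟩, fun j k h1 h2 => hinj j k ?_⟩
  · split_ifs
    · exact (hA i j).trans_lt hdm
    · exact (Nat.sub_le _ _).trans_lt hdm
  · have hle : ∀ i ∈ Finset.univ, A i j ≤ A i k := by
      intro i _
      by_cases hi : ε i
      · simpa [hi] using h1 i hi
      · have h3 := h2 i hi
        have h4 := hA i j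
        have h5 := hA i k
        simp only [hi, if_false, Fin.mk_le_mk] at h3
        omega
    have := (Finset.sum_eq_sum_iff_of_le hle).1 ((hsum j).trans (hsum k).symm)
    exact fun i => this i (Finset.mem_univ i)

/-- The position in `{1,…,r*n}` of the `i`-th vertex of the edge with index `j`: within the `i`-th
interval, the edges are sorted by `g i`, and `σ i` breaks the ties. -/
noncomputable def vertexPos {r n B : ℕ} (g : Fin r → Fin n → Fin B)
    (σ : Fin r → Equiv.Perm (Fin n)) (j : Fin n) (i : Fin r) : ℕ :=
  i * n + ((Tuple.sort (g i)).symm (σ i j) : ℕ) + 1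

theorem vertexPos_lt {r n B : ℕ} (g : Fin r → Fin n → Fin B)
    (σ σ' : Fin r → Equiv.Perm (Fin n)) (j k : Fin n) {i i' : Fin r} (h : i < i') :
    vertexPos g σ j i < vertexPos g σ' k i' := by
  have h1 : (i : ℕ) + 1 ≤ i' := h
  have h2 := ((Tuple.sort (g i)).symm (σ i j)).2
  have h3 := Nat.mul_le_mul_right n h1
  rw [add_mul] at h3
  unfold vertexPos
  omega

theorem le_of_vertexPos_le {r n B : ℕ} {g : Fin r → Fin n → Fin B}
    {σ : Fin r → Equiv.Perm (Fin n)} (hσ : ∀ i, g i ∘ σ i = g i) {j k : Fin n} {i : Fin r}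
    (h : vertexPos g σ j i ≤ vertexPos g σ k i) : g i j ≤ g i k := by
  have h1 : (Tuple.sort (g i)).symm (σ i j) ≤ (Tuple.sort (g i)).symm (σ i k) := by
    rw [Fin.le_def]
    unfold vertexPos at h
    omega
  have h2 := Tuple.monotone_sort (g i) h1
  simp only [Function.comp_apply, Equiv.apply_symm_apply] at h2
  rwa [← Function.comp_apply (f := g i), ← Function.comp_apply (f := g i) (g := σ i) (x := k),
    hσ i] at h2

theorem eq_of_vertexPos_eq {r n B : ℕ} {g : Fin r → Fin n → Fin B}
    {σ σ' : Fin r → Equiv.Perm (Fin n)} {j k : Fin n} {i : Fin r}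
    (h : vertexPos g σ j i = vertexPos g σ' k i) : σ i j = σ' i k := by
  refine (Tuple.sort (g i)).symm.injective (Fin.ext ?_)
  unfold vertexPos at h
  omega

/-- The matching whose edges have the vertices given by `vertexPos`. -/
noncomputable def matchingOf {r n B : ℕ} (g : Fin r → Fin n → Fin B)
    (σ : Fin r → Equiv.Perm (Fin n)) : Finset (Finset ℕ) :=
  Finset.univ.image fun j => edgeOf (vertexPos g σ j)

theorem mem_matchingOf {r n B : ℕ} {g : Fin r → Fin n → Fin B}
    {σ : Fin r → Equiv.Perm (Fin n)} {e : Finset ℕ} :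
    e ∈ matchingOf g σ ↔ ∃ j, edgeOf (vertexPos g σ j) = e := by
  simp [matchingOf]

theorem isOrderedMatching_matchingOf {r n B : ℕ} (hr : 0 < r) (g : Fin r → Fin n → Fin B)
    (σ : Fin r → Equiv.Perm (Fin n)) : IsOrderedMatching r n (matchingOf g σ) := by
  have hmono : ∀ j, StrictMono (vertexPos g σ j) := fun j i i' h => vertexPos_lt g σ σ j j h
  have hinj : Function.Injective fun j => edgeOf (vertexPos g σ j) := by
    intro j k h
    have := congrFun (eq_of_edgeOf_eq (hmono j) (hmono k) h) ⟨0, hr⟩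
    exact (σ _).injective (eq_of_vertexPos_eq this)
  have hcard : (matchingOf g σ).card = n := by
    rw [matchingOf, Finset.card_image_of_injective _ hinj, Finset.card_univ, Fintype.card_fin]
  have hr' : ∀ e ∈ matchingOf g σ, e.card = r := by
    intro e he
    obtain ⟨j, rfl⟩ := mem_matchingOf.1 he
    exact card_edgeOf (hmono j).injective
  have hdisj : ∀ e ∈ matchingOf g σ, ∀ f ∈ matchingOf g σ, e ≠ f → Disjoint e f := by
    intro e he f hf hne
    obtain ⟨j, rfl⟩ := mem_matchingOf.1 he
    obtain ⟨k, rfl⟩ := mem_matchingOf.1 hf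
    refine Finset.disjoint_left.2 fun v hv hv' => hne ?_
    obtain ⟨i, hi⟩ := mem_edgeOf.1 hv
    obtain ⟨i', hi'⟩ := mem_edgeOf.1 hv'
    rcases lt_trichotomy i i' with h | rfl | h
    · have := vertexPos_lt g σ σ j k h
      omega
    · rw [(σ i).injective (eq_of_vertexPos_eq (hi.trans hi'.symm))]
    · have := vertexPos_lt g σ σ k j h
      omega
  refine ⟨hcard, hr', hdisj, Finset.eq_of_subset_of_card_le ?_ ?_⟩
  · intro v hv
    obtain ⟨e, he, hve⟩ := Finset.mem_biUnion.1 hv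
    obtain ⟨j, rfl⟩ := mem_matchingOf.1 he
    obtain ⟨i, rfl⟩ := mem_edgeOf.1 hve
    have h1 : (i : ℕ) + 1 ≤ r := i.2
    have h2 := ((Tuple.sort (g i)).symm (σ i j)).2
    have h3 := Nat.mul_le_mul_right n h1
    rw [add_mul] at h3
    rw [Finset.mem_Icc]
    unfold vertexPos
    omega
  · rw [Finset.card_biUnion (t := id) hdisj]
    simp only [id_eq]
    rw [Finset.sum_const_nat hr', hcard, Nat.card_Icc, Nat.add_sub_cancel, mul_comm]

theorem prod_card_le_patternFreeCount {r n B : ℕ} (hr : 0 < r) {α β : Fin r → ℕ}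
    (hI : IsInterleaved α β) (g : Fin r → Fin n → Fin B)
    (hg : ∀ j k, (∀ i, α i < β i → g i j ≤ g i k) → (∀ i, ¬ α i < β i → g i k ≤ g i j) → j = k) :
    ∏ i, Nat.card {σ : Equiv.Perm (Fin n) // g i ∘ σ = g i} ≤
      patternFreeCount r n {edgeOf α, edgeOf β} := by
  have hmono : ∀ σ j, StrictMono (vertexPos g σ j) := fun σ j i i' h => vertexPos_lt g σ σ j j h
  let F : (∀ i, {σ : Equiv.Perm (Fin n) // g i ∘ σ = g i}) →
      {M : Finset (Finset ℕ) // IsOrderedMatching r n M ∧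
        ∀ e ∈ M, ∀ f ∈ M, e ≠ f → ¬ FormsPattern e f {edgeOf α, edgeOf β}} :=
    fun σ => ⟨matchingOf g fun i => (σ i).1, isOrderedMatching_matchingOf hr g _, by
      intro e he f hf hne hP
      obtain ⟨j, rfl⟩ := mem_matchingOf.1 he
      obtain ⟨k, rfl⟩ := mem_matchingOf.1 hf
      refine hne ?_
      rcases hP.lt_iff_lt hI.strictMono.1 hI.strictMono.2 (hmono _ j) (hmono _ k) with h | h
      · rw [hg j k (fun i hi => le_of_vertexPos_le (fun i => (σ i).2) ((h i).2 hi).le)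
          fun i hi => le_of_vertexPos_le (fun i => (σ i).2) (not_lt.1 (mt (h i).1 hi))]
      · rw [hg k j (fun i hi => le_of_vertexPos_le (fun i => (σ i).2) ((h i).2 hi).le)
          fun i hi => le_of_vertexPos_le (fun i => (σ i).2) (not_lt.1 (mt (h i).1 hi))]⟩
  have hF : Function.Injective F := by
    intro σ σ' h
    have h' : matchingOf g (fun i => (σ i).1) = matchingOf g fun i => (σ' i).1 :=
      congrArg Subtype.val h
    funext i
    refine Subtype.ext (Equiv.ext fun j => ?_)
    have hj : edgeOf (vertexPos g (fun i => (σ i).1) j) ∈ matchingOf g fun i => (σ' i).1 := by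
      rw [← h']
      exact mem_matchingOf.2 ⟨j, rfl⟩
    obtain ⟨k, hk⟩ := mem_matchingOf.1 hj
    have hpos := congrFun (eq_of_edgeOf_eq (hmono _ k) (hmono _ j) hk)
    have hσ : ∀ i, (σ' i).1 k = (σ i).1 j := fun i => eq_of_vertexPos_eq (hpos i)
    have hgi : ∀ i, g i k = g i j := by
      intro i
      rw [← congrFun (σ' i).2 k, ← congrFun (σ i).2 j]
      simp only [Function.comp_apply, hσ i]
    have hkj : k = j := hg k j (fun i _ => (hgi i).le) fun i _ => (hgi i).ge
    rw [← hσ i, hkj]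
  have : Finite {M : Finset (Finset ℕ) // IsOrderedMatching r n M ∧
        ∀ e ∈ M, ∀ f ∈ M, e ≠ f → ¬ FormsPattern e f {edgeOf α, edgeOf β}} :=
    (finite_patternFree r n {edgeOf α, edgeOf β}).to_subtype
  have hle := Nat.card_le_card_of_injective F hF
  rwa [Nat.card_pi] at hle

theorem le_card_stabilizer {n B : ℕ} (hn : 1 ≤ n) (g : Fin n → Fin B) :
    ((n : ℝ) / B) ^ n * Real.exp (-n) ≤ Nat.card {σ : Equiv.Perm (Fin n) // g ∘ σ = g} := by
  classical
  have hB : 0 < B := (Nat.zero_le _).trans_lt (g ⟨0, hn⟩).2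
  have hB' : (0 : ℝ) < B := by exact_mod_cast hB
  have hn' : (0 : ℝ) < n := by exact_mod_cast hn
  rw [Nat.card_eq_fintype_card, DomMulAct.stabilizer_card, Nat.cast_prod]
  have hsum : ∑ b, Fintype.card {a // g a = b} = n := by
    rw [← Fintype.card_sigma, Fintype.card_congr (Equiv.sigmaFiberEquiv g), Fintype.card_fin]
  have hfac : ∀ c : ℕ, ((n : ℝ) / B) ^ c * Real.exp (-(n / B)) ≤ c.factorial := by
    intro c
    have h1 := Real.pow_div_factorial_le_exp ((n : ℝ) / B) (by positivity) c
    rw [div_le_iff₀ (by positivity)] at h1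
    rw [Real.exp_neg, ← div_eq_mul_inv, div_le_iff₀ (Real.exp_pos _), mul_comm]
    exact h1
  calc ((n : ℝ) / B) ^ n * Real.exp (-n)
      = ∏ b : Fin B, (((n : ℝ) / B) ^ Fintype.card {a // g a = b} * Real.exp (-(n / B))) := by
        rw [Finset.prod_mul_distrib, Finset.prod_pow_eq_pow_sum, hsum, Finset.prod_const,
          ← Real.exp_nat_mul, Finset.card_univ, Fintype.card_fin]
        congr 2
        field_simp
    _ ≤ ∏ b : Fin B, ((Fintype.card {a // g a = b}).factorial : ℝ) :=
        Finset.prod_le_prod (fun _ _ => by positivity) fun _ _ => hfac _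

theorem pow_le_patternFreeCount {d : ℕ} {α β : Fin (d + 1) → ℕ} (hI : IsInterleaved α β)
    {n t : ℕ} {u : ℝ} (hn : 1 ≤ n) (hu : 0 < u) (hun : u ^ d = n) (htu : (2 : ℝ) ^ t ≤ u)
    (hut : u ≤ 2 ^ (t + 1)) :
    ((n : ℝ) ^ d / u) ^ n ≤ ((2 * (d + 1) * Real.exp 1) ^ (d + 1)) ^ n *
      patternFreeCount (d + 1) n {edgeOf α, edgeOf β} := by
  have hn' : (0 : ℝ) < n := by exact_mod_cast hn
  have hm : n ≤ (2 ^ (t + 1)) ^ d := by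
    have : (n : ℝ) ≤ (2 ^ (t + 1)) ^ d := hun ▸ pow_le_pow_left₀ hu.le hut d
    exact_mod_cast this
  obtain ⟨g, hg⟩ := exists_signed_coordinates Nat.one_le_two_pow hm fun i => α i < β i
  have hle := prod_card_le_patternFreeCount d.succ_pos hI g hg
  have hle' : ((((n : ℝ) / ((d + 1) * 2 ^ (t + 1) : ℕ)) ^ n * Real.exp (-n)) ^ (d + 1)) ≤
      patternFreeCount (d + 1) n {edgeOf α, edgeOf β} := by
    refine le_trans ?_ (Nat.cast_le.2 hle)
    rw [Nat.cast_prod]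
    refine le_trans (le_of_eq ?_)
      (Finset.prod_le_prod (fun _ _ => by positivity) fun i _ => le_card_stabilizer hn (g i))
    rw [Finset.prod_const, Finset.card_univ, Fintype.card_fin]
  have hB : (n : ℝ) / (2 * (d + 1) * u) ≤ (n : ℝ) / ((d + 1) * 2 ^ (t + 1) : ℕ) := by
    refine div_le_div_of_nonneg_left hn'.le (by positivity) ?_
    push_cast
    rw [pow_succ]
    nlinarith [(Nat.cast_nonneg d : (0 : ℝ) ≤ d)]
  calc ((n : ℝ) ^ d / u) ^ n
      = ((2 * (d + 1) * Real.exp 1) ^ (d + 1)) ^ n *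
        (((n : ℝ) / (2 * (d + 1) * u)) ^ n * Real.exp (-n)) ^ (d + 1) := by
        have h1 : Real.exp (-n) = (Real.exp 1)⁻¹ ^ n := by
          rw [← Real.exp_neg, ← Real.exp_nat_mul, mul_neg_one]
        rw [h1, ← mul_pow, pow_right_comm _ n (d + 1), ← mul_pow, ← mul_pow]
        congr 1
        have h2 : 2 * ((d : ℝ) + 1) * Real.exp 1 * ((n : ℝ) / (2 * (d + 1) * u) *
            (Real.exp 1)⁻¹) = n / u := by
          field_simp
        rw [h2, div_pow, pow_succ u, hun, pow_succ]
        field_simp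
    _ ≤ ((2 * (d + 1) * Real.exp 1) ^ (d + 1)) ^ n *
        (((n : ℝ) / ((d + 1) * 2 ^ (t + 1) : ℕ)) ^ n * Real.exp (-n)) ^ (d + 1) := by
        gcongr
    _ ≤ _ := by gcongr

theorem exists_root_scale {d n : ℕ} (hd : 1 ≤ d) (hn : 1 ≤ n) :
    ∃ (t : ℕ) (u : ℝ), 0 < u ∧ u ^ d = n ∧ (2 : ℝ) ^ t ≤ u ∧ u ≤ 2 ^ (t + 1) ∧
      (n : ℝ) ^ (((d : ℝ) - 1 / d) * n) = ((n : ℝ) ^ d / u) ^ n := by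
  have hn' : (1 : ℝ) ≤ n := by exact_mod_cast hn
  have hn0 : (0 : ℝ) < n := by linarith
  have h1 : 1 ≤ (n : ℝ) ^ (1 / (d : ℝ)) := Real.one_le_rpow hn' (by positivity)
  obtain ⟨t, ht1, ht2⟩ := exists_nat_pow_near h1 (one_lt_two)
  refine ⟨t, (n : ℝ) ^ (1 / (d : ℝ)), by positivity, ?_, ht1, ht2.le, ?_⟩
  · rw [one_div]
    exact Real.rpow_inv_natCast_pow hn0.le (by omega)
  · rw [Real.rpow_mul hn0.le, Real.rpow_natCast, Real.rpow_sub hn0, Real.rpow_natCast]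

theorem exists_patternFreeCount_le_of_one_le {d : ℕ} (hd : 1 ≤ d) :
    ∃ c : ℝ, 0 < c ∧ ∀ α β : Fin (d + 1) → ℕ, IsInterleaved α β → ∀ (n t : ℕ) (u : ℝ), 1 ≤ n →
      0 < u → u ^ d = n → (2 : ℝ) ^ t ≤ u → u ≤ 2 ^ (t + 1) →
      (patternFreeCount (d + 1) n {edgeOf α, edgeOf β} : ℝ) ≤ (c * ((n : ℝ) ^ d / u)) ^ n := by
  rcases hd.eq_or_lt with rfl | hd
  · refine ⟨4, by norm_num, fun α β hI n t u hn hu hun _ _ => ?_⟩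
    rw [← hun, pow_one, pow_one, div_self hu.ne', mul_one]
    exact_mod_cast patternFreeCount_two_le hI n
  · exact exists_patternFreeCount_le hd

/-- **Theorem 1.6.** For a fixed `r ≥ 2` and an `r`-partite `r`-pattern `P`,
`N_P(n) = e^{O_r(n)} · n^{(r-1-1/(r-1))n}`. -/
theorem count_partite_pattern_free (r : ℕ) (hr : 2 ≤ r)
    (P : Finset (Finset ℕ)) (hP : IsPattern r P) (hpart : IsPartite r 2 P) :
    ∃ C : ℝ, 0 < C ∧ ∀ n : ℕ, 1 ≤ n →
      Real.exp (-(C * n)) * (n : ℝ) ^ ((((r : ℝ) - 1) - 1 / ((r : ℝ) - 1)) * (n : ℝ))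
          ≤ (patternFreeCount r n P : ℝ) ∧
      (patternFreeCount r n P : ℝ)
          ≤ Real.exp (C * n) * (n : ℝ) ^ ((((r : ℝ) - 1) - 1 / ((r : ℝ) - 1)) * (n : ℝ)) := by
  obtain ⟨d, rfl⟩ : ∃ d, r = d + 1 := ⟨r - 1, by omega⟩
  have hd : 1 ≤ d := by omega
  obtain ⟨α, β, hI, rfl⟩ := exists_isInterleaved hP hpart
  obtain ⟨c, hc, hupper⟩ := exists_patternFreeCount_le_of_one_le hd
  have hb : (0 : ℝ) < (2 * (d + 1) * Real.exp 1) ^ (d + 1) := by positivity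
  set b : ℝ := (2 * (d + 1) * Real.exp 1) ^ (d + 1) with hb_def
  set C : ℝ := max (max (Real.log c) (Real.log b)) 1 with hC
  have hcC : c ≤ Real.exp C := by
    rw [← Real.log_le_iff_le_exp hc]
    exact (le_max_left _ _).trans (le_max_left _ _)
  have hbC : b ≤ Real.exp C := by
    rw [← Real.log_le_iff_le_exp hb]
    exact (le_max_right _ _).trans (le_max_left _ _)
  refine ⟨C, zero_lt_one.trans_le (le_max_right _ _), fun n hn => ?_⟩
  obtain ⟨t, u, hu, hun, htu, hut, hX⟩ := exists_root_scale hd hn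
  have hX0 : (0 : ℝ) ≤ (n : ℝ) ^ d / u := by positivity
  have hexp : Real.exp (C * n) = Real.exp C ^ n := by rw [← Real.exp_nat_mul, mul_comm]
  rw [Nat.cast_add_one, add_sub_cancel_right, hX]
  constructor
  · rw [Real.exp_neg, inv_mul_le_iff₀ (Real.exp_pos _), hexp]
    refine (pow_le_patternFreeCount hI hn hu hun htu hut).trans ?_
    gcongr
  · rw [hexp, ← mul_pow]
    exact (hupper α β hI n t u hn hu hun htu hut).trans (by gcongr)
end

section
/- Fix an integer r ≥ 2 and an r-partite r-pattern P. Then there exists a constant C = C(r) > 0 such that for all positive integers n and all integers m with 2 ≤ m and m^r ≤ n: e^{−Cn}·(m−1)^{(r/(r−1))n}·n^{(r−1−1/(r−1))n} ≤ N_{P,m}(n) ≤ e^{Cn}·(m−1)^{(r/(r−1))n}·n^{(r−1−1/(r−1))n}. -/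
/-- `N_{P,m}(n)`: the number of ordered `r`-matchings `M` on `{1,…,r*n}` with
`L_P(M) < m`, i.e. containing no `P`-clique of size `m`. -/
noncomputable def cliqueBoundedCount (r n m : ℕ) (P : Finset (Finset ℕ)) : ℕ :=
  Nat.card {M : Finset (Finset ℕ) // IsOrderedMatching r n M ∧ cliqueSize P M < m}

/-- Strict domination of pairs in both coordinates. -/
def PairLT (p q : ℕ × ℕ) : Prop := p.1 < q.1 ∧ p.2 < q.2

/-- Two arcs of an ordered graph cross (for `σ = true`) or are nested (for `σ = false`). -/
def ArcRel (σ : Bool) (p q : ℕ × ℕ) : Prop :=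
  p.1 < q.2 ∧ q.1 < p.2 ∧
    ((p.2 < q.2 ∧ if σ then p.1 < q.1 else q.1 < p.1) ∨
      (q.2 < p.2 ∧ if σ then q.1 < p.1 else p.1 < q.1))

theorem arcRel_true {p q : ℕ × ℕ} :
    ArcRel true p q ↔ p.1 < q.2 ∧ q.1 < p.2 ∧ (PairLT p q ∨ PairLT q p) := by
  simp only [ArcRel, PairLT, if_true]
  tauto

theorem card_le_of_pairLT_antichain (A : Finset (ℕ × ℕ))
    (hA : ∀ p ∈ A, ∀ q ∈ A, ¬ PairLT p q) :
    A.card ≤ (A.image Prod.fst).card + (A.image Prod.snd).card := by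
  classical
  rw [← Finset.card_filter_add_card_filter_not (s := A)
    (fun p => ∃ q ∈ A, q.2 = p.2 ∧ q.1 < p.1)]
  gcongr
  · refine Finset.card_le_card_of_injOn Prod.fst ?_ ?_
    · intro p hp
      exact Finset.mem_image_of_mem _ (Finset.mem_filter.1 hp).1
    · rintro p hp p' hp' h
      obtain ⟨hp, q, hq, h1, h2⟩ := Finset.mem_filter.1 hp
      obtain ⟨hp', q', hq', h1', h2'⟩ := Finset.mem_filter.1 hp'
      have a1 := hA q hq p' hp'
      have a2 := hA q' hq' p hp
      simp only [PairLT] at a1 a2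
      exact Prod.ext h (by omega)
  · refine Finset.card_le_card_of_injOn Prod.snd ?_ ?_
    · intro p hp
      exact Finset.mem_image_of_mem _ (Finset.mem_filter.1 hp).1
    · rintro p hp p' hp' h
      obtain ⟨hp, h1⟩ := Finset.mem_filter.1 hp
      obtain ⟨hp', h1'⟩ := Finset.mem_filter.1 hp'
      push Not at h1 h1'
      have a1 := h1 p' hp' h.symm
      have a2 := h1' p hp h
      exact Prod.ext (by omega) h

open Classical in
/-- `pairLayer A i` consists of the pairs in `A` on top of a chain of length `i + 1`. -/
noncomputable def pairLayer (A : Finset (ℕ × ℕ)) : ℕ → Finset (ℕ × ℕ)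
  | 0 => A
  | i + 1 => (pairLayer A i).filter fun p => ∃ q ∈ pairLayer A i, PairLT q p

open Classical in
/-- The pairs in `A` whose longest descending chain has length exactly `i + 1`. -/
noncomputable def pairRank (A : Finset (ℕ × ℕ)) (i : ℕ) : Finset (ℕ × ℕ) :=
  pairLayer A i \ pairLayer A (i + 1)

theorem mem_pairLayer_succ {A : Finset (ℕ × ℕ)} {i : ℕ} {p : ℕ × ℕ} :
    p ∈ pairLayer A (i + 1) ↔ p ∈ pairLayer A i ∧ ∃ q ∈ pairLayer A i, PairLT q p := by
  classical
  exact Finset.mem_filter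

theorem pairLayer_succ_subset (A : Finset (ℕ × ℕ)) (i : ℕ) :
    pairLayer A (i + 1) ⊆ pairLayer A i :=
  fun _ h => (mem_pairLayer_succ.1 h).1

theorem pairLayer_antitone (A : Finset (ℕ × ℕ)) : Antitone (pairLayer A) :=
  antitone_nat_of_succ_le (pairLayer_succ_subset A)

theorem pairLayer_subset (A : Finset (ℕ × ℕ)) (i : ℕ) : pairLayer A i ⊆ A :=
  pairLayer_antitone A (Nat.zero_le i)

theorem pairRank_subset (A : Finset (ℕ × ℕ)) (i : ℕ) : pairRank A i ⊆ A :=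
  Finset.sdiff_subset.trans (pairLayer_subset A i)

theorem pairRank_antichain (A : Finset (ℕ × ℕ)) (i : ℕ) :
    ∀ p ∈ pairRank A i, ∀ q ∈ pairRank A i, ¬ PairLT p q := by
  intro p hp q hq h
  simp only [pairRank, Finset.mem_sdiff] at hp hq
  refine hq.2 ?_
  rw [mem_pairLayer_succ]
  exact ⟨hq.1, p, hp.1, h⟩

theorem PairLT.trans {p q s : ℕ × ℕ} (h : PairLT p q) (h' : PairLT q s) : PairLT p s :=
  ⟨h.1.trans h'.1, h.2.trans h'.2⟩

theorem exists_pairRank_lt {A : Finset (ℕ × ℕ)} {i : ℕ} {p : ℕ × ℕ}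
    (hp : p ∈ pairLayer A (i + 1)) : ∃ q ∈ pairRank A i, PairLT q p := by
  classical
  have hne : ((pairLayer A i).filter fun q => PairLT q p).Nonempty := by
    rw [mem_pairLayer_succ] at hp
    obtain ⟨_, q, hq, h⟩ := hp
    exact ⟨q, Finset.mem_filter.2 ⟨hq, h⟩⟩
  obtain ⟨q, hq, hmin⟩ := Finset.exists_min_image _ Prod.snd hne
  rw [Finset.mem_filter] at hq
  refine ⟨q, Finset.mem_sdiff.2 ⟨hq.1, fun hq' => ?_⟩, hq.2⟩
  rw [mem_pairLayer_succ] at hq'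
  obtain ⟨_, q', hq', h⟩ := hq'
  exact absurd (hmin q' (Finset.mem_filter.2 ⟨hq', h.trans hq.2⟩)) (not_le.2 h.2)

theorem exists_chain_of_mem_pairLayer {A : Finset (ℕ × ℕ)} :
    ∀ (i : ℕ) {p : ℕ × ℕ}, p ∈ pairLayer A i → ∃ C ⊆ A, C.card = i + 1 ∧
      (C : Set (ℕ × ℕ)).Pairwise (fun a b => PairLT a b ∨ PairLT b a) ∧
      ∀ a ∈ C, a = p ∨ PairLT a p := by
  classical
  intro i
  induction i with
  | zero =>
    intro p hp
    exact ⟨{p}, Finset.singleton_subset_iff.2 hp, by simp, by simp, by simp⟩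
  | succ i ih =>
    intro p hp
    have hpA := pairLayer_subset _ _ hp
    rw [mem_pairLayer_succ] at hp
    obtain ⟨_, q, hq, hqp⟩ := hp
    obtain ⟨C, hCA, hcard, hC, htop⟩ := ih hq
    have hlt : ∀ a ∈ C, PairLT a p := fun a ha => by
      rcases htop a ha with rfl | h
      exacts [hqp, h.trans hqp]
    have hpC : p ∉ C := fun h => absurd (hlt p h).1 (lt_irrefl _)
    refine ⟨insert p C, Finset.insert_subset hpA hCA, by rw [Finset.card_insert_of_notMem hpC, hcard],
      ?_, ?_⟩
    · rw [Finset.coe_insert]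
      exact hC.insert fun b hb _ => ⟨Or.inr (hlt b hb), Or.inl (hlt b hb)⟩
    · intro a ha
      rcases Finset.mem_insert.1 ha with rfl | ha
      exacts [Or.inl rfl, Or.inr (hlt a ha)]

/-- A chain of pairs (rank, second coordinate) of elements of `A` lifts to a chain in `A`. -/
theorem exists_chain_of_rank_chain (A : Finset (ℕ × ℕ)) (T : Finset (ℕ × ℕ)) :
    (∀ t ∈ T, ∃ u, (u, t.2) ∈ pairRank A t.1) →
    (T : Set (ℕ × ℕ)).Pairwise (fun a b => PairLT a b ∨ PairLT b a) →
    ∀ e : ℕ × ℕ, (∀ t ∈ T, t.2 < e.2 ∧ ∃ f ∈ pairRank A t.1, PairLT f e) →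
    ∃ C ⊆ A, C.card = T.card ∧
      (C : Set (ℕ × ℕ)).Pairwise (fun a b => PairLT a b ∨ PairLT b a) ∧
      ∀ f ∈ C, PairLT f e ∧ ∃ t ∈ T, t.2 ≤ f.2 := by
  classical
  refine Finset.induction_on_max_value Prod.fst T ?_ ?_
  · intro _ _ e _
    exact ⟨∅, by simp, by simp, by simp, by simp⟩
  · intro a T haT hmax ih hreal hchain e he
    obtain ⟨u, hu⟩ := hreal a (Finset.mem_insert_self _ _)
    obtain ⟨hae, f, hf, hfe⟩ := he a (Finset.mem_insert_self _ _)
    have hlt : ∀ t ∈ T, PairLT t a := by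
      intro t ht
      have hne : t ≠ a := fun h => haT (h ▸ ht)
      rcases hchain (Finset.mem_coe.2 (Finset.mem_insert_of_mem ht))
        (Finset.mem_coe.2 (Finset.mem_insert_self _ _)) hne with h | h
      · exact h
      · exact absurd (hmax t ht) (not_le.2 h.1)
    obtain ⟨g, hg, hge, hag⟩ : ∃ g ∈ pairRank A a.1, PairLT g e ∧ a.2 ≤ g.2 := by
      by_cases h : a.2 ≤ f.2
      · exact ⟨f, hf, hfe, h⟩
      · refine ⟨(u, a.2), hu, ⟨?_, hae⟩, le_rfl⟩
        have := pairRank_antichain A a.1 f hf _ hu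
        simp only [PairLT] at this hfe ⊢
        omega
    obtain ⟨C, hCA, hcard, hC, hCe⟩ := ih (fun t ht => hreal t (Finset.mem_insert_of_mem ht))
      (hchain.mono (by simp)) g (fun t ht => ⟨(hlt t ht).2.trans_le hag, by
        refine exists_pairRank_lt (pairLayer_antitone A (Nat.succ_le_of_lt (hlt t ht).1) ?_)
        exact (Finset.mem_sdiff.1 hg).1⟩)
    have hgC : g ∉ C := fun h => absurd (hCe g h).1.1 (lt_irrefl _)
    refine ⟨insert g C, Finset.insert_subset (pairRank_subset _ _ hg) hCA, ?_, ?_, ?_⟩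
    · rw [Finset.card_insert_of_notMem hgC, hcard, Finset.card_insert_of_notMem haT]
    · rw [Finset.coe_insert]
      exact hC.insert fun b hb _ => ⟨Or.inr (hCe b hb).1, Or.inl (hCe b hb).1⟩
    · intro b hb
      rcases Finset.mem_insert.1 hb with rfl | hb
      · exact ⟨hge, a, Finset.mem_insert_self _ _, hag⟩
      · obtain ⟨h, t, ht, htb⟩ := hCe b hb
        exact ⟨h.trans hge, t, Finset.mem_insert_of_mem ht, htb⟩

theorem card_eq_sum_pairRank_add (A : Finset (ℕ × ℕ)) (k : ℕ) :
    A.card = ∑ i ∈ Finset.range k, (pairRank A i).card + (pairLayer A k).card := by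
  induction k with
  | zero => simp [pairLayer]
  | succ k ih =>
    have h : (pairRank A k).card = (pairLayer A k).card - (pairLayer A (k + 1)).card := by
      rw [pairRank, Finset.card_sdiff_of_subset (pairLayer_succ_subset A k)]
    have := Finset.card_le_card (pairLayer_succ_subset A k)
    rw [Finset.sum_range_succ]
    omega

theorem card_le_of_window {G : Finset (ℕ × ℕ)} {lo ℓ : ℕ}
    (hG : ∀ p ∈ G, lo ≤ p.1 ∧ p.1 < p.2 ∧ p.2 < lo + ℓ) : G.card ≤ ℓ * ℓ := by
  calc G.card ≤ (Finset.Ico lo (lo + ℓ) ×ˢ Finset.Ico lo (lo + ℓ)).card := by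
        refine Finset.card_le_card fun p hp => ?_
        have := hG p hp
        simp only [Finset.mem_product, Finset.mem_Ico]
        omega
    _ = ℓ * ℓ := by simp

/-- The arcs `(lo + M + i, v)` recording, for each rank `i < M`, the right endpoints `v` of the
arcs of `A` of rank `i`. -/
noncomputable def rankArcs (A : Finset (ℕ × ℕ)) (M lo : ℕ) : Finset (ℕ × ℕ) :=
  (Finset.range M).biUnion fun i => ((pairRank A i).image Prod.snd).image fun v => (lo + M + i, v)

theorem mem_rankArcs {A : Finset (ℕ × ℕ)} {M lo : ℕ} {p : ℕ × ℕ} :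
    p ∈ rankArcs A M lo ↔
      lo + M ≤ p.1 ∧ p.1 < lo + 2 * M ∧ ∃ u, (u, p.2) ∈ pairRank A (p.1 - (lo + M)) := by
  simp only [rankArcs, Finset.mem_biUnion, Finset.mem_range, Finset.mem_image, Prod.exists,
    exists_eq_right]
  constructor
  · rintro ⟨i, hi, v, ⟨u, hu⟩, rfl⟩
    exact ⟨by simp, by simp; omega, u, by simpa using hu⟩
  · rintro ⟨h1, h2, u, hu⟩
    exact ⟨p.1 - (lo + M), by omega, p.2, ⟨u, hu⟩, Prod.ext (by simp; omega) rfl⟩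

theorem card_rankArcs (A : Finset (ℕ × ℕ)) (M lo : ℕ) :
    (rankArcs A M lo).card = ∑ i ∈ Finset.range M, ((pairRank A i).image Prod.snd).card := by
  rw [rankArcs, Finset.card_biUnion]
  · refine Finset.sum_congr rfl fun i _ => ?_
    exact Finset.card_image_of_injective _ fun a b h => (Prod.ext_iff.1 h).2
  · intro i _ j _ hij
    rw [Function.onFun, Finset.disjoint_left]
    intro p hp hp'
    simp only [Finset.mem_image] at hp hp'
    obtain ⟨_, _, rfl⟩ := hp
    obtain ⟨_, _, h⟩ := hp'
    have := (Prod.ext_iff.1 h).1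
    simp at this
    omega

theorem card_le_of_crossing_bounded (M : ℕ) (hM : 1 ≤ M) (ℓ : ℕ) :
    ∀ (lo : ℕ) (G : Finset (ℕ × ℕ)), (∀ p ∈ G, lo ≤ p.1 ∧ p.1 < p.2 ∧ p.2 < lo + ℓ) →
      (∀ S ⊆ G, (S : Set (ℕ × ℕ)).Pairwise (ArcRel true) → S.card ≤ M) →
      G.card ≤ 6 * M * ℓ := by
  classical
  induction ℓ using Nat.strong_induction_on with
  | _ ℓ ih =>
  intro lo G hG hfree
  rcases le_or_gt ℓ (2 * M) with hℓ | hℓ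
  · exact (card_le_of_window hG).trans (Nat.mul_le_mul_right _ (by omega))
  set I := G.filter fun p => p.2 < lo + 2 * M with hI
  set A := G.filter fun p => p.1 < lo + 2 * M ∧ lo + 2 * M ≤ p.2 with hA
  set R := G.filter fun p => lo + 2 * M ≤ p.1 with hR
  have hsplit : G.card ≤ I.card + A.card + R.card := by
    refine (Finset.card_le_card ?_).trans
      ((Finset.card_union_le (I ∪ A) R).trans (by gcongr; exact Finset.card_union_le I A))
    intro p hp
    simp only [hI, hA, hR, Finset.mem_union, Finset.mem_filter, hp, true_and]
    omega
  have hIcard : I.card ≤ 2 * M * (2 * M) := by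
    refine card_le_of_window (lo := lo) fun p hp => ?_
    rw [hI, Finset.mem_filter] at hp
    exact ⟨(hG p hp.1).1, (hG p hp.1).2.1, hp.2⟩
  have hAmem : ∀ p ∈ A, p ∈ G ∧ p.1 < lo + 2 * M ∧ lo + 2 * M ≤ p.2 := fun p hp =>
    Finset.mem_filter.1 hp
  have hRmem : ∀ p ∈ R, p ∈ G ∧ lo + 2 * M ≤ p.1 := fun p hp => Finset.mem_filter.1 hp
  have hcross : ∀ C ⊆ A, (C : Set (ℕ × ℕ)).Pairwise (fun a b => PairLT a b ∨ PairLT b a) →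
      (C : Set (ℕ × ℕ)).Pairwise (ArcRel true) := by
    intro C hC h a ha b hb hab
    have ha' := hAmem a (hC ha)
    have hb' := hAmem b (hC hb)
    exact arcRel_true.2 ⟨by omega, by omega, h ha hb hab⟩
  have hlayer : pairLayer A M = ∅ := by
    rw [Finset.eq_empty_iff_forall_notMem]
    intro p hp
    obtain ⟨C, hC, hcard, hchain, -⟩ := exists_chain_of_mem_pairLayer M hp
    have := hfree C (hC.trans (Finset.filter_subset _ _)) (hcross C hC hchain)
    omega
  have hAcard : A.card ≤ 2 * M * M + (rankArcs A M lo).card := by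
    rw [card_rankArcs, card_eq_sum_pairRank_add A M, hlayer, Finset.card_empty, add_zero]
    calc ∑ i ∈ Finset.range M, (pairRank A i).card
        ≤ ∑ i ∈ Finset.range M, (2 * M + ((pairRank A i).image Prod.snd).card) := by
          refine Finset.sum_le_sum fun i _ => ?_
          refine (card_le_of_pairLT_antichain _ (pairRank_antichain A i)).trans ?_
          gcongr
          calc ((pairRank A i).image Prod.fst).card
              ≤ (Finset.Ico lo (lo + 2 * M)).card := by
                refine Finset.card_le_card fun x hx => ?_
                obtain ⟨p, hp, rfl⟩ := Finset.mem_image.1 hx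
                have := hAmem p (pairRank_subset A i hp)
                exact Finset.mem_Ico.2 ⟨(hG p this.1).1, this.2.1⟩
            _ = 2 * M := by simp
      _ = _ := by
          rw [Finset.sum_add_distrib, Finset.sum_const, Finset.card_range, smul_eq_mul]
          ring
  have hdisj : Disjoint R (rankArcs A M lo) := by
    rw [Finset.disjoint_left]
    intro p hp hp'
    have := (hRmem p hp).2
    have := (mem_rankArcs.1 hp').2.1
    omega
  have hnew : ∀ p ∈ rankArcs A M lo, ∃ u, (u, p.2) ∈ A := by
    intro p hp
    obtain ⟨-, -, u, hu⟩ := mem_rankArcs.1 hp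
    exact ⟨u, pairRank_subset _ _ hu⟩
  have hrec : (R ∪ rankArcs A M lo).card ≤ 6 * M * (ℓ - M) := by
    refine ih (ℓ - M) (by omega) (lo + M) _ ?_ ?_
    · intro p hp
      rcases Finset.mem_union.1 hp with hp | hp
      · obtain ⟨h1, h2⟩ := hRmem p hp
        have := hG p h1
        omega
      · obtain ⟨u, hu⟩ := hnew p hp
        obtain ⟨h1, h2, -⟩ := mem_rankArcs.1 hp
        have h3 := hAmem _ hu
        have h4 := hG _ h3.1
        simp only at h3 h4
        omega
    · intro S hS hSc
      set T' := S.filter fun p => p.1 < lo + 2 * M with hT'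
      set O := S.filter fun p => ¬ p.1 < lo + 2 * M with hO
      have hST : S.card = T'.card + O.card := (Finset.card_filter_add_card_filter_not _).symm
      have hOR : O ⊆ R := by
        intro p hp
        rw [hO, Finset.mem_filter] at hp
        rcases Finset.mem_union.1 (hS hp.1) with h | h
        · exact h
        · exact absurd (mem_rankArcs.1 h).2.1 hp.2
      have hTN : ∀ p ∈ T', p ∈ rankArcs A M lo := by
        intro p hp
        rw [hT', Finset.mem_filter] at hp
        rcases Finset.mem_union.1 (hS hp.1) with h | h
        · exact absurd hp.2 (not_lt.2 (hRmem p h).2)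
        · exact h
      have hTO : ∀ t ∈ T', ∀ o ∈ O, o.1 < t.2 ∧ t.2 < o.2 := by
        intro t ht o ho
        rw [hT', Finset.mem_filter] at ht
        rw [hO, Finset.mem_filter] at ho
        have h := arcRel_true.1 (hSc ht.1 ho.1 (fun h => ho.2 (h ▸ ht.2)))
        simp only [PairLT] at h
        omega
      rcases T'.eq_empty_or_nonempty with hemp | hne
      · rw [hST, hemp, Finset.card_empty, zero_add]
        exact hfree O (hOR.trans (Finset.filter_subset _ _))
          (hSc.mono (Finset.coe_subset.2 (Finset.filter_subset _ _)))
      obtain ⟨tm, htm, hmax⟩ := Finset.exists_max_image T' Prod.snd hne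
      set sh : ℕ × ℕ → ℕ × ℕ := fun p => (p.1 - (lo + M), p.2) with hsh
      have hinj : Set.InjOn sh T' := by
        intro p hp q hq hpq
        have h1 := (mem_rankArcs.1 (hTN p hp)).1
        have h2 := (mem_rankArcs.1 (hTN q hq)).1
        simp only [hsh, Prod.mk.injEq] at hpq
        exact Prod.ext (by omega) hpq.2
      obtain ⟨C, hCA, hCcard, hCchain, hCe⟩ := exists_chain_of_rank_chain A (T'.image sh)
        (by
          intro t ht
          obtain ⟨p, hp, rfl⟩ := Finset.mem_image.1 ht
          exact (mem_rankArcs.1 (hTN p hp)).2.2)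
        (by
          intro a ha b hb hab
          rw [Finset.mem_coe] at ha hb
          obtain ⟨p, hp, rfl⟩ := Finset.mem_image.1 ha
          obtain ⟨q, hq, rfl⟩ := Finset.mem_image.1 hb
          have h1 := (mem_rankArcs.1 (hTN p hp)).1
          have h2 := (mem_rankArcs.1 (hTN q hq)).1
          have h := (arcRel_true.1 (hSc (Finset.mem_filter.1 hp).1 (Finset.mem_filter.1 hq).1
            (fun h => hab (h ▸ rfl)))).2.2
          simp only [PairLT, hsh] at h ⊢
          omega)
        (lo + 2 * M, tm.2 + 1)
        (by
          intro t ht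
          obtain ⟨p, hp, rfl⟩ := Finset.mem_image.1 ht
          refine ⟨Nat.lt_succ_of_le (hmax p hp), ?_⟩
          obtain ⟨-, -, u, hu⟩ := mem_rankArcs.1 (hTN p hp)
          exact ⟨_, hu, (hAmem _ (pairRank_subset _ _ hu)).2.1, Nat.lt_succ_of_le (hmax p hp)⟩)
      rw [Finset.card_image_of_injOn hinj] at hCcard
      have hCO : ∀ c ∈ C, ∀ o ∈ O, ArcRel true c o ∧ ArcRel true o c := by
        intro c hc o ho
        obtain ⟨h1, t, ht, h2⟩ := hCe c hc
        obtain ⟨p, hp, rfl⟩ := Finset.mem_image.1 ht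
        have h3 := hTO p hp o ho
        have h4 := hTO tm htm o ho
        have h5 := hRmem o (hOR ho)
        have h6 := hG o h5.1
        simp only [PairLT, hsh] at h1 h2
        rw [arcRel_true, arcRel_true]
        simp only [PairLT]
        omega
      have hdCO : Disjoint C O := by
        rw [Finset.disjoint_left]
        intro c hc hc'
        have h1 := (hAmem c (hCA hc)).2.1
        have h2 := (hRmem c (hOR hc')).2
        omega
      have := hfree (C ∪ O) (Finset.union_subset (hCA.trans (Finset.filter_subset _ _))
        (hOR.trans (Finset.filter_subset _ _))) (by
          rw [Finset.coe_union, Set.pairwise_union]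
          exact ⟨hcross C hCA hCchain, hSc.mono (Finset.coe_subset.2 (Finset.filter_subset _ _)),
            fun c hc o ho _ => hCO c hc o ho⟩)
      rw [Finset.card_union_of_disjoint hdCO] at this
      omega
  rw [Finset.card_union_of_disjoint hdisj] at hrec
  obtain ⟨d, rfl⟩ : ∃ d, ℓ = M + d := ⟨ℓ - M, by omega⟩
  rw [Nat.add_sub_cancel_left] at hrec
  nlinarith

theorem card_le_of_arcRel_bounded (σ : Bool) (M B : ℕ) (hM : 1 ≤ M) (G : Finset (ℕ × ℕ))
    (hG : ∀ p ∈ G, p.1 < p.2 ∧ p.2 < 2 * B)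
    (hfree : ∀ S ⊆ G, (S : Set (ℕ × ℕ)).Pairwise (ArcRel σ) → S.card ≤ M) :
    G.card ≤ 12 * M * B := by
  classical
  cases σ with
  | true =>
    have := card_le_of_crossing_bounded M hM (2 * B) 0 G
      (fun p hp => ⟨Nat.zero_le _, (hG p hp).1, by have := (hG p hp).2; omega⟩) hfree
    nlinarith
  | false =>
    have hmaps : ∀ p ∈ G, p.1 + p.2 ∈ Finset.range (4 * B) := fun p hp => by
      have := hG p hp
      rw [Finset.mem_range]
      omega
    have := Finset.card_le_mul_card_image_of_maps_to hmaps M (by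
      intro c _
      refine hfree _ (Finset.filter_subset _ _) ?_
      intro p hp q hq hpq
      obtain ⟨h1, h2⟩ := Finset.mem_filter.1 hp
      obtain ⟨h3, h4⟩ := Finset.mem_filter.1 hq
      have h5 := hG p h1
      have h6 := hG q h3
      have : p.1 ≠ q.1 := fun h => hpq (Prod.ext h (by omega))
      simp only [ArcRel, Bool.false_eq_true, if_false]
      omega)
    rw [Finset.card_range] at this
    nlinarith

/-- Two tuples alternate position by position, the order in coordinate `j` being prescribed, up to
a global swap, by `s j`. -/
def TupRel {r : ℕ} (s : Fin r → Bool) (e f : Fin r → ℕ) : Prop :=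
  (∀ i j, i < j → e i < f j ∧ f i < e j) ∧
    ((∀ j, if s j then e j < f j else f j < e j) ∨ (∀ j, if s j then f j < e j else e j < f j))

theorem TupRel.symm {r : ℕ} {s : Fin r → Bool} {e f : Fin r → ℕ} (h : TupRel s e f) :
    TupRel s f e :=
  ⟨fun i j hij => (h.1 i j hij).symm, h.2.symm⟩

theorem card_le_pow_of_determined_off {r N : ℕ} (F : Finset (Fin r → ℕ)) (Z : Finset (Fin r))
    (hN : ∀ f ∈ F, ∀ j, f j < N)
    (hZ : ∀ f ∈ F, ∀ g ∈ F, (∀ j ∉ Z, f j = g j) → f = g) :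
    F.card ≤ N ^ (r - Z.card) := by
  classical
  calc F.card ≤ (Fintype.piFinset fun j => if j ∈ Z then {0} else Finset.range N).card := by
        refine Finset.card_le_card_of_injOn (fun f j => if j ∈ Z then 0 else f j) ?_ ?_
        · intro f hf
          rw [Finset.mem_coe, Fintype.mem_piFinset]
          intro j
          by_cases hj : j ∈ Z <;> simp [hj, hN f hf j]
        · intro f hf g hg hfg
          refine hZ f hf g hg fun j hj => ?_
          simpa [hj] using congrFun hfg j
    _ = N ^ (r - Z.card) := by
        rw [Fintype.card_piFinset]
        have : ∀ j : Fin r, (if j ∈ Z then ({0} : Finset ℕ) else Finset.range N).card =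
            if j ∈ Zᶜ then N else 1 := fun j => by
          by_cases hj : j ∈ Z <;> simp [hj]
        simp_rw [this]
        rw [Finset.prod_ite_mem, Finset.univ_inter, Finset.prod_const, Finset.card_compl,
          Fintype.card_fin]

theorem card_le_pow_of_coincidences {r N : ℕ} (F : Finset (Fin r → ℕ)) (Z : Finset (Fin r))
    (hN : ∀ f ∈ F, ∀ j, f j < N)
    (hZ : ∀ f ∈ F, ∀ j ∈ Z, ∃ i : Fin r, i.val + 1 = j.val ∧ f i = f j) :
    F.card ≤ N ^ (r - Z.card) := by
  refine card_le_pow_of_determined_off F Z hN fun f hf g hg hfg => ?_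
  funext j
  obtain ⟨j, hj⟩ := j
  induction j with
  | zero =>
    refine hfg _ fun h => ?_
    obtain ⟨i, hi, -⟩ := hZ f hf _ h
    simp at hi
  | succ j ih =>
    by_cases h : (⟨j + 1, hj⟩ : Fin r) ∈ Z
    · obtain ⟨i, hi, hfi⟩ := hZ f hf _ h
      obtain ⟨i', hi', hgi⟩ := hZ g hg _ h
      have e1 : i = ⟨j, by omega⟩ := Fin.ext (by simpa using hi)
      have e2 : i' = ⟨j, by omega⟩ := Fin.ext (by simpa using hi')
      rw [← hfi, ← hgi, e1, e2, ih]
    · exact hfg _ h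

/-- All coordinates of `q` increase strictly, except possibly from `a` to its successor `b`. -/
def AlmostStrict {r : ℕ} (q : Fin r → ℕ) (a b : Fin r) : Prop :=
  a.val + 1 = b.val ∧ ∀ i j, i < j → q i < q j ∨ (i = a ∧ j = b)

theorem exists_coincidence {r : ℕ} {q : Fin r → ℕ} (hq : Monotone q) {i j : Fin r} (hij : i < j)
    (h : q i = q j) : (∃ k : Fin r, k.val + 1 = j.val ∧ q k = q j) ∧
      ∃ k : Fin r, i.val + 1 = k.val ∧ q i = q k := by
  have hj := j.2
  rw [Fin.lt_def] at hij
  refine ⟨⟨⟨j.val - 1, by omega⟩, by simp; omega, ?_⟩, ⟨⟨i.val + 1, by omega⟩, rfl, ?_⟩⟩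
  · have h1 := hq (show i ≤ ⟨j.val - 1, by omega⟩ by rw [Fin.le_def]; simp; omega)
    have h2 := hq (show ⟨j.val - 1, by omega⟩ ≤ j by rw [Fin.le_def]; simp)
    omega
  · have h1 := hq (show i ≤ ⟨i.val + 1, by omega⟩ by rw [Fin.le_def]; simp)
    have h2 := hq (show ⟨i.val + 1, by omega⟩ ≤ j by rw [Fin.le_def]; simp; omega)
    omega

theorem exists_two_coincidences {r : ℕ} (hr : 2 ≤ r) {q : Fin r → ℕ} (hq : Monotone q)
    (hbad : ¬ ∃ a b, AlmostStrict q a b) :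
    ∃ b e : Fin r, b ≠ e ∧ (∃ i : Fin r, i.val + 1 = b.val ∧ q i = q b) ∧
      ∃ i : Fin r, i.val + 1 = e.val ∧ q i = q e := by
  by_contra! hcon
  by_cases hex : ∃ b a : Fin r, a.val + 1 = b.val ∧ q a = q b
  · obtain ⟨b, a, hab, hqab⟩ := hex
    refine hbad ⟨a, b, hab, fun i j hij => ?_⟩
    rcases (hq hij.le).lt_or_eq with h | h
    · exact Or.inl h
    · obtain ⟨⟨k, hk, hqk⟩, ⟨l, hl, hql⟩⟩ := exists_coincidence hq hij h
      have hbj : b = j := by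
        by_contra hne
        exact hcon b j hne ⟨a, hab, hqab⟩ k hk hqk
      have hbl : b = l := by
        by_contra hne
        exact hcon b l hne ⟨a, hab, hqab⟩ i hl hql
      refine Or.inr ⟨Fin.ext ?_, hbj.symm⟩
      rw [hbl] at hab
      omega
  · push Not at hex
    refine hbad ⟨⟨0, by omega⟩, ⟨1, by omega⟩, rfl, fun i j hij => Or.inl ?_⟩
    refine lt_of_le_of_ne (hq hij.le) fun h => ?_
    obtain ⟨⟨k, hk, hqk⟩, -⟩ := exists_coincidence hq hij h
    exact hex j k hk hqk

theorem card_le_of_two_coincidences {r N : ℕ} (F : Finset (Fin r → ℕ))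
    (hN : ∀ f ∈ F, ∀ j, f j < N)
    (hF : ∀ q ∈ F, ∃ b e : Fin r, b ≠ e ∧ (∃ i : Fin r, i.val + 1 = b.val ∧ q i = q b) ∧
      ∃ i : Fin r, i.val + 1 = e.val ∧ q i = q e) :
    F.card ≤ r ^ 2 * N ^ (r - 2) := by
  classical
  set F' : Fin r × Fin r → Finset (Fin r → ℕ) := fun p => F.filter fun q => p.1 ≠ p.2 ∧
    (∃ i : Fin r, i.val + 1 = p.1.val ∧ q i = q p.1) ∧
      ∃ i : Fin r, i.val + 1 = p.2.val ∧ q i = q p.2 with hF'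
  calc F.card ≤ (Finset.univ.biUnion F').card := by
        refine Finset.card_le_card fun q hq => ?_
        obtain ⟨b, e, h⟩ := hF q hq
        exact Finset.mem_biUnion.2 ⟨(b, e), Finset.mem_univ _, Finset.mem_filter.2 ⟨hq, h⟩⟩
    _ ≤ (Finset.univ : Finset (Fin r × Fin r)).card * N ^ (r - 2) := by
        refine Finset.card_biUnion_le_card_mul _ _ _ fun p _ => ?_
        by_cases hp : p.1 = p.2
        · simp [hF', hp]
        · rw [← Finset.card_pair hp]
          refine card_le_pow_of_coincidences _ _
            (fun f hf => hN f (Finset.mem_filter.1 hf).1) fun f hf j hj => ?_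
          obtain ⟨-, -, h1, h2⟩ := Finset.mem_filter.1 hf
          rcases Finset.mem_insert.1 hj with rfl | hj
          · exact h1
          · rw [Finset.mem_singleton.1 hj]
            exact h2
    _ = r ^ 2 * N ^ (r - 2) := by simp [sq]

theorem card_le_of_not_injective {r N : ℕ} (F : Finset (Fin r → ℕ))
    (hN : ∀ f ∈ F, ∀ j, f j < N) (hmono : ∀ f ∈ F, Monotone f)
    (hF : ∀ f ∈ F, ¬ StrictMono f) :
    F.card ≤ r * N ^ (r - 1) := by
  classical
  set F' : Fin r → Finset (Fin r → ℕ) := fun p => F.filter fun q =>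
    ∃ i : Fin r, i.val + 1 = p.val ∧ q i = q p with hF'
  calc F.card ≤ (Finset.univ.biUnion F').card := by
        refine Finset.card_le_card fun q hq => ?_
        obtain ⟨j, h⟩ : ∃ j : Fin r, ∃ i : Fin r, i.val + 1 = j.val ∧ q i = q j := by
          by_contra! hcon
          refine hF q hq fun i j hij => lt_of_le_of_ne (hmono q hq hij.le) fun h => ?_
          obtain ⟨⟨k, hk, hqk⟩, -⟩ := exists_coincidence (hmono q hq) hij h
          exact hcon j k hk hqk
        exact Finset.mem_biUnion.2 ⟨j, Finset.mem_univ _, Finset.mem_filter.2 ⟨hq, h⟩⟩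
    _ ≤ (Finset.univ : Finset (Fin r)).card * N ^ (r - 1) := by
        refine Finset.card_biUnion_le_card_mul _ _ _ fun p _ => ?_
        rw [← Finset.card_singleton p]
        refine card_le_pow_of_coincidences _ _
            (fun f hf => hN f (Finset.mem_filter.1 hf).1) fun f hf j hj => ?_
        rw [Finset.mem_singleton.1 hj]
        exact (Finset.mem_filter.1 hf).2
    _ = r * N ^ (r - 1) := by simp

theorem card_fiber_div_two_le {r : ℕ} (F : Finset (Fin r → ℕ)) (p : Fin r → ℕ)
    (hF : ∀ q ∈ F, (fun j => q j / 2) = p) : F.card ≤ 2 ^ r := by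
  classical
  calc F.card ≤ (Fintype.piFinset fun j => ({2 * p j, 2 * p j + 1} : Finset ℕ)).card := by
        refine Finset.card_le_card fun q hq => ?_
        rw [Fintype.mem_piFinset]
        intro j
        have := congrFun (hF q hq) j
        simp only [Finset.mem_insert, Finset.mem_singleton]
        omega
    _ = 2 ^ r := by simp [Fintype.card_piFinset]

/-- The position of a residue `x` modulo `B`, read forwards or backwards. -/
def flipRes (B : ℕ) (c : Bool) (x : ℕ) : ℕ := if c then x else B - 1 - x

theorem flipRes_lt {B x : ℕ} (c : Bool) (hx : x < B) : flipRes B c x < B := by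
  unfold flipRes
  split <;> omega

theorem tupRel_of_almostStrict {r B : ℕ} {s : Fin r → Bool} {q : Fin r → ℕ} {a b : Fin r}
    (hq : AlmostStrict q a b) {v w : Fin r → ℕ} (hv : ∀ j, v j / B = q j) (hw : ∀ j, w j / B = q j)
    (hB : 0 < B)
    (hab : q a < q b ∨ (q a = q b ∧ v a % B < w b % B ∧ w a % B < v b % B))
    (hlt : v b % B < w b % B)
    (ha : if s a = s b then v a % B < w a % B else w a % B < v a % B)
    (hj : ∀ j, j ≠ a → j ≠ b → flipRes B (s j == s b) (v j % B) + B - v b % B =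
      flipRes B (s j == s b) (w j % B) + B - w b % B) : TupRel s v w := by
  have hv' : ∀ j, v j = B * q j + v j % B := fun j => by rw [← hv, Nat.div_add_mod]
  have hw' : ∀ j, w j = B * q j + w j % B := fun j => by rw [← hw, Nat.div_add_mod]
  have hvB : ∀ j, v j % B < B := fun j => Nat.mod_lt _ hB
  have hwB : ∀ j, w j % B < B := fun j => Nat.mod_lt _ hB
  have hqB : ∀ i j, q i < q j → B * q i + B ≤ B * q j := fun i j h => by
    calc B * q i + B = B * (q i + 1) := by ring
      _ ≤ B * q j := Nat.mul_le_mul_left _ h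
  have key : ∀ j, if s j = s b then v j < w j else w j < v j := by
    intro j
    have h1 := hv' j
    have h2 := hw' j
    by_cases hjb : j = b
    · subst hjb
      rw [if_pos rfl]
      omega
    by_cases hja : j = a
    · subst hja
      split_ifs at ha ⊢ <;> omega
    have h3 := hj j hja hjb
    have h4 := hvB j
    have h5 := hwB j
    have h6 := hvB b
    have h7 := hwB b
    unfold flipRes at h3
    by_cases hs : s j = s b
    · simp only [hs, beq_self_eq_true, if_true] at h3 ⊢
      omega
    · have : (s j == s b) = false := by simpa using hs
      simp only [this, hs, Bool.false_eq_true, if_false] at h3 ⊢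
      omega
  refine ⟨fun i j hij => ?_, ?_⟩
  · have h1 := hv' i
    have h2 := hw' i
    have h3 := hv' j
    have h4 := hw' j
    have h5 := hvB i
    have h6 := hwB i
    rcases hq.2 i j hij with h | ⟨rfl, rfl⟩
    · have := hqB i j h
      omega
    · rcases hab with h | h
      · have := hqB i j h
        omega
      · rw [h.1] at h1 h2
        omega
  · cases hb : s b
    · right
      intro j
      have := key j
      cases hsj : s j <;> simpa [hsj, hb] using this
    · left
      intro j
      have := key j
      cases hsj : s j <;> simpa [hsj, hb] using this

/-- Lower part of the cell-fixing data: all differences (with signs) relative to coordinate `b`. -/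
def cellShift {r : ℕ} (s : Fin r → Bool) (B : ℕ) (a b : Fin r) (v : Fin r → ℕ) (j : Fin r) : ℕ :=
  if j = a then 0 else if j = b then B else flipRes B (s j == s b) (v j % B) + B - v b % B

theorem card_le_of_cell_of_cellShift {r B M : ℕ} (hB : 0 < B) (hM : 1 ≤ M) (s : Fin r → Bool)
    {q : Fin r → ℕ} {a b : Fin r} (hq : AlmostStrict q a b) (hqm : q a ≤ q b) (δ : Fin r → ℕ)
    (H : Finset (Fin r → ℕ)) (hmono : ∀ v ∈ H, StrictMono v) (hcell : ∀ v ∈ H, ∀ j, v j / B = q j)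
    (hδ : ∀ v ∈ H, cellShift s B a b v = δ)
    (hfree : ∀ S ⊆ H, (S : Set (Fin r → ℕ)).Pairwise (TupRel s) → S.card ≤ M) :
    H.card ≤ 12 * M * B := by
  classical
  set π : (Fin r → ℕ) → ℕ × ℕ := fun v => (v a % B, v b % B + if q a < q b then B else 0) with hπ
  have hlt : ∀ (v : Fin r → ℕ) j, v j % B < B := fun v j => Nat.mod_lt _ hB
  have hab : a < b := by rw [Fin.lt_def, ← hq.1]; omega
  have hshift : ∀ v ∈ H, ∀ w ∈ H, ∀ j, j ≠ a → j ≠ b →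
      flipRes B (s j == s b) (v j % B) + B - v b % B =
        flipRes B (s j == s b) (w j % B) + B - w b % B := by
    intro v hv w hw j hja hjb
    have := congrFun ((hδ v hv).trans (hδ w hw).symm) j
    simpa [cellShift, hja, hjb] using this
  have hwin : ∀ v ∈ H, (π v).1 < (π v).2 ∧ (π v).2 < 2 * B := by
    intro v hv
    have h1 := hlt v a
    have h2 := hlt v b
    simp only [hπ]
    split_ifs with h
    · omega
    · have h3 : q a = q b := by omega
      have h4 := hmono v hv hab
      rw [← Nat.div_add_mod (v a) B, ← Nat.div_add_mod (v b) B, hcell v hv, hcell v hv, h3] at h4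
      omega
  have hinj : Set.InjOn π H := by
    intro v hv w hw h
    simp only [hπ, Prod.mk.injEq, add_left_inj] at h
    funext j
    rw [← Nat.div_add_mod (v j) B, ← Nat.div_add_mod (w j) B, hcell v hv, hcell w hw]
    congr 1
    by_cases hja : j = a
    · rw [hja, h.1]
    by_cases hjb : j = b
    · rw [hjb, h.2]
    have h1 := hshift v hv w hw j hja hjb
    have h2 := hlt v j
    have h3 := hlt w j
    have h4 := hlt v b
    rw [h.2] at h1 h4
    unfold flipRes at h1
    split_ifs at h1 <;> omega
  rw [← Finset.card_image_of_injOn hinj]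
  refine card_le_of_arcRel_bounded (s a == s b) M B hM _ ?_ ?_
  · intro p hp
    obtain ⟨v, hv, rfl⟩ := Finset.mem_image.1 hp
    exact hwin v hv
  · intro S hS hSc
    set T := H.filter fun v => π v ∈ S with hT
    have hTS : T.image π = S := by
      ext p
      simp only [hT, Finset.mem_image, Finset.mem_filter]
      constructor
      · rintro ⟨v, hv, rfl⟩
        exact hv.2
      · intro hp
        obtain ⟨v, hv, rfl⟩ := Finset.mem_image.1 (hS hp)
        exact ⟨v, ⟨hv, hp⟩, rfl⟩
    have hTH : T ⊆ H := Finset.filter_subset _ _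
    rw [← hTS, Finset.card_image_of_injOn (hinj.mono (Finset.coe_subset.2 hTH))]
    refine hfree T hTH ?_
    have main : ∀ v ∈ H, ∀ w ∈ H, (π v).1 < (π w).2 → (π w).1 < (π v).2 → (π v).2 < (π w).2 →
        (if (s a == s b) then (π v).1 < (π w).1 else (π w).1 < (π v).1) → TupRel s v w := by
      intro v hv w hw h1 h2 h3 h4
      refine tupRel_of_almostStrict hq (hcell v hv) (hcell w hw) hB ?_ ?_ ?_ (hshift v hv w hw)
      · rcases hqm.lt_or_eq with h | h
        · exact Or.inl h
        · refine Or.inr ⟨h, ?_⟩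
          simpa [hπ, h, and_comm] using And.intro h1 h2
      · simpa [hπ] using h3
      · simpa [hπ] using h4
    intro v hv w hw hvw
    obtain ⟨hv1, hv2⟩ := Finset.mem_filter.1 hv
    obtain ⟨hw1, hw2⟩ := Finset.mem_filter.1 hw
    obtain ⟨h1, h2, h3⟩ := hSc hv2 hw2 (fun h => hvw (hinj hv1 hw1 h))
    rcases h3 with h3 | h3
    · exact main v hv1 w hw1 h1 h2 h3.1 h3.2
    · exact (main w hw1 v hv1 h2 h1 h3.1 h3.2).symm

theorem card_le_of_cell {r B M : ℕ} (hB : 0 < B) (hM : 1 ≤ M) (s : Fin r → Bool)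
    {q : Fin r → ℕ} {a b : Fin r} (hq : AlmostStrict q a b) (hqm : q a ≤ q b)
    (H : Finset (Fin r → ℕ)) (hmono : ∀ v ∈ H, StrictMono v) (hcell : ∀ v ∈ H, ∀ j, v j / B = q j)
    (hfree : ∀ S ⊆ H, (S : Set (Fin r → ℕ)).Pairwise (TupRel s) → S.card ≤ M) :
    H.card ≤ 12 * M * B * (2 * B) ^ (r - 2) := by
  classical
  have hab : a ≠ b := fun h => by
    have := hq.1
    rw [h] at this
    omega
  have hshifts : (H.image (cellShift s B a b)).card ≤ (2 * B) ^ (r - 2) := by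
    refine (card_le_pow_of_determined_off (N := 2 * B) _ {a, b} ?_ ?_).trans
      (by rw [Finset.card_pair hab])
    · intro f hf j
      obtain ⟨v, -, rfl⟩ := Finset.mem_image.1 hf
      have h1 := flipRes_lt (s j == s b) (Nat.mod_lt (v j) hB)
      unfold cellShift
      split_ifs <;> omega
    · intro f hf g hg hfg
      obtain ⟨v, -, rfl⟩ := Finset.mem_image.1 hf
      obtain ⟨w, -, rfl⟩ := Finset.mem_image.1 hg
      funext j
      by_cases hja : j = a
      · simp [cellShift, hja]
      by_cases hjb : j = b
      · simp [cellShift, hjb]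
      exact hfg j (by simp [hja, hjb])
  refine (Finset.card_le_mul_card_image (f := cellShift s B a b) H (12 * M * B) fun δ _ => ?_).trans
    (Nat.mul_le_mul_left _ hshifts)
  have hsub := Finset.filter_subset (fun v => cellShift s B a b v = δ) H
  exact card_le_of_cell_of_cellShift hB hM s hq hqm δ _ (fun v hv => hmono v (hsub hv))
    (fun v hv => hcell v (hsub hv)) (fun v hv => (Finset.mem_filter.1 hv).2)
    (fun S hS => hfree S (hS.trans hsub))

/-- The cell of side `2 ^ d` containing the tuple `v`. -/
def cell {r : ℕ} (d : ℕ) (v : Fin r → ℕ) : Fin r → ℕ := fun j => v j / 2 ^ d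

theorem cell_mono {r d : ℕ} {v : Fin r → ℕ} (hv : Monotone v) : Monotone (cell d v) :=
  fun _ _ hij => Nat.div_le_div_right (hv hij)

theorem cell_succ {r d : ℕ} (v : Fin r → ℕ) : cell (d + 1) v = fun j => cell d v j / 2 := by
  funext j
  rw [cell, cell, Nat.div_div_eq_div_mul, pow_succ]

theorem cell_lt {r d t : ℕ} {v : Fin r → ℕ} {j : Fin r} (hv : v j < 2 ^ t) (hd : d ≤ t) :
    cell d v j < 2 ^ (t - d) := by
  rw [cell, Nat.div_lt_iff_lt_mul (by positivity), ← pow_add, Nat.sub_add_cancel hd]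
  exact hv

theorem card_image_cell_le {r d t : ℕ} (hr : 2 ≤ r) (hd : d < t) (H : Finset (Fin r → ℕ))
    (hmono : ∀ v ∈ H, StrictMono v) (hlt : ∀ v ∈ H, ∀ j, v j < 2 ^ t)
    (hbad : ∀ v ∈ H, ¬ ∃ a b, AlmostStrict (cell (d + 1) v) a b) :
    (H.image (cell d)).card ≤ 2 ^ r * (r ^ 2 * (2 ^ (t - (d + 1))) ^ (r - 2)) := by
  classical
  have himg : (H.image (cell d)).image (fun q j => q j / 2) = H.image (cell (d + 1)) := by
    rw [Finset.image_image]
    exact Finset.image_congr fun v _ => (cell_succ v).symm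
  refine (Finset.card_le_mul_card_image (f := fun q : Fin r → ℕ => fun j => q j / 2)
    (H.image (cell d)) (2 ^ r) fun p _ => card_fiber_div_two_le _ p
      fun q hq => (Finset.mem_filter.1 hq).2).trans ?_
  rw [himg]
  refine Nat.mul_le_mul_left _ (card_le_of_two_coincidences _ ?_ ?_)
  · intro f hf j
    obtain ⟨v, hv, rfl⟩ := Finset.mem_image.1 hf
    exact cell_lt (hlt v hv j) hd
  · intro f hf
    obtain ⟨v, hv, rfl⟩ := Finset.mem_image.1 hf
    exact exists_two_coincidences hr (cell_mono (hmono v hv).monotone) (hbad v hv)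

theorem card_le_of_almostStrict_cells {r d M : ℕ} (hM : 1 ≤ M) (s : Fin r → Bool)
    (H : Finset (Fin r → ℕ)) (hmono : ∀ v ∈ H, StrictMono v)
    (hgood : ∀ v ∈ H, ∃ a b, AlmostStrict (cell d v) a b)
    (hfree : ∀ S ⊆ H, (S : Set (Fin r → ℕ)).Pairwise (TupRel s) → S.card ≤ M) :
    H.card ≤ 12 * M * 2 ^ d * (2 * 2 ^ d) ^ (r - 2) * (H.image (cell d)).card := by
  classical
  refine Finset.card_le_mul_card_image H _ fun q hq => ?_
  obtain ⟨v, hv, rfl⟩ := Finset.mem_image.1 hq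
  obtain ⟨a, b, hab⟩ := hgood v hv
  have hsub := Finset.filter_subset (fun w => cell d w = cell d v) H
  have hle : a ≤ b := by rw [Fin.le_def, ← hab.1]; omega
  exact card_le_of_cell (by positivity) hM s hab (cell_mono (hmono v hv).monotone hle) _
    (fun w hw => hmono w (hsub hw)) (fun w hw => congrFun (Finset.mem_filter.1 hw).2)
    (fun S hS => hfree S (hS.trans hsub))

theorem exists_transition {p : ℕ → Prop} (h0 : p 0) (t : ℕ) :
    p t ∨ ∃ d < t, p d ∧ ¬ p (d + 1) := by
  induction t with
  | zero => exact Or.inl h0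
  | succ t ih =>
    rcases ih with h | ⟨d, hd, h⟩
    · by_cases h' : p (t + 1)
      · exact Or.inl h'
      · exact Or.inr ⟨t, by omega, h, h'⟩
    · exact Or.inr ⟨d, by omega, h⟩

theorem card_le_of_tupRel_bounded {r M : ℕ} (hr : 2 ≤ r) (hM : 1 ≤ M) (s : Fin r → Bool) (t : ℕ)
    (H : Finset (Fin r → ℕ)) (hmono : ∀ v ∈ H, StrictMono v) (hlt : ∀ v ∈ H, ∀ j, v j < 2 ^ t)
    (hfree : ∀ S ⊆ H, (S : Set (Fin r → ℕ)).Pairwise (TupRel s) → S.card ≤ M) :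
    H.card ≤ 24 * 2 ^ r * r ^ 2 * M * 2 ^ (t * (r - 1)) := by
  classical
  obtain ⟨k, rfl⟩ : ∃ k, r = k + 2 := ⟨r - 2, by omega⟩
  rw [show k + 2 - 1 = k + 1 by omega]
  set good : ℕ → (Fin (k + 2) → ℕ) → Prop := fun d v => ∃ a b, AlmostStrict (cell d v) a b
    with hgood
  set Hd : ℕ → Finset (Fin (k + 2) → ℕ) := fun d => H.filter fun v => good d v ∧ ¬ good (d + 1) v
    with hHd
  set Ht := H.filter (good t) with hHt
  have hcover : H ⊆ Ht ∪ (Finset.range t).biUnion Hd := by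
    intro v hv
    have h0 : good 0 v := by
      refine ⟨⟨0, by omega⟩, ⟨1, by omega⟩, rfl, fun i j hij => Or.inl ?_⟩
      simpa [cell] using hmono v hv hij
    simp only [Finset.mem_union, Finset.mem_biUnion, Finset.mem_range, hHt, hHd,
      Finset.mem_filter, hv, true_and]
    exact exists_transition (p := fun d => good d v) h0 t
  have hcardt : Ht.card ≤ 12 * M * 2 ^ t * (2 * 2 ^ t) ^ k := by
    have hsub : Ht ⊆ H := Finset.filter_subset _ _
    have h1 := card_le_of_almostStrict_cells (d := t) hM s Ht (fun v hv => hmono v (hsub hv))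
      (fun v hv => (Finset.mem_filter.1 hv).2) (fun S hS => hfree S (hS.trans hsub))
    have h2 : (Ht.image (cell t)).card ≤ 1 := by
      refine Finset.card_le_one.2 fun p hp q hq => ?_
      obtain ⟨v, hv, rfl⟩ := Finset.mem_image.1 hp
      obtain ⟨w, hw, rfl⟩ := Finset.mem_image.1 hq
      funext j
      rw [cell, cell, Nat.div_eq_of_lt (hlt v (hsub hv) j), Nat.div_eq_of_lt (hlt w (hsub hw) j)]
    calc Ht.card ≤ _ := h1
      _ ≤ 12 * M * 2 ^ t * (2 * 2 ^ t) ^ k * 1 := Nat.mul_le_mul_left _ h2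
      _ = _ := mul_one _
  have hcardd : ∀ d ∈ Finset.range t,
      (Hd d).card ≤ 12 * 2 ^ (k + 2) * (k + 2) ^ 2 * M * 2 ^ (t * k) * 2 ^ d := by
    intro d hd
    rw [Finset.mem_range] at hd
    have hsub : Hd d ⊆ H := Finset.filter_subset _ _
    have h1 := card_le_of_almostStrict_cells (d := d) hM s (Hd d) (fun v hv => hmono v (hsub hv))
      (fun v hv => (Finset.mem_filter.1 hv).2.1) (fun S hS => hfree S (hS.trans hsub))
    have h2 := card_image_cell_le (by omega) hd (Hd d) (fun v hv => hmono v (hsub hv))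
      (fun v hv => hlt v (hsub hv)) (fun v hv => (Finset.mem_filter.1 hv).2.2)
    calc (Hd d).card ≤ _ := h1
      _ ≤ _ := Nat.mul_le_mul_left _ h2
      _ = 12 * 2 ^ (k + 2) * (k + 2) ^ 2 * M * (2 ^ (d + 1) * 2 ^ (t - (d + 1))) ^ k * 2 ^ d := by
        simp only [Nat.add_sub_cancel]
        ring
      _ = _ := by rw [← pow_add, Nat.add_sub_cancel' (show d + 1 ≤ t by omega), ← pow_mul]
  have hgeom : ∑ d ∈ Finset.range t, 2 ^ d ≤ 2 ^ t := by
    rw [Nat.geomSum_eq le_rfl]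
    simp
  calc H.card ≤ Ht.card + ∑ d ∈ Finset.range t, (Hd d).card :=
        (Finset.card_le_card hcover).trans ((Finset.card_union_le _ _).trans
          (Nat.add_le_add_left Finset.card_biUnion_le _))
    _ ≤ 12 * M * 2 ^ t * (2 * 2 ^ t) ^ k +
        ∑ d ∈ Finset.range t, 12 * 2 ^ (k + 2) * (k + 2) ^ 2 * M * 2 ^ (t * k) * 2 ^ d :=
        add_le_add hcardt (Finset.sum_le_sum hcardd)
    _ = 12 * 2 ^ k * 1 * M * 2 ^ (t * (k + 1)) + 12 * 2 ^ (k + 2) * (k + 2) ^ 2 * M * 2 ^ (t * k) *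
        ∑ d ∈ Finset.range t, 2 ^ d := by
        rw [← Finset.mul_sum]
        congr 1
        ring
    _ ≤ 12 * 2 ^ (k + 2) * (k + 2) ^ 2 * M * 2 ^ (t * (k + 1)) +
        12 * 2 ^ (k + 2) * (k + 2) ^ 2 * M * 2 ^ (t * k) * 2 ^ t := by
        gcongr
        · exact one_le_two
        · omega
        · exact Nat.one_le_pow _ _ (by omega)
    _ = _ := by ring

theorem FormsPattern.symm {e f : Finset ℕ} {P : Finset (Finset ℕ)} (h : FormsPattern e f P) :
    FormsPattern f e P := by
  obtain ⟨φ, h1, h2⟩ := h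
  exact ⟨φ, by rwa [Finset.union_comm], by rwa [Finset.pair_comm]⟩

/-- The pair of tuples `A, B` lists the two edges of an `r`-partite `r`-pattern. -/
def IsPatternPair {r : ℕ} (A B : Fin r → ℕ) : Prop :=
  ∀ j, (A j = 2 * j.val + 1 ∧ B j = 2 * j.val + 2) ∨ (A j = 2 * j.val + 2 ∧ B j = 2 * j.val + 1)

theorem IsPatternPair.strictMono {r : ℕ} {A B : Fin r → ℕ} (h : IsPatternPair A B) :
    StrictMono A ∧ StrictMono B := by
  constructor <;>
  · intro i j hij
    rw [Fin.lt_def] at hij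
    have := h i
    have := h j
    omega

theorem exists_isPatternPair {r : ℕ} {P : Finset (Finset ℕ)} (hP : IsPattern r P)
    (hpart : IsPartite r 2 P) : ∃ A B : Fin r → ℕ, IsPatternPair A B ∧
      P = {Finset.univ.image A, Finset.univ.image B} := by
  obtain ⟨hcard, hr, hdisj, -⟩ := hP
  obtain ⟨E, F, hEF, rfl⟩ := Finset.card_eq_two.1 hcard
  have key : ∀ e ∈ ({E, F} : Finset (Finset ℕ)), ∃ a : Fin r → ℕ,
      (∀ j, 2 * j.val + 1 ≤ a j ∧ a j ≤ 2 * j.val + 2) ∧ Finset.univ.image a = e := by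
    intro e he
    have h : ∀ j : Fin r, ∃ x, e ∩ Finset.Icc (j.val * 2 + 1) ((j.val + 1) * 2) = {x} := fun j =>
      Finset.card_eq_one.1 (hpart e he (j.val + 1) (by omega) (by omega))
    choose a ha using h
    have hmem : ∀ j, a j ∈ e ∧ 2 * j.val + 1 ≤ a j ∧ a j ≤ 2 * j.val + 2 := fun j => by
      have : a j ∈ e ∩ Finset.Icc (j.val * 2 + 1) ((j.val + 1) * 2) := by
        rw [ha]
        exact Finset.mem_singleton_self _
      rw [Finset.mem_inter, Finset.mem_Icc] at this
      exact ⟨this.1, by omega, by omega⟩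
    refine ⟨a, fun j => (hmem j).2, Finset.eq_of_subset_of_card_le ?_ ?_⟩
    · intro x hx
      obtain ⟨j, -, rfl⟩ := Finset.mem_image.1 hx
      exact (hmem j).1
    · rw [hr e he, Finset.card_image_of_injective, Finset.card_univ, Fintype.card_fin]
      intro i j hij
      have h1 := hmem i
      have h2 := hmem j
      exact Fin.ext (by omega)
  obtain ⟨A, hA, hAE⟩ := key E (by simp)
  obtain ⟨B, hB, hBF⟩ := key F (by simp)
  refine ⟨A, B, fun j => ?_, by rw [hAE, hBF]⟩
  have hne : A j ≠ B j := by
    have h := hdisj E (by simp) F (by simp) hEF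
    rw [← hAE, ← hBF, Finset.disjoint_left] at h
    intro hAB
    exact h (Finset.mem_image_of_mem A (Finset.mem_univ j))
      (hAB ▸ Finset.mem_image_of_mem B (Finset.mem_univ j))
  have h1 := hA j
  have h2 := hB j
  omega

theorem IsPatternPair.formsPattern {r : ℕ} {A B : Fin r → ℕ} (h : IsPatternPair A B)
    {e f : Fin r → ℕ} (he : StrictMono e) (hf : StrictMono f)
    (hint : ∀ i j, i < j → e i < f j ∧ f i < e j)
    (hor : ∀ j, if A j < B j then e j < f j else f j < e j) :
    FormsPattern (Finset.univ.image e) (Finset.univ.image f)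
      {Finset.univ.image A, Finset.univ.image B} := by
  have hor' : ∀ j, (A j < B j ∧ e j < f j) ∨ (B j < A j ∧ f j < e j) := fun j => by
    have h1 := h j
    have h2 := hor j
    split_ifs at h2 <;> omega
  have hmono : ∀ x y : Fin r ⊕ Fin r, Sum.elim e f x < Sum.elim e f y →
      Sum.elim A B x < Sum.elim A B y := by
    have hlt : ∀ i j : Fin r, i < j → A i < B j ∧ B i < A j := fun i j hij => by
      rw [Fin.lt_def] at hij
      have h1 := h i
      have h2 := h j
      omega
    rintro (i | i) (j | j) hxy <;> simp only [Sum.elim_inl, Sum.elim_inr] at hxy ⊢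
    · exact h.strictMono.1 (he.lt_iff_lt.1 hxy)
    · rcases lt_trichotomy i j with hij | rfl | hij
      · exact (hlt i j hij).1
      · have := hor' i
        omega
      · have := hint j i hij
        omega
    · rcases lt_trichotomy i j with hij | rfl | hij
      · exact (hlt i j hij).2
      · have := hor' i
        omega
      · have := hint j i hij
        omega
    · exact h.strictMono.2 (hf.lt_iff_lt.1 hxy)
  have hne : ∀ i j, e i ≠ f j := fun i j => by
    rcases lt_trichotomy i j with hij | rfl | hij
    · exact (hint i j hij).1.ne
    · have := hor' i
      omega
    · exact (hint j i hij).2.ne'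
  have hinj : Function.Injective (Sum.elim e f) := he.injective.sumElim hf.injective hne
  have hval : ∀ x, Function.extend (Sum.elim e f) (Sum.elim A B) 0 (Sum.elim e f x) =
      Sum.elim A B x := fun x => hinj.extend_apply _ _ x
  refine ⟨Function.extend (Sum.elim e f) (Sum.elim A B) 0, ?_, ?_⟩
  · have hmem : ∀ x ∈ Finset.univ.image e ∪ Finset.univ.image f,
        ∃ z, Sum.elim e f z = x := by
      intro x hx
      rcases Finset.mem_union.1 hx with hx | hx
      · obtain ⟨i, -, rfl⟩ := Finset.mem_image.1 hx
        exact ⟨Sum.inl i, rfl⟩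
      · obtain ⟨i, -, rfl⟩ := Finset.mem_image.1 hx
        exact ⟨Sum.inr i, rfl⟩
    intro x hx y hy hxy
    obtain ⟨x, rfl⟩ := hmem x hx
    obtain ⟨y, rfl⟩ := hmem y hy
    rw [hval, hval]
    exact hmono x y hxy
  · rw [Finset.image_image, Finset.image_image]
    have h1 : Function.extend (Sum.elim e f) (Sum.elim A B) 0 ∘ e = A :=
      funext fun i => hval (Sum.inl i)
    have h2 : Function.extend (Sum.elim e f) (Sum.elim A B) 0 ∘ f = B :=
      funext fun i => hval (Sum.inr i)
    rw [h1, h2]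

/-- The coordinatewise orders between `e` and `f` are those given by `s`, up to a global swap. -/
def SignRel {r : ℕ} (s : Fin r → Bool) (e f : Fin r → ℕ) : Prop :=
  (∀ j, if s j then e j < f j else f j < e j) ∨ (∀ j, if s j then f j < e j else e j < f j)

theorem IsPatternPair.signRel {r : ℕ} {A B : Fin r → ℕ} (h : IsPatternPair A B)
    {e f : Fin r → ℕ} (he : StrictMono e) (hf : StrictMono f)
    (hform : FormsPattern (Finset.univ.image e) (Finset.univ.image f)
      {Finset.univ.image A, Finset.univ.image B}) : SignRel (fun j => decide (A j < B j)) e f := by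
  have main : ∀ {e f : Fin r → ℕ}, StrictMono e → StrictMono f → ∀ φ : ℕ → ℕ,
      StrictMonoOn φ (↑(Finset.univ.image e ∪ Finset.univ.image f) : Set ℕ) →
      (Finset.univ.image e).image φ = Finset.univ.image A →
      (Finset.univ.image f).image φ = Finset.univ.image B →
      ∀ j, if A j < B j then e j < f j else f j < e j := by
    intro e f he hf φ hφ heA hfB j
    have hme : ∀ i, e i ∈ (↑(Finset.univ.image e ∪ Finset.univ.image f) : Set ℕ) := fun i => by
      simp
    have hmf : ∀ i, f i ∈ (↑(Finset.univ.image e ∪ Finset.univ.image f) : Set ℕ) := fun i => by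
      simp
    have huniq : ∀ {g A : Fin r → ℕ}, StrictMono g → StrictMono A →
        Finset.univ.image g = Finset.univ.image A → g = A := by
      intro g A hg hA hgA
      refine (hg.range_inj hA).1 ?_
      have := congrArg (fun s : Finset ℕ => (s : Set ℕ)) hgA
      simpa using this
    have h1 : φ ∘ e = A := huniq (fun i j hij => hφ (hme i) (hme j) (he hij)) h.strictMono.1
      (by rw [← heA, Finset.image_image])
    have h2 : φ ∘ f = B := huniq (fun i j hij => hφ (hmf i) (hmf j) (hf hij)) h.strictMono.2
      (by rw [← hfB, Finset.image_image])
    have h3 : φ (e j) = A j := congrFun h1 j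
    have h4 : φ (f j) = B j := congrFun h2 j
    have h5 := h j
    split_ifs with hlt
    · exact (hφ.lt_iff_lt (hme j) (hmf j)).1 (by omega)
    · exact (hφ.lt_iff_lt (hmf j) (hme j)).1 (by omega)
  obtain ⟨φ, hφ, himg⟩ := hform
  have hpair : ((Finset.univ.image e).image φ = Finset.univ.image A ∧
      (Finset.univ.image f).image φ = Finset.univ.image B) ∨
      ((Finset.univ.image e).image φ = Finset.univ.image B ∧
      (Finset.univ.image f).image φ = Finset.univ.image A) := by
    have := congrArg (fun s : Finset (Finset ℕ) => (s : Set (Finset ℕ))) himg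
    simpa [Set.pair_eq_pair_iff] using this
  rcases hpair with ⟨h1, h2⟩ | ⟨h1, h2⟩
  · left
    intro j
    simpa using main he hf φ hφ h1 h2 j
  · right
    intro j
    simpa using main hf he φ (by rwa [Finset.union_comm]) h2 h1 j

theorem exists_signs {r : ℕ} {P : Finset (Finset ℕ)} (hP : IsPattern r P)
    (hpart : IsPartite r 2 P) : ∃ s : Fin r → Bool,
      ∀ e f : Fin r → ℕ, StrictMono e → StrictMono f →
        (TupRel s e f → FormsPattern (Finset.univ.image e) (Finset.univ.image f) P) ∧
        (FormsPattern (Finset.univ.image e) (Finset.univ.image f) P → SignRel s e f) := by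
  obtain ⟨A, B, hAB, rfl⟩ := exists_isPatternPair hP hpart
  refine ⟨fun j => decide (A j < B j), fun e f he hf => ⟨fun h => ?_, hAB.signRel he hf⟩⟩
  obtain ⟨hint, h | h⟩ := h
  · exact hAB.formsPattern he hf hint (by simpa using h)
  · exact (hAB.formsPattern hf he (fun i j hij => (hint i j hij).symm) (by simpa using h)).symm

theorem pow_self_le_three_pow_mul_factorial (n : ℕ) : n ^ n ≤ 3 ^ n * n.factorial := by
  have h1 := Real.pow_div_factorial_le_exp (n : ℝ) (by positivity) n
  have h2 : Real.exp n ≤ 3 ^ n := by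
    rw [← Real.exp_one_pow]
    gcongr
    exact Real.exp_one_lt_three.le
  rw [div_le_iff₀ (by positivity)] at h1
  have h3 : (n : ℝ) ^ n ≤ 3 ^ n * n.factorial := h1.trans (by gcongr)
  exact_mod_cast h3

/-- A family of `n` strictly increasing tuples with entries below `2 ^ J` in which all cliques have
at most `M` members. -/
structure IsCliqueBounded {r : ℕ} (s : Fin r → Bool) (J M n : ℕ) (V : Finset (Fin r → ℕ)) :
    Prop where
  strictMono : ∀ v ∈ V, StrictMono v
  lt : ∀ v ∈ V, ∀ j, v j < 2 ^ J
  card_le : ∀ S ⊆ V, (S : Set (Fin r → ℕ)).Pairwise (TupRel s) → S.card ≤ M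
  card : V.card = n

theorem tupRel_of_cell {r d : ℕ} {s : Fin r → Bool} {e f : Fin r → ℕ}
    (h : TupRel s (cell d e) (cell d f)) : TupRel s e f := by
  have hlt : ∀ {e f : Fin r → ℕ} {i j}, cell d e i < cell d f j → e i < f j := fun h =>
    lt_of_not_ge fun h' => absurd h (not_lt.2 (Nat.div_le_div_right h'))
  refine ⟨fun i j hij => ⟨hlt (h.1 i j hij).1, hlt (h.1 i j hij).2⟩, ?_⟩
  refine h.2.imp (fun h j => ?_) (fun h j => ?_)
  all_goals
    have := h j
    split_ifs at this ⊢ <;> exact hlt this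

/-- The constant in the bound on the number of occupied cells. -/
def cellConst (r : ℕ) : ℕ := 24 * 2 ^ r * r ^ 2 + r

theorem IsCliqueBounded.card_image_cell_le {r J M n d : ℕ} {s : Fin r → Bool}
    {V : Finset (Fin r → ℕ)} (hV : IsCliqueBounded s J M n V) (hr : 2 ≤ r) (hM : 1 ≤ M)
    (hd : d ≤ J) : (V.image (cell d)).card ≤ cellConst r * M * 2 ^ ((J - d) * (r - 1)) := by
  classical
  set W := V.image (cell d) with hW
  have hlt : ∀ q ∈ W, ∀ j, q j < 2 ^ (J - d) := by
    intro q hq j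
    obtain ⟨v, hv, rfl⟩ := Finset.mem_image.1 hq
    exact cell_lt (hV.lt v hv j) hd
  have h1 : (W.filter StrictMono).card ≤
      24 * 2 ^ r * r ^ 2 * M * 2 ^ ((J - d) * (r - 1)) := by
    refine card_le_of_tupRel_bounded hr hM s (J - d) _ (fun q hq => (Finset.mem_filter.1 hq).2)
      (fun q hq => hlt q (Finset.mem_filter.1 hq).1) fun S hS hSc => ?_
    have hex : ∀ q ∈ S, ∃ v ∈ V, cell d v = q := fun q hq =>
      Finset.mem_image.1 (Finset.mem_filter.1 (hS hq)).1
    choose! g hgV hg using hex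
    have hinj : Set.InjOn g S := fun q hq q' hq' h => by
      rw [← hg q hq, ← hg q' hq', h]
    rw [← Finset.card_image_of_injOn hinj]
    refine hV.card_le _ (Finset.image_subset_iff.2 hgV) ?_
    rw [Finset.coe_image]
    rintro _ ⟨q, hq, rfl⟩ _ ⟨q', hq', rfl⟩ hne
    have := hSc hq hq' (fun h => hne (h ▸ rfl))
    rw [← hg q hq, ← hg q' hq'] at this
    exact tupRel_of_cell this
  have h2 : (W.filter fun q => ¬ StrictMono q).card ≤ r * (2 ^ (J - d)) ^ (r - 1) := by
    refine card_le_of_not_injective _ (fun q hq => hlt q (Finset.mem_filter.1 hq).1) ?_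
      (fun q hq => (Finset.mem_filter.1 hq).2)
    intro q hq
    obtain ⟨v, hv, rfl⟩ := Finset.mem_image.1 (Finset.mem_filter.1 hq).1
    exact cell_mono (hV.strictMono v hv).monotone
  calc W.card = _ := (Finset.card_filter_add_card_filter_not _).symm
    _ ≤ _ := add_le_add h1 h2
    _ = 24 * 2 ^ r * r ^ 2 * M * 2 ^ ((J - d) * (r - 1)) + r * 1 * 2 ^ ((J - d) * (r - 1)) := by
      rw [pow_mul, mul_one]
    _ ≤ 24 * 2 ^ r * r ^ 2 * M * 2 ^ ((J - d) * (r - 1)) +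
        r * M * 2 ^ ((J - d) * (r - 1)) := by gcongr
    _ = _ := by rw [cellConst]; ring

theorem card_image_cells_step {r J M n d : ℕ} {s : Fin r → Bool} (hr : 2 ≤ r) (hM : 1 ≤ M)
    (hd : d < J) (𝓗 : Finset (Finset (Fin r → ℕ))) (h𝓗 : ∀ V ∈ 𝓗, IsCliqueBounded s J M n V) :
    (𝓗.image fun V => V.image (cell d)).card ≤
      2 ^ (2 ^ r * (cellConst r * M * 2 ^ ((J - (d + 1)) * (r - 1)))) *
        (𝓗.image fun V => V.image (cell (d + 1))).card := by
  classical
  set half : (Fin r → ℕ) → Fin r → ℕ := fun q j => q j / 2 with hhalf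
  have himg : ∀ V : Finset (Fin r → ℕ), (V.image (cell d)).image half = V.image (cell (d + 1)) := by
    intro V
    rw [Finset.image_image]
    exact Finset.image_congr fun v _ => (cell_succ v).symm
  refine Finset.card_le_mul_card_image_of_maps_to (f := fun W => W.image half) ?_ _ ?_
  · intro W hW
    obtain ⟨V, hV, rfl⟩ := Finset.mem_image.1 hW
    exact Finset.mem_image.2 ⟨V, hV, (himg V).symm⟩
  · intro W' hW'
    obtain ⟨V, hV, rfl⟩ := Finset.mem_image.1 hW'
    set F := (𝓗.image fun V => V.image (cell d)).filter
      fun W => W.image half = V.image (cell (d + 1)) with hF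
    set Y := F.biUnion id with hY
    have hYcard : Y.card ≤ 2 ^ r * (cellConst r * M * 2 ^ ((J - (d + 1)) * (r - 1))) := by
      refine (Finset.card_le_mul_card_image_of_maps_to (f := half)
        (t := V.image (cell (d + 1))) ?_ (2 ^ r) ?_).trans
        (Nat.mul_le_mul_left _ ((h𝓗 V hV).card_image_cell_le hr hM hd))
      · intro q hq
        obtain ⟨W, hW, hqW⟩ := Finset.mem_biUnion.1 hq
        rw [← (Finset.mem_filter.1 hW).2]
        exact Finset.mem_image_of_mem _ hqW
      · intro p _
        exact card_fiber_div_two_le _ p fun q hq => (Finset.mem_filter.1 hq).2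
    calc F.card ≤ Y.powerset.card := Finset.card_le_card fun W hW =>
          Finset.mem_powerset.2 (Finset.subset_biUnion_of_mem id hW)
      _ = 2 ^ Y.card := Finset.card_powerset _
      _ ≤ _ := Nat.pow_le_pow_right two_pos hYcard

theorem card_image_cells_le {r J M n : ℕ} {s : Fin r → Bool} (hr : 2 ≤ r) (hM : 1 ≤ M)
    (𝓗 : Finset (Finset (Fin r → ℕ))) (h𝓗 : ∀ V ∈ 𝓗, IsCliqueBounded s J M n V) (t : ℕ)
    (ht : t ≤ J) :
    (𝓗.image fun V => V.image (cell (J - t))).card ≤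
      2 * 2 ^ (2 ^ r * (cellConst r * M * 2 ^ (t * (r - 1)))) := by
  classical
  induction t with
  | zero =>
    have hsub : (𝓗.image fun V => V.image (cell (J - 0))) ⊆
        ({fun _ => 0} : Finset (Fin r → ℕ)).powerset := by
      intro W hW
      obtain ⟨V, hV, rfl⟩ := Finset.mem_image.1 hW
      rw [Finset.mem_powerset]
      intro q hq
      obtain ⟨v, hv, rfl⟩ := Finset.mem_image.1 hq
      rw [Finset.mem_singleton]
      exact funext fun j => Nat.div_eq_of_lt ((h𝓗 V hV).lt v hv j)
    refine (Finset.card_le_card hsub).trans ?_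
    rw [Finset.card_powerset, Finset.card_singleton, pow_one]
    exact Nat.le_mul_of_pos_right _ (by positivity)
  | succ t ih =>
    have hstep := card_image_cells_step hr hM (d := J - (t + 1)) (by omega) 𝓗 h𝓗
    rw [show J - (t + 1) + 1 = J - t by omega, show J - (J - t) = t by omega] at hstep
    refine hstep.trans ((Nat.mul_le_mul_left _ (ih (by omega))).trans ?_)
    rw [mul_left_comm, ← pow_add]
    refine Nat.mul_le_mul_left _ (Nat.pow_le_pow_right two_pos ?_)
    have : 2 * 2 ^ (t * (r - 1)) ≤ 2 ^ ((t + 1) * (r - 1)) := by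
      rw [← pow_succ']
      refine Nat.pow_le_pow_right two_pos ?_
      rw [add_mul]
      omega
    calc _ = 2 ^ r * (cellConst r * M * (2 * 2 ^ (t * (r - 1)))) := by ring
      _ ≤ _ := by gcongr

theorem card_le_of_isCliqueBounded {r J M n t : ℕ} {s : Fin r → Bool} (hr : 2 ≤ r) (hM : 1 ≤ M)
    (hn : 1 ≤ n) (𝓗 : Finset (Finset (Fin r → ℕ))) (h𝓗 : ∀ V ∈ 𝓗, IsCliqueBounded s J M n V)
    (ht : t ≤ J) (htn : M * 2 ^ (t * (r - 1)) ≤ n) :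
    𝓗.card ≤ (2 * 2 ^ (2 ^ r * cellConst r) * (3 * cellConst r) * (2 ^ (J - t)) ^ r) ^ n := by
  classical
  set c := cellConst r with hc
  set L := 2 ^ (J - t) with hL
  have hLpos : 0 < L := by positivity
  have hcn : c * M * 2 ^ (t * (r - 1)) ≤ c * n := by
    rw [mul_assoc]
    exact Nat.mul_le_mul_left _ htn
  have hfib : ∀ W ∈ 𝓗.image fun V => V.image (cell (J - t)),
      (𝓗.filter fun V => V.image (cell (J - t)) = W).card ≤ (3 * c * L ^ r) ^ n := by
    intro W hW
    obtain ⟨V₀, hV₀, rfl⟩ := Finset.mem_image.1 hW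
    set F := 𝓗.filter fun V => V.image (cell (J - t)) = V₀.image (cell (J - t)) with hF
    set Y := F.biUnion id with hY
    have hYcard : Y.card ≤ L ^ r * (c * n) := by
      have hWc : (V₀.image (cell (J - t))).card ≤ c * n := by
        have := (h𝓗 V₀ hV₀).card_image_cell_le hr hM (Nat.sub_le J t)
        rw [show J - (J - t) = t by omega] at this
        exact this.trans hcn
      refine (Finset.card_le_mul_card_image_of_maps_to (f := cell (J - t))
        (t := V₀.image (cell (J - t))) ?_ (L ^ r) ?_).trans (Nat.mul_le_mul_left _ hWc)
      · intro v hv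
        obtain ⟨V, hV, hvV⟩ := Finset.mem_biUnion.1 hv
        rw [← (Finset.mem_filter.1 hV).2]
        exact Finset.mem_image_of_mem _ hvV
      · intro q _
        calc _ ≤ (Fintype.piFinset fun j => Finset.Ico (q j * L) (q j * L + L)).card := by
              refine Finset.card_le_card fun v hv => ?_
              rw [Fintype.mem_piFinset]
              intro j
              have h1 : v j / L = q j := congrFun (Finset.mem_filter.1 hv).2 j
              rw [Finset.mem_Ico, ← h1]
              exact ⟨Nat.div_mul_le_self _ _, by
                have := Nat.div_add_mod' (v j) L
                have := Nat.mod_lt (v j) hLpos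
                omega⟩
          _ = L ^ r := by simp [Fintype.card_piFinset]
    have h1 : F.card ≤ Y.card.choose n := by
      rw [← Finset.card_powersetCard]
      refine Finset.card_le_card fun V hV => Finset.mem_powersetCard.2
        ⟨Finset.subset_biUnion_of_mem id hV, (h𝓗 V (Finset.mem_filter.1 hV).1).card⟩
    have h2 : Y.card.choose n * n.factorial ≤ (3 * c * L ^ r) ^ n * n.factorial := by
      calc Y.card.choose n * n.factorial = Y.card.descFactorial n := by
            rw [Nat.descFactorial_eq_factorial_mul_choose, mul_comm]
        _ ≤ Y.card ^ n := Nat.descFactorial_le_pow _ _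
        _ ≤ (L ^ r * (c * n)) ^ n := Nat.pow_le_pow_left hYcard n
        _ = (L ^ r * c) ^ n * n ^ n := by rw [← mul_pow]; ring
        _ ≤ (L ^ r * c) ^ n * (3 ^ n * n.factorial) :=
          Nat.mul_le_mul_left _ (pow_self_le_three_pow_mul_factorial n)
        _ = _ := by rw [← mul_assoc, ← mul_pow]; ring
    exact h1.trans (Nat.le_of_mul_le_mul_right h2 (Nat.factorial_pos n))
  calc 𝓗.card ≤ (3 * c * L ^ r) ^ n * (𝓗.image fun V => V.image (cell (J - t))).card :=
        Finset.card_le_mul_card_image _ _ hfib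
    _ ≤ (3 * c * L ^ r) ^ n * (2 ^ n * 2 ^ (2 ^ r * (c * n))) := by
        refine Nat.mul_le_mul_left _ ((card_image_cells_le hr hM 𝓗 h𝓗 t ht).trans ?_)
        gcongr
        · exact Nat.le_self_pow (by omega) 2
        · exact one_le_two
    _ = _ := by
        rw [show 2 ^ r * (c * n) = 2 ^ r * c * n by ring, pow_mul 2 (2 ^ r * c) n, ← mul_pow,
          ← mul_pow]
        ring

/-- The increasing enumeration of an edge of size `r` (junk if the size is not `r`). -/
def edgeTuple (r : ℕ) (e : Finset ℕ) : Fin r → ℕ :=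
  if h : e.card = r then e.orderEmbOfFin h else fun j => j

theorem strictMono_edgeTuple (r : ℕ) (e : Finset ℕ) : StrictMono (edgeTuple r e) := by
  unfold edgeTuple
  split
  · exact (e.orderEmbOfFin _).strictMono
  · exact Fin.val_strictMono

theorem image_edgeTuple {r : ℕ} {e : Finset ℕ} (h : e.card = r) :
    Finset.univ.image (edgeTuple r e) = e := by
  simp [edgeTuple, h]

theorem edgeTuple_mem {r : ℕ} {e : Finset ℕ} (h : e.card = r) (j : Fin r) :
    edgeTuple r e j ∈ e := by
  simp [edgeTuple, h]

theorem card_le_cliqueSize {P M S : Finset (Finset ℕ)} (hS : S ⊆ M) (hc : IsPatternClique P S) :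
    S.card ≤ cliqueSize P M := by
  refine le_csSup ⟨M.card, ?_⟩ ⟨S, hS, hc, rfl⟩
  rintro k ⟨T, hT, -, rfl⟩
  exact Finset.card_le_card hT

theorem cliqueSize_le {P M : Finset (Finset ℕ)} {k : ℕ}
    (h : ∀ S ⊆ M, IsPatternClique P S → S.card ≤ k) : cliqueSize P M ≤ k := by
  refine csSup_le ⟨0, ∅, by simp, by simp [IsPatternClique], by simp⟩ ?_
  rintro _ ⟨S, hS, hc, rfl⟩
  exact h S hS hc

theorem finite_setOf_isOrderedMatching (r n : ℕ) :
    {M : Finset (Finset ℕ) | IsOrderedMatching r n M}.Finite := by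
  refine (Finset.Icc 1 (r * n)).powerset.powerset.finite_toSet.subset ?_
  intro M hM
  rw [Finset.mem_coe, Finset.mem_powerset]
  intro e he
  rw [Finset.mem_powerset, ← hM.2.2.2]
  exact Finset.subset_biUnion_of_mem id he

theorem IsOrderedMatching.isCliqueBounded {r n m J : ℕ} {P M : Finset (Finset ℕ)}
    (hM : IsOrderedMatching r n M) (hc : cliqueSize P M < m) (hJ : r * n < 2 ^ J)
    {s : Fin r → Bool} (hs : ∀ e f : Fin r → ℕ, StrictMono e → StrictMono f → TupRel s e f →
      FormsPattern (Finset.univ.image e) (Finset.univ.image f) P) :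
    IsCliqueBounded s J (m - 1) n (M.image (edgeTuple r)) := by
  obtain ⟨hcard, hr, hdisj, hun⟩ := hM
  have hinj : Set.InjOn (edgeTuple r) M := fun e he f hf h => by
    rw [← image_edgeTuple (hr e he), ← image_edgeTuple (hr f hf), h]
  refine ⟨?_, ?_, ?_, ?_⟩
  · intro v hv
    obtain ⟨e, -, rfl⟩ := Finset.mem_image.1 hv
    exact strictMono_edgeTuple r e
  · intro v hv j
    obtain ⟨e, he, rfl⟩ := Finset.mem_image.1 hv
    have : edgeTuple r e j ∈ M.biUnion id :=
      Finset.mem_biUnion.2 ⟨e, he, edgeTuple_mem (hr e he) j⟩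
    rw [hun, Finset.mem_Icc] at this
    omega
  · intro S hS hSc
    set T := M.filter fun e => edgeTuple r e ∈ S with hT
    have hTS : T.image (edgeTuple r) = S := by
      ext v
      simp only [hT, Finset.mem_image, Finset.mem_filter]
      constructor
      · rintro ⟨e, he, rfl⟩
        exact he.2
      · intro hv
        obtain ⟨e, he, rfl⟩ := Finset.mem_image.1 (hS hv)
        exact ⟨e, ⟨he, hv⟩, rfl⟩
    have hTM : T ⊆ M := Finset.filter_subset _ _
    rw [← hTS, Finset.card_image_of_injOn (hinj.mono (Finset.coe_subset.2 hTM))]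
    have := card_le_cliqueSize (P := P) hTM (by
      intro e he f hf hef
      rw [hT, Finset.mem_filter] at he hf
      have := hs _ _ (strictMono_edgeTuple r e) (strictMono_edgeTuple r f)
        (hSc he.2 hf.2 fun h => hef (hinj he.1 hf.1 h))
      rwa [image_edgeTuple (hr e he.1), image_edgeTuple (hr f hf.1)] at this)
    omega
  · rw [Finset.card_image_of_injOn hinj, hcard]

theorem cliqueBoundedCount_le {r n m J t : ℕ} {P : Finset (Finset ℕ)} (hr : 2 ≤ r) (hn : 1 ≤ n)
    (hm : 2 ≤ m) {s : Fin r → Bool} (hs : ∀ e f : Fin r → ℕ, StrictMono e → StrictMono f →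
      TupRel s e f → FormsPattern (Finset.univ.image e) (Finset.univ.image f) P)
    (hJ : r * n < 2 ^ J) (ht : t ≤ J) (htn : (m - 1) * 2 ^ (t * (r - 1)) ≤ n) :
    cliqueBoundedCount r n m P ≤
      (2 * 2 ^ (2 ^ r * cellConst r) * (3 * cellConst r) * (2 ^ (J - t)) ^ r) ^ n := by
  classical
  have hfin : {M : Finset (Finset ℕ) | IsOrderedMatching r n M ∧ cliqueSize P M < m}.Finite :=
    (finite_setOf_isOrderedMatching r n).subset fun M hM => hM.1
  have hcount : cliqueBoundedCount r n m P = hfin.toFinset.card := by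
    rw [cliqueBoundedCount, ← Set.ncard_eq_toFinset_card _ hfin]
    rfl
  have hinj : Set.InjOn (fun M : Finset (Finset ℕ) => M.image (edgeTuple r)) hfin.toFinset := by
    have hrec : ∀ M ∈ hfin.toFinset,
        (M.image (edgeTuple r)).image (fun v => Finset.univ.image v) = M := by
      intro M hM
      rw [Set.Finite.mem_toFinset] at hM
      rw [Finset.image_image]
      conv_rhs => rw [← Finset.image_id (s := M)]
      exact Finset.image_congr fun e he => image_edgeTuple (hM.1.2.1 e he)
    intro M hM M' hM' h
    rw [← hrec M hM, ← hrec M' hM']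
    simp only at h
    rw [h]
  rw [hcount, ← Finset.card_image_of_injOn hinj]
  refine card_le_of_isCliqueBounded (s := s) hr (by omega) hn _ ?_ ht htn
  intro V hV
  obtain ⟨M, hM, rfl⟩ := Finset.mem_image.1 hV
  rw [Set.Finite.mem_toFinset] at hM
  exact hM.1.isCliqueBounded hM.2 hJ hs

/-- The permutations that sort the word `f`. -/
def sortingPerms {n : ℕ} (f : Fin n → ℕ) : Finset (Equiv.Perm (Fin n)) :=
  Finset.univ.filter fun σ => Monotone (f ∘ σ)

theorem mem_sortingPerms {n : ℕ} {f : Fin n → ℕ} {σ : Equiv.Perm (Fin n)} :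
    σ ∈ sortingPerms f ↔ Monotone (f ∘ σ) := by
  simp [sortingPerms]

theorem factorial_le_card_sortingPerms_mul {n q : ℕ} (f : Fin n → ℕ) (hf : ∀ c, f c < q) :
    n.factorial ≤ (sortingPerms f).card * q ^ n := by
  classical
  calc n.factorial = (Finset.univ : Finset (Equiv.Perm (Fin n))).card := by
        rw [Finset.card_univ, Fintype.card_perm, Fintype.card_fin]
    _ ≤ (sortingPerms f).card * (Fintype.piFinset fun _ : Fin n => Finset.range q).card := by
        refine Finset.card_le_mul_card_image_of_maps_to
          (f := fun τ : Equiv.Perm (Fin n) => f ∘ τ) ?_ _ ?_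
        · intro τ _
          rw [Fintype.mem_piFinset]
          exact fun c => Finset.mem_range.2 (hf _)
        · intro w _
          rcases (Finset.univ.filter
            fun τ : Equiv.Perm (Fin n) => f ∘ τ = w).eq_empty_or_nonempty with h | ⟨τ₁, h₁⟩
          · rw [h]
            exact Nat.zero_le _
          refine Finset.card_le_card_of_injOn (fun τ => τ * (τ₁⁻¹ * Tuple.sort f)) ?_
            (mul_left_injective _).injOn
          intro τ hτ
          rw [Finset.mem_coe, mem_sortingPerms]
          have h2 : f ∘ τ = f ∘ τ₁ :=
            (Finset.mem_filter.1 hτ).2.trans (Finset.mem_filter.1 h₁).2.symm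
          have h3 : f ∘ ⇑(τ * (τ₁⁻¹ * Tuple.sort f)) = f ∘ Tuple.sort f := by
            funext c
            have := congrFun h2 (τ₁⁻¹ (Tuple.sort f c))
            simpa using this
          rw [h3]
          exact Tuple.monotone_sort f
    _ = _ := by simp [Fintype.card_piFinset]

/-- The vertices of the edge with label `c` when block `i` is labelled by the permutation `σ i`. -/
def labelTuple {r n : ℕ} (σ : Fin r → Equiv.Perm (Fin n)) (c : Fin n) (i : Fin r) : ℕ :=
  i.val * n + ((σ i)⁻¹ c).val + 1

theorem labelTuple_eq {r n : ℕ} {σ τ : Fin r → Equiv.Perm (Fin n)} {c d : Fin n} {i j : Fin r}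
    (h : labelTuple σ c i = labelTuple τ d j) : i = j ∧ (σ i)⁻¹ c = (τ j)⁻¹ d := by
  unfold labelTuple at h
  have h1 := ((σ i)⁻¹ c).isLt
  have h2 := ((τ j)⁻¹ d).isLt
  have hij : i.val = j.val := by
    rcases lt_trichotomy i.val j.val with hlt | heq | hlt
    · have := Nat.mul_le_mul_right n (Nat.succ_le_of_lt hlt)
      rw [Nat.succ_mul] at this
      omega
    · exact heq
    · have := Nat.mul_le_mul_right n (Nat.succ_le_of_lt hlt)
      rw [Nat.succ_mul] at this
      omega
  rw [hij] at h
  exact ⟨Fin.ext hij, Fin.ext (by omega)⟩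

theorem strictMono_labelTuple {r n : ℕ} (σ : Fin r → Equiv.Perm (Fin n)) (c : Fin n) :
    StrictMono (labelTuple σ c) := by
  intro i j hij
  have h1 := ((σ i)⁻¹ c).isLt
  have := Nat.mul_le_mul_right n (Nat.succ_le_of_lt (Fin.lt_def.1 hij))
  rw [Nat.succ_mul] at this
  unfold labelTuple
  omega

/-- The edge with label `c`. -/
def labelEdge {r n : ℕ} (σ : Fin r → Equiv.Perm (Fin n)) (c : Fin n) : Finset ℕ :=
  Finset.univ.image (labelTuple σ c)

theorem labelEdge_eq {r n : ℕ} {σ τ : Fin r → Equiv.Perm (Fin n)} {c d : Fin n}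
    (h : labelEdge σ c = labelEdge τ d) (i : Fin r) : (σ i)⁻¹ c = (τ i)⁻¹ d := by
  have : labelTuple σ c i ∈ labelEdge τ d := h ▸ Finset.mem_image_of_mem _ (Finset.mem_univ i)
  obtain ⟨j, -, hj⟩ := Finset.mem_image.1 this
  obtain ⟨rfl, h2⟩ := labelTuple_eq hj
  exact h2.symm

theorem labelEdge_injective {r n : ℕ} (hr : 0 < r) (σ : Fin r → Equiv.Perm (Fin n)) :
    Function.Injective (labelEdge σ) := fun _ _ h =>
  (σ ⟨0, hr⟩)⁻¹.injective (labelEdge_eq h _)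

/-- The matching whose edges are indexed by labels. -/
def labelMatching {r n : ℕ} (σ : Fin r → Equiv.Perm (Fin n)) : Finset (Finset ℕ) :=
  Finset.univ.image (labelEdge σ)

theorem isOrderedMatching_labelMatching {r n : ℕ} (hr : 0 < r) (σ : Fin r → Equiv.Perm (Fin n)) :
    IsOrderedMatching r n (labelMatching σ) := by
  refine ⟨?_, ?_, ?_, ?_⟩
  · rw [labelMatching, Finset.card_image_of_injective _ (labelEdge_injective hr σ),
      Finset.card_univ, Fintype.card_fin]
  · intro e he
    obtain ⟨c, -, rfl⟩ := Finset.mem_image.1 he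
    rw [labelEdge, Finset.card_image_of_injective _ (strictMono_labelTuple σ c).injective,
      Finset.card_univ, Fintype.card_fin]
  · intro e he f hf hef
    obtain ⟨c, -, rfl⟩ := Finset.mem_image.1 he
    obtain ⟨d, -, rfl⟩ := Finset.mem_image.1 hf
    rw [Finset.disjoint_left]
    intro x hx hx'
    obtain ⟨i, -, rfl⟩ := Finset.mem_image.1 hx
    obtain ⟨j, -, hj⟩ := Finset.mem_image.1 hx'
    obtain ⟨rfl, h⟩ := labelTuple_eq hj
    exact hef (by rw [(σ j)⁻¹.injective h])
  · ext x
    simp only [labelMatching, Finset.mem_biUnion, Finset.mem_image, Finset.mem_univ, true_and,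
      exists_exists_eq_and, id, labelEdge, Finset.mem_Icc]
    constructor
    · rintro ⟨c, i, rfl⟩
      have h1 := ((σ i)⁻¹ c).isLt
      have := Nat.mul_le_mul_right n (Nat.succ_le_of_lt i.isLt)
      rw [Nat.succ_mul] at this
      unfold labelTuple
      omega
    · rintro ⟨h1, h2⟩
      have hn : 0 < n := Nat.pos_of_ne_zero fun h => by
        rw [h, mul_zero] at h2
        omega
      have hi : (x - 1) / n < r := (Nat.div_lt_iff_lt_mul hn).2 (by omega)
      refine ⟨σ ⟨(x - 1) / n, hi⟩ ⟨(x - 1) % n, Nat.mod_lt _ hn⟩, ⟨(x - 1) / n, hi⟩, ?_⟩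
      have := Nat.div_add_mod' (x - 1) n
      simp [labelTuple]
      omega

/-- The weak version of `SignRel`. -/
def WeakSignRel {r : ℕ} (s : Fin r → Bool) (e f : Fin r → ℕ) : Prop :=
  (∀ j, if s j then e j ≤ f j else f j ≤ e j) ∨ (∀ j, if s j then f j ≤ e j else e j ≤ f j)

theorem cliqueSize_labelMatching_le {r n M : ℕ} {P : Finset (Finset ℕ)}
    {s : Fin r → Bool} (hs : ∀ e f : Fin r → ℕ, StrictMono e → StrictMono f →
      FormsPattern (Finset.univ.image e) (Finset.univ.image f) P → SignRel s e f)
    (w : Fin r → Fin n → ℕ) (hw : ∀ T : Finset (Fin n),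
      (T : Set (Fin n)).Pairwise (fun c d => WeakSignRel s (w · c) (w · d)) → T.card ≤ M)
    {σ : Fin r → Equiv.Perm (Fin n)} (hσ : ∀ i, σ i ∈ sortingPerms (w i)) :
    cliqueSize P (labelMatching σ) ≤ M := by
  classical
  refine cliqueSize_le fun S hS hc => ?_
  set T := Finset.univ.filter fun c => labelEdge σ c ∈ S with hT
  have hST : S ⊆ T.image (labelEdge σ) := by
    intro e he
    obtain ⟨c, -, rfl⟩ := Finset.mem_image.1 (hS he)
    exact Finset.mem_image_of_mem _ (Finset.mem_filter.2 ⟨Finset.mem_univ c, he⟩)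
  refine (Finset.card_le_card hST).trans (Finset.card_image_le.trans (hw T ?_))
  have hle : ∀ {c d : Fin n} {j}, labelTuple σ c j < labelTuple σ d j → w j c ≤ w j d := by
    intro c d j h
    have h1 : (σ j)⁻¹ c ≤ (σ j)⁻¹ d := by
      unfold labelTuple at h
      rw [Fin.le_def]
      omega
    simpa using mem_sortingPerms.1 (hσ j) h1
  intro c hcT d hdT hcd
  by_cases heq : labelEdge σ c = labelEdge σ d
  · refine Or.inl fun j => ?_
    have := (σ j)⁻¹.injective (labelEdge_eq heq j)
    exact absurd this hcd
  have := hs _ _ (strictMono_labelTuple σ c) (strictMono_labelTuple σ d)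
    (hc _ (Finset.mem_filter.1 hcT).2 _ (Finset.mem_filter.1 hdT).2 heq)
  refine this.imp (fun h j => ?_) (fun h j => ?_)
  all_goals
    have := h j
    split_ifs at this ⊢ <;> exact hle this

theorem injOn_labelMatching {r n : ℕ} (w : Fin r → Fin n → ℕ)
    (hinj : ∀ c d, (∀ i, w i c = w i d) → c = d) :
    Set.InjOn labelMatching (Fintype.piFinset fun i => sortingPerms (w i) :
      Set (Fin r → Equiv.Perm (Fin n))) := by
  intro σ hσ τ hτ h
  rw [Finset.mem_coe, Fintype.mem_piFinset] at hσ hτ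
  have hword : ∀ i, w i ∘ σ i = w i ∘ τ i := fun i =>
    Tuple.unique_monotone (mem_sortingPerms.1 (hσ i)) (mem_sortingPerms.1 (hτ i))
  have key : ∀ c i, (σ i)⁻¹ c = (τ i)⁻¹ c := by
    intro c
    have hmem : labelEdge σ c ∈ labelMatching τ :=
      h ▸ Finset.mem_image_of_mem _ (Finset.mem_univ c)
    obtain ⟨d, -, hd⟩ := Finset.mem_image.1 hmem
    have hpos := labelEdge_eq hd.symm
    have hcd : c = d := hinj c d fun i => by
      have := congrFun (hword i) ((σ i)⁻¹ c)
      have h1 : σ i ((σ i)⁻¹ c) = c := (σ i).apply_symm_apply c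
      have h2 : τ i ((τ i)⁻¹ d) = d := (τ i).apply_symm_apply d
      rwa [Function.comp_apply, Function.comp_apply, h1, hpos i, h2] at this
    intro i
    rw [hpos i, hcd]
  funext i
  exact inv_injective (Equiv.ext fun c => key c i)

theorem pow_le_cliqueBoundedCount_mul_of_words {r n M q : ℕ} (hr : 0 < r) {P : Finset (Finset ℕ)}
    {s : Fin r → Bool} (hs : ∀ e f : Fin r → ℕ, StrictMono e → StrictMono f →
      FormsPattern (Finset.univ.image e) (Finset.univ.image f) P → SignRel s e f)
    (w : Fin r → Fin n → ℕ) (hwq : ∀ i c, w i c < q)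
    (hinj : ∀ c d, (∀ i, w i c = w i d) → c = d) (hw : ∀ T : Finset (Fin n),
      (T : Set (Fin n)).Pairwise (fun c d => WeakSignRel s (w · c) (w · d)) → T.card ≤ M) :
    n.factorial ^ r ≤ cliqueBoundedCount r n (M + 1) P * (q ^ n) ^ r := by
  classical
  have hfin : {N : Finset (Finset ℕ) | IsOrderedMatching r n N ∧ cliqueSize P N < M + 1}.Finite :=
    (finite_setOf_isOrderedMatching r n).subset fun M hM => hM.1
  have hcount : cliqueBoundedCount r n (M + 1) P = hfin.toFinset.card := by
    rw [cliqueBoundedCount, ← Set.ncard_eq_toFinset_card _ hfin]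
    rfl
  have h1 : ∏ i, (sortingPerms (w i)).card ≤ hfin.toFinset.card := by
    rw [← Fintype.card_piFinset]
    refine Finset.card_le_card_of_injOn labelMatching ?_ (injOn_labelMatching w hinj)
    intro σ hσ
    rw [Finset.mem_coe, Fintype.mem_piFinset] at hσ
    rw [Finset.mem_coe, Set.Finite.mem_toFinset]
    exact ⟨isOrderedMatching_labelMatching hr σ,
      Nat.lt_succ_of_le (cliqueSize_labelMatching_le hs w hw hσ)⟩
  calc n.factorial ^ r = ∏ _i : Fin r, n.factorial := by simp
    _ ≤ ∏ i, (sortingPerms (w i)).card * q ^ n := Finset.prod_le_prod' fun i _ =>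
        factorial_le_card_sortingPerms_mul (w i) (hwq i)
    _ = (∏ i, (sortingPerms (w i)).card) * (q ^ n) ^ r := by
        rw [Finset.prod_mul_distrib, Finset.prod_const, Finset.card_univ, Fintype.card_fin]
    _ ≤ _ := by
        rw [hcount]
        exact Nat.mul_le_mul_right _ h1

/-- A tuple with the given initial entries and entry sum `N - u`. -/
def sumTuple {ρ k M : ℕ} (N : ℕ) (p : (Fin ρ → Fin k) × Fin M) : Fin (ρ + 1) → ℕ :=
  Fin.snoc (α := fun _ => ℕ) (fun i => (p.1 i).val) (N - ∑ i, (p.1 i).val - p.2.val)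

theorem sumTuple_le {ρ k M N : ℕ} (hk : k ≤ N) (p : (Fin ρ → Fin k) × Fin M) (j : Fin (ρ + 1)) :
    sumTuple N p j ≤ N := by
  unfold sumTuple
  induction j using Fin.lastCases with
  | last =>
    rw [Fin.snoc_last]
    omega
  | cast i =>
    rw [Fin.snoc_castSucc]
    exact (p.1 i).isLt.le.trans hk

theorem sum_sumTuple {ρ k M : ℕ} (hMk : M ≤ k) (p : (Fin ρ → Fin k) × Fin M) :
    ∑ j, sumTuple ((ρ + 1) * k) p j + p.2.val = (ρ + 1) * k := by
  unfold sumTuple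
  rw [Fin.sum_univ_castSucc]
  simp only [Fin.snoc_castSucc, Fin.snoc_last]
  have h1 : ∑ i, (p.1 i).val ≤ ρ * k := by
    calc ∑ i, (p.1 i).val ≤ ∑ _i : Fin ρ, k := Finset.sum_le_sum fun i _ => (p.1 i).isLt.le
      _ = ρ * k := by simp
  have h2 := p.2.isLt
  have h3 : (ρ + 1) * k = ρ * k + k := by ring
  omega

theorem sumTuple_injective {ρ k M : ℕ} (hMk : M ≤ k) :
    Function.Injective (sumTuple (ρ := ρ) (k := k) (M := M) ((ρ + 1) * k)) := by
  intro p p' h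
  have h1 := sum_sumTuple hMk p
  have h2 := sum_sumTuple hMk p'
  rw [h] at h1
  refine Prod.ext (funext fun i => Fin.ext ?_) (Fin.ext (by omega))
  have := congrFun h i.castSucc
  simpa [sumTuple] using this

/-- The words built from the tuples `sumTuple`, reversed in the coordinates with sign `false`. -/
def slabWord {ρ k M : ℕ} (s : Fin (ρ + 1) → Bool) (N : ℕ) (p : (Fin ρ → Fin k) × Fin M)
    (j : Fin (ρ + 1)) : ℕ :=
  if s j then sumTuple N p j else N - sumTuple N p j

theorem sumTuple_le_of_slabWord {ρ k M N : ℕ} (hk : k ≤ N) {s : Fin (ρ + 1) → Bool}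
    {p p' : (Fin ρ → Fin k) × Fin M} {j : Fin (ρ + 1)}
    (h : if s j then slabWord s N p j ≤ slabWord s N p' j
      else slabWord s N p' j ≤ slabWord s N p j) : sumTuple N p j ≤ sumTuple N p' j := by
  have h1 := sumTuple_le hk p j
  have h2 := sumTuple_le hk p' j
  unfold slabWord at h
  split_ifs at h <;> omega

theorem eq_of_weakSignRel_slabWord {ρ k M : ℕ} (hMk : M ≤ k) {s : Fin (ρ + 1) → Bool}
    {p p' : (Fin ρ → Fin k) × Fin M} (hu : p.2 = p'.2)
    (h : WeakSignRel s (slabWord s ((ρ + 1) * k) p) (slabWord s ((ρ + 1) * k) p')) : p = p' := by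
  have hk : k ≤ (ρ + 1) * k := Nat.le_mul_of_pos_left _ (by omega)
  have h1 := sum_sumTuple hMk p
  have h2 := sum_sumTuple hMk p'
  rw [hu] at h1
  refine sumTuple_injective hMk (funext fun j => ?_)
  rcases h with h | h
  · exact (Finset.sum_eq_sum_iff_of_le fun j _ => sumTuple_le_of_slabWord hk (h j)).1
      (by omega) j (Finset.mem_univ j)
  · exact ((Finset.sum_eq_sum_iff_of_le fun j _ => sumTuple_le_of_slabWord hk (h j)).1
      (by omega) j (Finset.mem_univ j)).symm

theorem pow_le_cliqueBoundedCount_mul {r n M k : ℕ} (hr : 0 < r) {P : Finset (Finset ℕ)}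
    {s : Fin r → Bool} (hs : ∀ e f : Fin r → ℕ, StrictMono e → StrictMono f →
      FormsPattern (Finset.univ.image e) (Finset.univ.image f) P → SignRel s e f)
    (hk : 1 ≤ k) (hMk : M ≤ k) (hn : n ≤ k ^ (r - 1) * M) :
    (n ^ n) ^ r ≤ cliqueBoundedCount r n (M + 1) P * ((6 * r * k) ^ n) ^ r := by
  classical
  obtain ⟨ρ, rfl⟩ : ∃ ρ, r = ρ + 1 := ⟨r - 1, by omega⟩
  rw [Nat.add_sub_cancel] at hn
  obtain ⟨c⟩ : Nonempty (Fin n ↪ (Fin ρ → Fin k) × Fin M) := by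
    refine Function.Embedding.nonempty_of_card_le ?_
    simpa using hn
  have hkN : k ≤ (ρ + 1) * k := Nat.le_mul_of_pos_left _ (by omega)
  have hmain := pow_le_cliqueBoundedCount_mul_of_words (M := M) (q := (ρ + 1) * k + 1) hr hs
    (fun j x => slabWord s ((ρ + 1) * k) (c x) j)
    (by
      intro i x
      have := sumTuple_le hkN (c x) i
      simp only [slabWord]
      split_ifs <;> omega)
    (by
      intro x y hxy
      refine c.injective (sumTuple_injective hMk (funext fun j => ?_))
      have h1 := hxy j
      have h2 := sumTuple_le hkN (c x) j
      have h3 := sumTuple_le hkN (c y) j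
      simp only [slabWord] at h1
      split_ifs at h1 <;> omega)
    (by
      intro T hT
      calc T.card ≤ (Finset.univ : Finset (Fin M)).card := by
            refine Finset.card_le_card_of_injOn (fun x => (c x).2)
              (fun _ _ => Finset.mem_coe.2 (Finset.mem_univ _)) ?_
            intro x hx y hy hxy
            by_contra hne
            exact hne (c.injective (eq_of_weakSignRel_slabWord hMk hxy (hT hx hy hne)))
        _ = M := by simp)
  calc (n ^ n) ^ (ρ + 1) ≤ (3 ^ n * n.factorial) ^ (ρ + 1) :=
        Nat.pow_le_pow_left (pow_self_le_three_pow_mul_factorial n) _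
    _ = (3 ^ n) ^ (ρ + 1) * n.factorial ^ (ρ + 1) := mul_pow _ _ _
    _ ≤ (3 ^ n) ^ (ρ + 1) * (cliqueBoundedCount (ρ + 1) n (M + 1) P *
        (((ρ + 1) * k + 1) ^ n) ^ (ρ + 1)) := Nat.mul_le_mul_left _ hmain
    _ = cliqueBoundedCount (ρ + 1) n (M + 1) P *
        ((3 * ((ρ + 1) * k + 1)) ^ n) ^ (ρ + 1) := by
        rw [mul_pow 3, mul_pow (3 ^ n)]
        ring
    _ ≤ _ := by
        have : 3 * ((ρ + 1) * k + 1) ≤ 6 * (ρ + 1) * k := by nlinarith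
        gcongr

/-- The side length `x` at which `n` unit points, at most `M` of them comparable, fill a cube. -/
theorem exists_scale {r : ℕ} (hr : 2 ≤ r) {M n : ℝ} (hM : 0 < M) (hn : 0 < n) :
    ∃ x : ℝ, 0 < x ∧ x ^ (r - 1) * M = n ∧ ∀ N : ℕ,
      M ^ (((r : ℝ) / ((r : ℝ) - 1)) * (N : ℝ)) *
        n ^ ((((r : ℝ) - 1) - 1 / ((r : ℝ) - 1)) * (N : ℝ)) = ((n / x) ^ r) ^ N := by
  have hq : (0 : ℝ) < (r : ℝ) - 1 := by
    have : (2 : ℝ) ≤ r := by exact_mod_cast hr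
    linarith
  obtain ⟨a, rfl⟩ : ∃ a, Real.exp a = M := ⟨_, Real.exp_log hM⟩
  obtain ⟨b, rfl⟩ : ∃ b, Real.exp b = n := ⟨_, Real.exp_log hn⟩
  refine ⟨Real.exp ((b - a) / ((r : ℝ) - 1)), Real.exp_pos _, ?_, fun N => ?_⟩
  · rw [← Real.exp_nat_mul, ← Real.exp_add, Nat.cast_sub (by omega), Nat.cast_one,
      mul_div_cancel₀ _ hq.ne', sub_add_cancel]
  · rw [← Real.exp_mul, ← Real.exp_mul, ← Real.exp_add, ← Real.exp_sub, ← Real.exp_nat_mul,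
      ← Real.exp_nat_mul]
    congr 1
    field_simp
    ring

theorem exists_dyadic_scale {r n M : ℕ} (hr : 2 ≤ r) (hM : 1 ≤ M) (hMn : M ≤ n) {x : ℝ}
    (hx : 0 < x) (hxn : x ^ (r - 1) * M = n) :
    ∃ J t : ℕ, r * n < 2 ^ J ∧ t ≤ J ∧ M * 2 ^ (t * (r - 1)) ≤ n ∧
      (2 : ℝ) ^ (J - t) ≤ 4 * r * (n / x) := by
  have hn : 1 ≤ n := hM.trans hMn
  have hbound : ∀ t : ℕ, M * 2 ^ (t * (r - 1)) ≤ n → 2 ^ t ≤ n := fun t ht =>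
    calc 2 ^ t ≤ 2 ^ (t * (r - 1)) :=
          Nat.pow_le_pow_right (by norm_num) (Nat.le_mul_of_pos_right _ (by omega))
      _ ≤ M * 2 ^ (t * (r - 1)) := Nat.le_mul_of_pos_left _ hM
      _ ≤ n := ht
  have hfind : ∃ t, n < M * 2 ^ ((t + 1) * (r - 1)) := by
    by_contra! h
    have h1 := hbound _ (h n)
    have h2 : n + 1 < 2 ^ (n + 1) := Nat.lt_two_pow_self
    omega
  have hspec := Nat.find_spec hfind
  set t := Nat.find hfind with ht
  have htn : M * 2 ^ (t * (r - 1)) ≤ n := by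
    rcases t.eq_zero_or_pos with h0 | h0
    · simpa [h0] using hMn
    · have := Nat.find_min hfind (m := t - 1) (by omega)
      rwa [Nat.sub_add_cancel h0, not_lt] at this
  have hrn : n ≤ r * n := Nat.le_mul_of_pos_left _ (by omega)
  have hJ : r * n < 2 ^ (Nat.log 2 (r * n) + 1) := Nat.lt_pow_succ_log_self (by norm_num) _
  have hJ' : 2 ^ (Nat.log 2 (r * n) + 1) ≤ 2 * (r * n) := by
    rw [pow_succ, mul_comm]
    exact Nat.mul_le_mul_left _ (Nat.pow_log_le_self _ (by omega))
  have htJ : t ≤ Nat.log 2 (r * n) + 1 :=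
    ((Nat.pow_lt_pow_iff_right (by norm_num)).1
      (((hbound t htn).trans hrn).trans_lt hJ)).le
  refine ⟨_, t, hJ, htJ, htn, ?_⟩
  have hxt : x < 2 ^ (t + 1) := by
    have hM' : (0 : ℝ) < M := by exact_mod_cast hM
    have : (n : ℝ) < M * 2 ^ ((t + 1) * (r - 1)) := by exact_mod_cast hspec
    rw [← hxn, mul_comm, mul_lt_mul_iff_right₀ hM', pow_mul] at this
    exact lt_of_pow_lt_pow_left₀ _ (by positivity) this
  have h2 : (2 : ℝ) ^ (Nat.log 2 (r * n) + 1) ≤ 2 * (r * n) := by exact_mod_cast hJ'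
  rw [← mul_div_assoc, le_div_iff₀ hx]
  calc (2 : ℝ) ^ (Nat.log 2 (r * n) + 1 - t) * x
      ≤ 2 ^ (Nat.log 2 (r * n) + 1 - t) * 2 ^ (t + 1) := by gcongr
    _ = 2 * 2 ^ (Nat.log 2 (r * n) + 1) := by
        rw [← pow_add, ← pow_succ']
        congr 1
        omega
    _ ≤ 4 * r * n := by linarith

theorem exists_cube_side {r n M : ℕ} (hr : 2 ≤ r) (hM : 1 ≤ M) (hMn : (M + 1) ^ r ≤ n) {x : ℝ}
    (hx : 0 < x) (hxn : x ^ (r - 1) * M = n) :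
    ∃ k : ℕ, 1 ≤ k ∧ M ≤ k ∧ n ≤ k ^ (r - 1) * M ∧ (k : ℝ) ≤ 2 * x := by
  have hM' : (0 : ℝ) < M := by exact_mod_cast hM
  have hMx : (M : ℝ) ≤ x := by
    refine le_of_pow_le_pow_left₀ (n := r - 1) (by omega) hx.le ?_
    refine le_of_mul_le_mul_right ?_ hM'
    rw [hxn, ← pow_succ, Nat.sub_add_cancel (by omega)]
    exact_mod_cast (Nat.pow_le_pow_left (Nat.le_succ M) r).trans hMn
  have h1x : 1 ≤ x := le_trans (by exact_mod_cast hM) hMx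
  refine ⟨⌈x⌉₊, Nat.ceil_pos.2 hx, by exact_mod_cast hMx.trans (Nat.le_ceil x), ?_, ?_⟩
  · have : (n : ℝ) ≤ (⌈x⌉₊ : ℝ) ^ (r - 1) * M := by
      rw [← hxn]
      gcongr
      exact Nat.le_ceil x
    exact_mod_cast this
  · linarith [Nat.ceil_lt_add_one hx.le]

theorem exists_cliqueBoundedCount_le {r : ℕ} (hr : 2 ≤ r) {P : Finset (Finset ℕ)}
    {s : Fin r → Bool}
    (hs : ∀ e f : Fin r → ℕ, StrictMono e → StrictMono f → TupRel s e f →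
      FormsPattern (Finset.univ.image e) (Finset.univ.image f) P) :
    ∃ K : ℝ, 1 ≤ K ∧ ∀ (n M : ℕ) (x : ℝ), 1 ≤ M → M ≤ n → 0 < x → x ^ (r - 1) * M = n →
      (cliqueBoundedCount r n (M + 1) P : ℝ) ≤ (K * (n / x) ^ r) ^ n := by
  have hr' : (1 : ℝ) ≤ r := by exact_mod_cast (by omega : 1 ≤ r)
  have hc : (1 : ℝ) ≤ cellConst r := by
    have : r ≤ cellConst r := Nat.le_add_left _ _
    exact_mod_cast (by omega : 1 ≤ cellConst r)
  refine ⟨2 * 2 ^ (2 ^ r * cellConst r) * (3 * cellConst r) * (4 * r) ^ r, ?_,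
    fun n M x hM hMn hx hxn => ?_⟩
  · have h1 : (1 : ℝ) ≤ 2 ^ (2 ^ r * cellConst r) := one_le_pow₀ (by norm_num)
    have h2 : (1 : ℝ) ≤ (4 * r) ^ r := one_le_pow₀ (by linarith)
    exact one_le_mul_of_one_le_of_one_le
      (one_le_mul_of_one_le_of_one_le (by linarith) (by linarith)) h2
  · obtain ⟨J, t, hJ, ht, htn, hle⟩ := exists_dyadic_scale hr hM hMn hx hxn
    have h := cliqueBoundedCount_le (m := M + 1) hr (hM.trans hMn) (by omega) hs hJ ht htn
    calc (cliqueBoundedCount r n (M + 1) P : ℝ)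
        ≤ (2 * 2 ^ (2 ^ r * cellConst r) * (3 * cellConst r) * (2 ^ (J - t)) ^ r) ^ n := by
          exact_mod_cast h
      _ ≤ (2 * 2 ^ (2 ^ r * cellConst r) * (3 * cellConst r) * (4 * r * (n / x)) ^ r) ^ n := by
          gcongr
      _ = _ := by rw [mul_pow (4 * (r : ℝ)), ← mul_assoc]

theorem pow_le_mul_cliqueBoundedCount {r n M : ℕ} (hr : 2 ≤ r) {P : Finset (Finset ℕ)}
    {s : Fin r → Bool}
    (hs : ∀ e f : Fin r → ℕ, StrictMono e → StrictMono f →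
      FormsPattern (Finset.univ.image e) (Finset.univ.image f) P → SignRel s e f)
    (hM : 1 ≤ M) (hMn : (M + 1) ^ r ≤ n) {x : ℝ} (hx : 0 < x) (hxn : x ^ (r - 1) * M = n) :
    ((n / x) ^ r) ^ n ≤ ((12 * r : ℝ) ^ r) ^ n * cliqueBoundedCount r n (M + 1) P := by
  obtain ⟨k, hk, hMk, hnk, hkx⟩ := exists_cube_side hr hM hMn hx hxn
  have h : (((n : ℝ) ^ n) ^ r) ≤ cliqueBoundedCount r n (M + 1) P * ((6 * r * k) ^ n) ^ r := by
    exact_mod_cast pow_le_cliqueBoundedCount_mul (by omega) hs hk hMk hnk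
  rw [div_pow, div_pow, div_le_iff₀ (by positivity)]
  calc ((n : ℝ) ^ r) ^ n = ((n : ℝ) ^ n) ^ r := pow_right_comm _ _ _
    _ ≤ cliqueBoundedCount r n (M + 1) P * ((6 * r * k) ^ n) ^ r := h
    _ ≤ cliqueBoundedCount r n (M + 1) P * ((6 * r * (2 * x)) ^ n) ^ r := by gcongr
    _ = _ := by
        rw [pow_right_comm, show 6 * (r : ℝ) * (2 * x) = 12 * r * x by ring, mul_pow (12 * (r : ℝ)),
          mul_pow]
        ring

/-- **Theorem 1.8.** For a fixed `r ≥ 2` and an `r`-partite `r`-pattern `P`,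
for all `2 ≤ m` with `m^r ≤ n`,
`N_{P,m}(n) = e^{O_r(n)} · (m-1)^{(r/(r-1))n} · n^{(r-1-1/(r-1))n}`. -/
theorem count_clique_bounded (r : ℕ) (hr : 2 ≤ r)
    (P : Finset (Finset ℕ)) (hP : IsPattern r P) (hpart : IsPartite r 2 P) :
    ∃ C : ℝ, 0 < C ∧ ∀ n m : ℕ, 1 ≤ n → 2 ≤ m → m ^ r ≤ n →
      Real.exp (-(C * n)) * ((m : ℝ) - 1) ^ (((r : ℝ) / ((r : ℝ) - 1)) * (n : ℝ))
            * (n : ℝ) ^ ((((r : ℝ) - 1) - 1 / ((r : ℝ) - 1)) * (n : ℝ))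
          ≤ (cliqueBoundedCount r n m P : ℝ) ∧
      (cliqueBoundedCount r n m P : ℝ)
          ≤ Real.exp (C * n) * ((m : ℝ) - 1) ^ (((r : ℝ) / ((r : ℝ) - 1)) * (n : ℝ))
            * (n : ℝ) ^ ((((r : ℝ) - 1) - 1 / ((r : ℝ) - 1)) * (n : ℝ)) := by
  obtain ⟨s, hs⟩ := exists_signs hP hpart
  obtain ⟨K, hK, hupper⟩ := exists_cliqueBoundedCount_le hr fun e f he hf => (hs e f he hf).1
  have hL : (1 : ℝ) ≤ (12 * r) ^ r := by
    have : (2 : ℝ) ≤ r := by exact_mod_cast hr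
    exact one_le_pow₀ (by linarith)
  set L : ℝ := (12 * r) ^ r with hLdef
  have hKL : 0 < K * L := by positivity
  refine ⟨Real.log (K * L) + 1,
    by linarith [Real.log_nonneg (one_le_mul_of_one_le_of_one_le hK hL)], ?_⟩
  have hexp : K * L ≤ Real.exp (Real.log (K * L) + 1) := by
    rw [← Real.log_le_iff_le_exp hKL]
    linarith
  have hKexp := (le_mul_of_one_le_right (by linarith) hL).trans hexp
  have hLexp := (le_mul_of_one_le_left (by linarith) hK).trans hexp
  intro n m hn hm hmn
  obtain ⟨M, rfl⟩ : ∃ M, m = M + 1 := ⟨m - 1, by omega⟩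
  have hM : 1 ≤ M := by omega
  have hMn : M ≤ n := (M.le_succ.trans (Nat.le_self_pow (by omega) _)).trans hmn
  obtain ⟨x, hx, hxn, hprod⟩ := exists_scale hr (M := M) (n := n) (by exact_mod_cast hM)
    (by exact_mod_cast hn)
  rw [mul_assoc, mul_assoc, Nat.cast_succ, add_sub_cancel_right, hprod, Real.exp_neg,
    mul_comm _ (n : ℝ), Real.exp_nat_mul, inv_mul_le_iff₀ (by positivity)]
  constructor
  · refine (pow_le_mul_cliqueBoundedCount hr (fun e f he hf => (hs e f he hf).2) hM hmn hx
      hxn).trans ?_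
    gcongr
  · refine (hupper n M x hM hMn hx hxn).trans ?_
    rw [mul_pow]
    gcongr
end
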